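/- arXiv:1212.6735 — 2 statements merged into one kernel-verified Lean document; each statement's English description precedes it below -/
import Mathlib

section
/- For every ε > 0 there exists n₀ such that every edge-coloured graph G on n ≥ n₀ vertices with δ₁^c(G) ≥ (2/3 + ε)n contains a properly coloured cycle of length ℓ for every 3 ≤ ℓ ≤ n. -/
open SimpleGraph

/-- A list of vertices forms a properly coloured walk: consecutive vertices are
adjacent and consecutive edges receive different colours. -/
def IsPCWalk {V : Type*} (G : SimpleGraph V) (c : V → V → ℕ) : List V → Prop
  | a :: b :: d :: rest => G.Adj a b ∧ c a b ≠ c b d ∧ IsPCWalk G c (b :: d :: rest)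
  | [a, b] => G.Adj a b
  | _ => True

/-- A properly coloured path: distinct vertices forming a properly coloured walk. -/
def IsPCPath {V : Type*} (G : SimpleGraph V) (c : V → V → ℕ) (l : List V) : Prop :=
  l.Nodup ∧ IsPCWalk G c l

/-- A properly coloured cycle, given as a list of (distinct) vertices of length ≥ 3;
closing the cycle by appending the first two vertices ensures all adjacencies and
colour conditions, including around the wrap-around vertex. -/
def IsPCCycle {V : Type*} (G : SimpleGraph V) (c : V → V → ℕ) (l : List V) : Prop :=
  3 ≤ l.length ∧ l.Nodup ∧ IsPCWalk G c (l ++ l.take 2)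

/-- The colour degree of `v`: the number of distinct colours on edges at `v`. -/
noncomputable def colourDeg {V : Type*} (G : SimpleGraph V) (c : V → V → ℕ) (v : V) : ℕ :=
  ((c v) '' {w | G.Adj v w}).ncard

/-- `colourDeg1 G c v a`: the number of edges at `v` whose colour differs from `a`.
`δ₁^c(G) ≥ k` is then `∀ v a, k ≤ colourDeg1 G c v a`. -/
noncomputable def colourDeg1 {V : Type*} (G : SimpleGraph V) (c : V → V → ℕ) (v : V) (a : ℕ) : ℕ :=
  {w | G.Adj v w ∧ c v w ≠ a}.ncard

section Walks

variable {V : Type*} {G : SimpleGraph V} {c : V → V → ℕ}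

lemma IsPCWalk.of_cons {a : V} {l : List V} (h : IsPCWalk G c (a :: l)) : IsPCWalk G c l := by
  match l, h with
  | [], _ => trivial
  | [_], _ => trivial
  | _ :: _ :: _, h => exact h.2.2

/-- A walk may be cut at any of its edges. -/
lemma isPCWalk_append_cons_cons (l₁ l₂ : List V) (a b : V) :
    IsPCWalk G c (l₁ ++ a :: b :: l₂) ↔
      IsPCWalk G c (l₁ ++ [a, b]) ∧ IsPCWalk G c (a :: b :: l₂) := by
  induction l₁ with
  | nil =>
    refine ⟨fun h => ⟨?_, h⟩, fun h => h.2⟩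
    cases l₂ with
    | nil => exact h
    | cons d l => exact h.1
  | cons x l ih =>
    match l, ih with
    | [], ih => simp only [List.nil_append, List.cons_append, IsPCWalk] at ih ⊢; tauto
    | [y], ih => simp only [List.nil_append, List.cons_append, IsPCWalk] at ih ⊢; tauto
    | y :: z :: l, ih => simp only [List.cons_append, IsPCWalk] at ih ⊢; tauto

/-- `x, y` are the inner vertices of a properly coloured path from `u` to `v` with three edges, whose
first edge avoids the colour `a` and whose last edge avoids the colour `a'`. -/
def Connects (G : SimpleGraph V) (c : V → V → ℕ) (u : V) (a : ℕ) (v : V) (a' : ℕ) (x y : V) : Prop :=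
  (G.Adj u x ∧ c u x ≠ a) ∧ (G.Adj v y ∧ c v y ≠ a') ∧
    (G.Adj x y ∧ c x y ≠ c x u) ∧ (G.Adj y x ∧ c y x ≠ c y v)

/-- Between any two ends there is a connection inside `R` avoiding a given set of `κ` vertices. -/
def Supply (G : SimpleGraph V) (c : V → V → ℕ) (R : Finset V) (κ : ℕ) : Prop :=
  ∀ (u : V) (a : ℕ) (v : V) (a' : ℕ) (Z : Finset V), Z.card ≤ κ →
    ∃ x ∈ R, ∃ y ∈ R, x ∉ Z ∧ y ∉ Z ∧ Connects G c u a v a' x y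

/-- The second list is a properly coloured walk with the same two vertices as the first at either end. -/
def SameEnds (G : SimpleGraph V) (c : V → V → ℕ) (P P' : List V) : Prop :=
  IsPCWalk G c P' ∧ P'.take 2 = P.take 2 ∧ P'.reverse.take 2 = P.reverse.take 2

lemma isPCWalk_connect (hc : ∀ u v, c u v = c v u) {b₁ b₂ v x y : V} {a' : ℕ} {P : List V}
    (hb : G.Adj b₁ b₂) (h : Connects G c b₂ (c b₁ b₂) v a' x y) (hP : IsPCWalk G c (v :: P))
    (ha : ∀ w ∈ P.head?, a' = c v w) : IsPCWalk G c (b₁ :: b₂ :: x :: y :: v :: P) := by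
  obtain ⟨⟨h1, h2⟩, ⟨h3, h4⟩, ⟨h5, h6⟩, h7, h8⟩ := h
  have hy : IsPCWalk G c (y :: v :: P) := by
    cases P with
    | nil => exact h3.symm
    | cons w P =>
      refine ⟨h3.symm, ?_, hP⟩
      rw [hc y v, ← ha w (by simp)]
      exact h4
  refine ⟨hb, h2.symm, h1, ?_, h5, ?_, hy⟩
  · rw [hc b₂ x]; exact h6.symm
  · rw [hc x y]; exact h8

lemma exists_eq_append_pair (y v : V) (P : List V) :
    ∃ l b₁ b₂, y :: v :: P = l ++ [b₁, b₂] := by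
  induction P generalizing y v with
  | nil => exact ⟨[], y, v, rfl⟩
  | cons w P ih =>
    obtain ⟨l, b₁, b₂, h⟩ := ih v w
    exact ⟨y :: l, b₁, b₂, by rw [h]; rfl⟩

lemma isPCWalk_pair_adj {l : List V} {a b : V} (h : IsPCWalk G c (l ++ [a, b])) : G.Adj a b :=
  ((isPCWalk_append_cons_cons l [] a b).1 h).2

/-- Walks can be chained through a supply of connections, so that the connecting vertices still work
after the walks have been replaced by walks with the same ends. -/
lemma exists_chain (hc : ∀ u v, c u v = c v u) {R : Finset V} {κ : ℕ} (hR : Supply G c R κ)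
    {a₁ a₂ : V} (hadj : G.Adj a₁ a₂) (Ps : List (List V)) :
    ∀ (b₁ b₂ : V) (Z : Finset V), G.Adj b₁ b₂ → (∀ P ∈ Ps, P ≠ [] ∧ IsPCWalk G c P) →
      Z.card + 2 * Ps.length ≤ κ →
      ∃ Q : List V, Q.Nodup ∧ (∀ q ∈ Q, q ∈ R ∧ q ∉ Z) ∧ Q.length = 2 * (Ps.length + 1) ∧
        ∀ Ps', List.Forall₂ (SameEnds G c) Ps Ps' →
          ∃ r, r.Perm (Q ++ Ps'.flatten) ∧ IsPCWalk G c (b₁ :: b₂ :: (r ++ [a₁, a₂])) := by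
  classical
  induction Ps with
  | nil =>
    intro b₁ b₂ Z hb _ hZ
    obtain ⟨x, hx, y, hy, hxZ, hyZ, hcon⟩ := hR b₂ (c b₁ b₂) a₁ (c a₁ a₂) Z (by simpa using hZ)
    refine ⟨[x, y], ?_, ?_, rfl, ?_⟩
    · simpa using hcon.2.2.1.1.ne
    · simp [hx, hy, hxZ, hyZ]
    · intro Ps' h
      rw [List.forall₂_nil_left_iff.1 h]
      exact ⟨[x, y], by simp, isPCWalk_connect hc hb hcon hadj (by simp)⟩
  | cons P Ps ih =>
    intro b₁ b₂ Z hb hPs hZ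
    obtain ⟨hne, hP⟩ := hPs P (by simp)
    obtain ⟨v, P, rfl⟩ := List.exists_cons_of_ne_nil hne
    obtain ⟨a', ha'⟩ : ∃ a', ∀ w ∈ P.head?, a' = c v w := by
      cases P with
      | nil => exact ⟨0, by simp⟩
      | cons w P => exact ⟨c v w, by simp⟩
    rw [List.length_cons] at hZ
    obtain ⟨x, hx, y, hy, hxZ, hyZ, hcon⟩ := hR b₂ (c b₁ b₂) v a' Z (by omega)
    obtain ⟨l, e₁, e₂, hl⟩ := exists_eq_append_pair y v P
    have hw := isPCWalk_connect hc hb hcon hP ha'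
    have he : G.Adj e₁ e₂ := by
      have : IsPCWalk G c (b₁ :: b₂ :: x :: (y :: v :: P)) := hw
      rw [hl] at this
      exact isPCWalk_pair_adj (l := b₁ :: b₂ :: x :: l) this
    obtain ⟨Q, hQ, hQR, hQl, hQc⟩ := ih e₁ e₂ (insert x (insert y Z)) he
      (fun P hP => hPs P (by simp [hP])) (by
        have := Finset.card_insert_le x (insert y Z)
        have := Finset.card_insert_le y Z
        omega)
    refine ⟨x :: y :: Q, ?_, ?_, by simp [hQl]; ring, ?_⟩
    · have hxy : x ≠ y := hcon.2.2.1.1.ne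
      have h1 : x ∉ Q := fun h => by simpa using (hQR x h).2
      have h2 : y ∉ Q := fun h => by simpa using (hQR y h).2
      simp [hxy, h1, h2, hQ]
    · intro q hq
      simp only [List.mem_cons] at hq
      rcases hq with rfl | rfl | hq
      · exact ⟨hx, hxZ⟩
      · exact ⟨hy, hyZ⟩
      · have := hQR q hq
        simp only [Finset.mem_insert, not_or] at this
        exact ⟨this.1, this.2.2.2⟩
    · intro Ps' h
      cases h with
      | @cons _ P' _ Ps' hs h =>
      obtain ⟨hs1, hs2, hs3⟩ := hs
      obtain ⟨r, hr, hrw⟩ := hQc Ps' h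
      obtain ⟨P', rfl⟩ : ∃ P'', P' = v :: P'' := by
        cases P' with
        | nil => simp at hs2
        | cons v' P' => simp at hs2; exact ⟨P', by rw [hs2.1]⟩
      have hhead : P'.head? = P.head? := by
        cases P' <;> cases P <;> simp_all
      obtain ⟨l', e₁', e₂', hl'⟩ := exists_eq_append_pair y v P'
      have hee : e₁' = e₁ ∧ e₂' = e₂ := by
        have e1 : (y :: v :: P').reverse.take 2 = (y :: v :: P).reverse.take 2 := by
          rw [List.reverse_cons (as := v :: P'), List.reverse_cons (as := v :: P),
            List.take_append, List.take_append, hs3]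
          have : (v :: P').reverse.length = 1 ↔ (v :: P).reverse.length = 1 := by
            cases P' <;> cases P <;> simp_all
          congr 2
          have h1 : 0 < (v :: P').reverse.length := by simp
          have h2 : 0 < (v :: P).reverse.length := by simp
          omega
        rw [hl, hl'] at e1
        simp at e1
        exact ⟨e1.2, e1.1⟩
      obtain ⟨rfl, rfl⟩ := hee
      have hw' := isPCWalk_connect hc hb hcon hs1 (by rw [hhead]; exact ha')
      refine ⟨x :: (y :: v :: P') ++ r, ?_, ?_⟩
      · simp only [List.cons_append, List.flatten_cons]
        refine List.Perm.cons _ (List.Perm.cons _ ?_)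
        have : (v :: (P' ++ r)).Perm ((v :: P') ++ (Q ++ Ps'.flatten)) := hr.append_left (v :: P')
        refine this.trans ?_
        rw [← List.append_assoc]
        refine (List.perm_append_comm.append_right _).trans ?_
        simp
      · have e2 : b₁ :: b₂ :: (x :: (y :: v :: P') ++ r ++ [a₁, a₂]) =
            (b₁ :: b₂ :: x :: l') ++ e₁' :: e₂' :: (r ++ [a₁, a₂]) := by
          rw [hl']; simp
        rw [e2, isPCWalk_append_cons_cons]
        refine ⟨?_, hrw⟩
        have : IsPCWalk G c (b₁ :: b₂ :: x :: (y :: v :: P')) := hw'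
        rw [hl'] at this
        simpa using this

end Walks

section Counting

open scoped Classical
open Finset

variable {V : Type*} [Fintype V] {G : SimpleGraph V} {c : V → V → ℕ}

/-- The vertices to which one cannot go from `v` along an edge of colour different from `a`. -/
noncomputable def badSet (G : SimpleGraph V) (c : V → V → ℕ) (v : V) (a : ℕ) : Finset V :=
  univ.filter fun w => ¬ (G.Adj v w ∧ c v w ≠ a)

lemma mem_badSet {v w : V} {a : ℕ} : w ∈ badSet G c v a ↔ ¬ (G.Adj v w ∧ c v w ≠ a) := by
  simp only [badSet, mem_filter, mem_univ, true_and]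

lemma notMem_badSet {v w : V} {a : ℕ} : w ∉ badSet G c v a ↔ G.Adj v w ∧ c v w ≠ a := by
  rw [mem_badSet, not_not]

lemma card_compl_union_ge (A B : Finset V) :
    Fintype.card V ≤ #(A ∪ B)ᶜ + #A + #B := by
  have h1 := card_compl_add_card (A ∪ B)
  have h2 := card_union_le A B
  omega

lemma exists_isPCCycle_three (hc : ∀ u v, c u v = c v u) {b : ℕ}
    (hb : ∀ v a, #(badSet G c v a) ≤ b) (hn : 3 * b < Fintype.card V) :
    ∃ l : List V, IsPCCycle G c l ∧ l.length = 3 := by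
  by_contra! hno
  have hrain : ∀ x y z, G.Adj x y → G.Adj y z → G.Adj z x → c x y ≠ c y z → c y z ≠ c z x →
      c z x ≠ c x y → False := by
    intro x y z h1 h2 h3 h4 h5 h6
    refine hno [x, y, z] ⟨by simp, by simp [h1.ne, h2.ne, h3.ne.symm], ?_⟩ rfl
    exact ⟨h1, h4, h2, h5, h3, h6, h1⟩
  obtain ⟨v⟩ : Nonempty V := Fintype.card_pos_iff.1 (by omega)
  set N : Finset V := univ.filter fun w => G.Adj v w with hN
  let r : V → V → Prop := fun x y => G.Adj x y ∧ c x y ≠ c v x ∧ c v x ≠ c v y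
  have hcount := sum_card_bipartiteAbove_eq_sum_card_bipartiteBelow (s := N) (t := N) r
  have hNe : N.Nonempty := by
    rw [nonempty_iff_ne_empty]
    intro h
    have : badSet G c v 0 = univ := by
      ext w
      have : w ∉ N := by simp [h]
      simp only [mem_badSet, mem_univ, iff_true]
      rintro ⟨h1, -⟩
      exact this (mem_filter.2 ⟨mem_univ _, h1⟩)
    have h1 := hb v 0
    rw [this, card_univ] at h1
    omega
  have hlow : ∀ x ∈ N, b + 1 ≤ #(N.bipartiteAbove r x) := by
    intro x hx
    have hx' : G.Adj v x := by simpa [hN] using hx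
    have h1 := card_compl_union_ge (badSet G c x (c v x)) (badSet G c v (c v x))
    have h2 := hb x (c v x)
    have h3 := hb v (c v x)
    have : (badSet G c x (c v x) ∪ badSet G c v (c v x))ᶜ ⊆ N.bipartiteAbove r x := by
      intro y hy
      simp only [mem_compl, mem_union, not_or, notMem_badSet] at hy
      simp only [mem_bipartiteAbove, hN, mem_filter, mem_univ, true_and, r]
      exact ⟨hy.2.1, hy.1.1, hy.1.2, hy.2.2.symm⟩
    have := card_le_card this
    omega
  have hup : ∀ y ∈ N, #(N.bipartiteBelow r y) ≤ b := by
    intro y hy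
    have hy' : G.Adj v y := by simpa [hN] using hy
    refine le_trans (card_le_card ?_) (hb y (c v y))
    intro x hx
    simp only [mem_bipartiteBelow, hN, mem_filter, mem_univ, true_and, r] at hx
    obtain ⟨hvx, hxy, h1, h2⟩ := hx
    rw [mem_badSet]
    rintro ⟨-, h3⟩
    refine hrain v x y hvx hxy hy'.symm h1.symm ?_ ?_
    · rw [hc x y, hc y v]; exact h3
    · rw [hc y v]; exact h2.symm
  have h1 := sum_le_sum hlow
  have h2 := sum_le_sum hup
  rw [sum_const, smul_eq_mul] at h1 h2
  have := card_pos.2 hNe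
  nlinarith

/-- Number of connections between two given ends that avoid a given set. -/
lemma card_connects_ge {b z : ℕ} (hb : ∀ v a, #(badSet G c v a) ≤ b) (u v : V) (a a' : ℕ)
    (Z : Finset V) (hZ : #Z ≤ z) (hn : 3 * b + z ≤ Fintype.card V) :
    (Fintype.card V - 3 * b - z) * (Fintype.card V - b - z) ≤
      #(univ.filter fun p : V × V => Connects G c u a v a' p.1 p.2 ∧ p.1 ∉ Z ∧ p.2 ∉ Z) := by
  set n := Fintype.card V
  set X := (badSet G c u a ∪ Z)ᶜ with hX
  set Y := (badSet G c v a' ∪ Z)ᶜ with hY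
  set T := univ.filter fun p : V × V => Connects G c u a v a' p.1 p.2 ∧ p.1 ∉ Z ∧ p.2 ∉ Z
  have hXc : n ≤ #X + b + z := by
    have := card_compl_union_ge (badSet G c u a) Z
    rw [← hX] at this
    have := hb u a
    omega
  have hYc : n ≤ #Y + b + z := by
    have := card_compl_union_ge (badSet G c v a') Z
    rw [← hY] at this
    have := hb v a'
    omega
  have hsub : X ×ˢ Y ⊆ T ∪ ((X.sigma fun x => badSet G c x (c x u)).image (fun p => (p.1, p.2)) ∪
      (Y.sigma fun y => badSet G c y (c y v)).image fun p => (p.2, p.1)) := by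
    rintro ⟨x, y⟩ hxy
    simp only [mem_product, hX, hY, mem_compl, mem_union, not_or, notMem_badSet] at hxy
    obtain ⟨⟨h1, h2⟩, h3, h4⟩ := hxy
    by_cases hxb : y ∈ badSet G c x (c x u)
    · refine mem_union_right _ (mem_union_left _ (mem_image.2 ⟨⟨x, y⟩, ?_, rfl⟩))
      simp [hX, h2, notMem_badSet, h1, hxb]
    by_cases hyb : x ∈ badSet G c y (c y v)
    · refine mem_union_right _ (mem_union_right _ (mem_image.2 ⟨⟨y, x⟩, ?_, rfl⟩))
      simp [hY, h4, notMem_badSet, h3, hyb]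
    refine mem_union_left _ ?_
    simp only [T, mem_filter, mem_univ, true_and]
    exact ⟨⟨h1, h3, notMem_badSet.1 hxb, notMem_badSet.1 hyb⟩, h2, h4⟩
  have hcard := card_le_card hsub
  rw [card_product] at hcard
  have h1 : #((X.sigma fun x => badSet G c x (c x u)).image fun p => ((p.1, p.2) : V × V)) ≤
      #X * b := by
    refine card_image_le.trans ?_
    rw [card_sigma, ← smul_eq_mul]
    exact sum_le_card_nsmul _ _ _ fun x _ => hb _ _
  have h2 : #((Y.sigma fun y => badSet G c y (c y v)).image fun p => ((p.2, p.1) : V × V)) ≤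
      #Y * b := by
    refine card_image_le.trans ?_
    rw [card_sigma, ← smul_eq_mul]
    exact sum_le_card_nsmul _ _ _ fun x _ => hb _ _
  have h3 := card_union_le T ((X.sigma fun x => badSet G c x (c x u)).image (fun p => (p.1, p.2)) ∪
      (Y.sigma fun y => badSet G c y (c y v)).image fun p => (p.2, p.1))
  have h4 := card_union_le ((X.sigma fun x => badSet G c x (c x u)).image
      (fun p => ((p.1, p.2) : V × V)))
      ((Y.sigma fun y => badSet G c y (c y v)).image fun p => (p.2, p.1))
  have h5 : #X * #Y ≤ #T + #X * b + #Y * b := by omega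
  obtain ⟨s, hs⟩ : ∃ s, n = 3 * b + z + s := Nat.exists_eq_add_of_le hn
  have e1 : n - 3 * b - z = s := by omega
  have e2 : n - b - z = 2 * b + s := by omega
  rw [e1, e2]
  obtain ⟨p, hp⟩ : ∃ p, #X = 2 * b + s + p := Nat.exists_eq_add_of_le (by omega)
  obtain ⟨q, hq⟩ : ∃ q, #Y = 2 * b + s + q := Nat.exists_eq_add_of_le (by omega)
  rw [hp, hq] at h5
  nlinarith [Nat.zero_le (p * q), Nat.zero_le (p * b), Nat.zero_le (q * b), Nat.zero_le (p * s),
    Nat.zero_le (q * s)]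

lemma supply_univ {b z : ℕ} (hb : ∀ v a, #(badSet G c v a) ≤ b)
    (hn : 3 * b + z < Fintype.card V) : Supply G c univ z := by
  intro u a v a' Z hZ
  have h := card_connects_ge hb u v a a' Z hZ hn.le
  have : 0 < (Fintype.card V - 3 * b - z) * (Fintype.card V - b - z) :=
    Nat.mul_pos (by omega) (by omega)
  obtain ⟨p, hp⟩ := card_pos.1 (this.trans_le h)
  simp only [mem_filter, mem_univ, true_and] at hp
  exact ⟨p.1, mem_univ _, p.2, mem_univ _, hp.2.1, hp.2.2, hp.1⟩

/-- `w` can be inserted in the middle of the properly coloured path `p`. -/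
structure AbsorbsVertex (G : SimpleGraph V) (c : V → V → ℕ) (w : V) (p : V × V × V × V) : Prop where
  nodup : [p.1, p.2.1, p.2.2.1, p.2.2.2].Nodup
  walk : IsPCWalk G c [p.1, p.2.1, p.2.2.1, p.2.2.2]
  walk_insert : IsPCWalk G c [p.1, p.2.1, w, p.2.2.1, p.2.2.2]
  ne : w ∉ ({p.1, p.2.1, p.2.2.1, p.2.2.2} : Finset V)

lemma card_filter_prod_ge {α β : Type*} [Fintype α] [Fintype β] (P : α → Prop) (Q : α → β → Prop)
    (R : α × β → Prop) (hR : ∀ x y, P x → Q x y → R (x, y))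
    {r s : ℕ} (hP : r ≤ #(univ.filter P)) (hQ : ∀ x, P x → s ≤ #(univ.filter (Q x))) :
    r * s ≤ #(univ.filter R) := by
  have : #((univ.filter P).sigma fun x => univ.filter (Q x)) ≤ #(univ.filter R) := by
    refine card_le_card_of_injOn (fun p => (p.1, p.2)) ?_ ?_
    · rintro ⟨x, y⟩ h
      simp only [coe_sigma, coe_filter, mem_univ, true_and, Set.mem_sigma_iff,
        Set.mem_ofPred_eq] at h ⊢
      exact hR x y h.1 h.2
    · rintro ⟨x, y⟩ _ ⟨x', y'⟩ _ h
      simp only [Prod.mk.injEq] at h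
      obtain ⟨rfl, rfl⟩ := h
      rfl
  refine le_trans ?_ this
  rw [card_sigma]
  calc r * s ≤ #(univ.filter P) • s := Nat.mul_le_mul_right _ hP
    _ ≤ _ := card_nsmul_le_sum _ _ _ fun x hx => hQ x (by simpa using hx)

/-- Number of absorbing paths for a given vertex that avoid a given set. -/
lemma card_absorbs_ge (hc : ∀ u v, c u v = c v u) {b z k : ℕ} (hb : ∀ v a, #(badSet G c v a) ≤ b)
    (w : V) (Z : Finset V) (hZ : #Z ≤ z) (hk : k + 2 * b + z + 3 ≤ Fintype.card V) :
    k * (k * (k * k)) ≤ #(univ.filter fun p : V × V × V × V => AbsorbsVertex G c w p ∧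
      Disjoint ({p.1, p.2.1, p.2.2.1, p.2.2.2} : Finset V) Z) := by
  have key : ∀ (A B C : Finset V) (P : V → Prop), #A ≤ b → #B ≤ b → #C ≤ z + 3 →
      (∀ x, x ∉ A → x ∉ B → x ∉ C → P x) → k ≤ #(univ.filter P) := by
    intro A B C P hA hB hC hP
    have : (A ∪ B ∪ C)ᶜ ⊆ univ.filter P := by
      intro x hx
      simp only [mem_compl, mem_union, not_or, mem_filter, mem_univ, true_and] at hx ⊢
      exact hP x hx.1.1 hx.1.2 hx.2
    have h1 := card_le_card this
    have h2 := card_compl_union_ge (A ∪ B) C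
    have h3 := card_union_le A B
    omega
  have hins : ∀ x y z' : V, #(insert x (insert y (insert z' Z))) ≤ z + 3 := by
    intro x y z'
    have h1 := card_insert_le x (insert y (insert z' Z))
    have h2 := card_insert_le y (insert z' Z)
    have h3 := card_insert_le z' Z
    omega
  let P₂ : V → Prop := fun x₂ => x₂ ∉ badSet G c w 0 ∧ x₂ ∉ insert w (insert w (insert w Z))
  let P₃ : V → V → Prop := fun x₂ x₃ => x₃ ∉ badSet G c w (c w x₂) ∧ x₃ ∉ badSet G c x₂ 0 ∧
    x₃ ∉ insert w (insert w (insert x₂ Z))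
  let P₁ : V → V → V → Prop := fun x₂ x₃ x₁ => x₁ ∉ badSet G c x₂ (c x₂ x₃) ∧
    x₁ ∉ badSet G c x₂ (c x₂ w) ∧ x₁ ∉ insert w (insert x₂ (insert x₃ Z))
  let P₄ : V → V → V → V → Prop := fun x₂ x₃ x₁ x₄ => x₄ ∉ badSet G c x₃ (c x₃ x₂) ∧
    x₄ ∉ badSet G c x₃ (c x₃ w) ∧ x₄ ∉ insert w (insert x₂ (insert x₁ Z))
  have hmain := card_filter_prod_ge (β := V × V × V) P₂
    (fun x₂ q => P₃ x₂ q.1 ∧ P₁ x₂ q.1 q.2.1 ∧ P₄ x₂ q.1 q.2.1 q.2.2)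
    (fun q => P₂ q.1 ∧ P₃ q.1 q.2.1 ∧ P₁ q.1 q.2.1 q.2.2.1 ∧ P₄ q.1 q.2.1 q.2.2.1 q.2.2.2)
    (fun x y h1 h2 => ⟨h1, h2⟩) (r := k) (s := k * (k * k))
    (key _ _ _ _ (hb w 0) (hb w 0) (hins _ _ _) fun x h1 _ h3 => ⟨h1, h3⟩) (by
      intro x₂ _
      refine card_filter_prod_ge (β := V × V) (P₃ x₂)
        (fun x₃ q => P₁ x₂ x₃ q.1 ∧ P₄ x₂ x₃ q.1 q.2) _ (fun x y h1 h2 => ⟨h1, h2⟩)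
        (key _ _ _ _ (hb _ _) (hb _ _) (hins _ _ _) fun x h1 h2 h3 => ⟨h1, h2, h3⟩) ?_
      intro x₃ _
      refine card_filter_prod_ge (P₁ x₂ x₃) (P₄ x₂ x₃) _ (fun x y h1 h2 => ⟨h1, h2⟩)
        (key _ _ _ _ (hb _ _) (hb _ _) (hins _ _ _) fun x h1 h2 h3 => ⟨h1, h2, h3⟩) ?_
      intro x₁ _
      exact key _ _ _ _ (hb _ _) (hb _ _) (hins _ _ _) fun x h1 h2 h3 => ⟨h1, h2, h3⟩)
  refine hmain.trans (card_le_card_of_injOn (fun p => (p.2.2.1, p.1, p.2.1, p.2.2.2)) ?_ ?_)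
  · rintro ⟨x₂, x₃, x₁, x₄⟩ hp
    simp only [coe_filter, mem_univ, true_and, Set.mem_ofPred_eq, P₁, P₂, P₃, P₄, notMem_badSet,
      mem_insert, not_or] at hp ⊢
    obtain ⟨⟨⟨h1, -⟩, h2, -, -, h2Z⟩, ⟨⟨h3, h3'⟩, ⟨h4, -⟩, h5, -, h6, h3Z⟩,
      ⟨⟨h7, h7'⟩, ⟨-, h8⟩, h9, h10, h11, h1Z⟩, ⟨⟨h12, h12'⟩, ⟨-, h13⟩, h14, h15, h16, h4Z⟩⟩ := hp
    refine ⟨⟨?_, ?_, ?_, ?_⟩, ?_⟩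
    · have := h12.ne
      simp only [List.nodup_cons, List.mem_cons, List.not_mem_nil, or_false, not_or]
      tauto
    · refine ⟨h7.symm, ?_, h4, ?_, h12⟩
      · rw [hc x₁ x₂]; exact h7'
      · rw [hc x₂ x₃]; exact h12'.symm
    · refine ⟨h7.symm, ?_, h1.symm, ?_, h3, ?_, h12⟩
      · rw [hc x₁ x₂]; exact h8
      · rw [hc x₂ w]; exact h3'.symm
      · rw [hc w x₃]; exact h13.symm
    · simp only [mem_insert, mem_singleton, not_or]
      tauto
    · simp only [disjoint_insert_left, disjoint_singleton_left]
      tauto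
  · rintro ⟨x₂, x₃, x₁, x₄⟩ _ ⟨x₂', x₃', x₁', x₄'⟩ _ h
    simp only [Prod.mk.injEq] at h ⊢
    tauto

end Counting

section Selection

open scoped Classical
open Finset

variable {V : Type*}

/-- Greedy derandomised selection of items with disjoint supports. -/
lemma exists_disjoint_selection {τ ω : Type*} [Fintype τ] [Nonempty τ] [Fintype ω] [Nonempty ω]
    (supp : τ → Finset V) (hne : ∀ q, (supp q).Nonempty) {k : ℕ} (hk : ∀ q, #(supp q) ≤ k)
    (hit : ω → τ → Prop) {p : ℝ} (hp : 0 < p) (Z₀ : Finset V) {z : ℕ}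
    (hcount : ∀ w (Z : Finset V), #Z ≤ z →
      p * Fintype.card τ ≤ #(univ.filter fun q => hit w q ∧ Disjoint (supp q) Z)) (m : ℕ)
    (hm : #Z₀ + k * m ≤ z) :
    ∃ F : Finset τ, #F = m ∧ (∀ q ∈ F, Disjoint (supp q) Z₀) ∧
      (∀ q ∈ F, ∀ q' ∈ F, q ≠ q' → Disjoint (supp q) (supp q')) ∧ (∀ q ∈ F, ∃ w, hit w q) ∧
      ∑ w, (1 / 2 : ℝ) ^ #(F.filter (hit w)) ≤ Fintype.card ω * (1 - p / 2) ^ m := by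
  induction m with
  | zero => exact ⟨∅, by simp⟩
  | succ m ih =>
    obtain ⟨F, hF, hFZ, hFd, hFh, hsum⟩ := ih (by rw [mul_add] at hm; omega)
    set Z := Z₀ ∪ F.biUnion supp with hZ
    have hZc : #Z ≤ z := by
      have h1 := card_union_le Z₀ (F.biUnion supp)
      rw [← hZ] at h1
      have h2 := card_biUnion_le_card_mul F supp k fun q _ => hk q
      rw [hF] at h2
      have : m * k ≤ k * (m + 1) := by nlinarith
      omega
    set wt : ω → ℝ := fun w => (1 / 2 : ℝ) ^ #(F.filter (hit w)) with hwt
    have hwt0 : ∀ w, 0 < wt w := fun w => by positivity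
    set Φ := ∑ w, wt w with hΦ
    have hΦ0 : 0 < Φ := sum_pos (fun w _ => hwt0 w) univ_nonempty
    let S : τ → ℝ := fun q => ∑ w, if hit w q ∧ Disjoint (supp q) Z then wt w else 0
    have hS : ∑ _q : τ, p * Φ ≤ ∑ q, S q := by
      have h1 : ∑ q, S q = ∑ w, wt w * #(univ.filter fun q => hit w q ∧ Disjoint (supp q) Z) := by
        simp only [S]
        rw [sum_comm]
        refine sum_congr rfl fun w _ => ?_
        rw [← sum_filter, sum_const, nsmul_eq_mul, mul_comm]
      rw [h1, sum_const, nsmul_eq_mul, card_univ, hΦ, mul_sum, mul_sum]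
      refine sum_le_sum fun w _ => ?_
      have := hcount w Z hZc
      have := hwt0 w
      nlinarith
    obtain ⟨q, -, hq⟩ := exists_le_of_sum_le univ_nonempty hS
    have hq0 : 0 < S q := lt_of_lt_of_le (by positivity) hq
    obtain ⟨w₀, -, hw₀⟩ := exists_ne_zero_of_sum_ne_zero hq0.ne'
    have hw₁ : hit w₀ q ∧ Disjoint (supp q) Z := by
      by_contra h
      exact hw₀ (if_neg h)
    obtain ⟨hhit, hdis⟩ := hw₁
    rw [hZ, disjoint_union_right, disjoint_biUnion_right] at hdis
    have hqF : q ∉ F := fun h => (hne q).ne_empty (disjoint_self.1 (hdis.2 q h))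
    refine ⟨insert q F, by rw [card_insert_of_notMem hqF, hF], ?_, ?_, ?_, ?_⟩
    · intro q' hq'
      rcases mem_insert.1 hq' with rfl | h
      exacts [hdis.1, hFZ _ h]
    · intro q₁ h₁ q₂ h₂ hne
      rcases mem_insert.1 h₁ with rfl | h₃ <;> rcases mem_insert.1 h₂ with rfl | h₄
      · exact (hne rfl).elim
      · exact hdis.2 _ h₄
      · exact (hdis.2 _ h₃).symm
      · exact hFd _ h₃ _ h₄ hne
    · intro q' hq'
      rcases mem_insert.1 hq' with rfl | h
      exacts [⟨w₀, hhit⟩, hFh _ h]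
    · have hterm : ∀ w, (1 / 2 : ℝ) ^ #((insert q F).filter (hit w)) ≤
          wt w - (1 / 2) * if hit w q ∧ Disjoint (supp q) Z then wt w else 0 := by
        intro w
        have hd : Disjoint (supp q) Z := by
          rw [hZ, disjoint_union_right, disjoint_biUnion_right]; exact hdis
        rw [filter_insert]
        by_cases hw : hit w q
        · rw [if_pos hw, if_pos ⟨hw, hd⟩, card_insert_of_notMem (by simp [hqF]), pow_succ]
          simp only [hwt]
          linarith
        · rw [if_neg hw, if_neg (by tauto)]
          simp [hwt]
      have hle := sum_le_sum fun w (_ : w ∈ (univ : Finset ω)) => hterm w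
      rw [sum_sub_distrib, ← mul_sum] at hle
      change _ ≤ Φ - 1 / 2 * S q at hle
      have hcard : (0 : ℝ) < Fintype.card ω := by exact_mod_cast Fintype.card_pos
      have hp1 : p ≤ 1 := by
        have h1 := hcount w₀ ∅ (by simp)
        have h2 : (#(univ.filter fun q => hit w₀ q ∧ Disjoint (supp q) ∅) : ℝ) ≤ Fintype.card τ := by
          exact_mod_cast card_le_univ _
        have h3 : (0 : ℝ) < Fintype.card τ := by exact_mod_cast Fintype.card_pos
        nlinarith
      calc _ ≤ _ := hle
        _ ≤ Φ * (1 - p / 2) := by linarith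
        _ ≤ Fintype.card ω * (1 - p / 2) ^ m * (1 - p / 2) :=
          mul_le_mul_of_nonneg_right hsum (by linarith)
        _ = _ := by ring

lemma lt_card_filter_of_sum_lt {τ ω : Type*} [Fintype ω] (hit : ω → τ → Prop) (F : Finset τ)
    {h : ℕ} (hs : ∑ w, (1 / 2 : ℝ) ^ #(F.filter (hit w)) < (1 / 2) ^ h) (w : ω) :
    h < #(F.filter (hit w)) := by
  have h1 : (1 / 2 : ℝ) ^ #(F.filter (hit w)) ≤ ∑ w, (1 / 2 : ℝ) ^ #(F.filter (hit w)) :=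
    single_le_sum (f := fun w => (1 / 2 : ℝ) ^ #(F.filter (hit w)))
      (fun _ _ => by positivity) (mem_univ w)
  exact (pow_lt_pow_iff_right_of_lt_one₀ (by norm_num) (by norm_num)).1 (h1.trans_lt hs)

open Filter in
lemma exists_pow_four_mul_pow_floor_lt {q γ : ℝ} (hq0 : 0 ≤ q) (hq1 : q < 1) (hγ : 0 < γ) :
    ∃ η : ℝ, 0 < η ∧ ∃ n₀ : ℕ, ∀ n : ℕ, n₀ ≤ n → ∃ h : ℕ, η * n ≤ h ∧
      (n : ℝ) ^ 4 * q ^ ⌊γ * n⌋₊ < (1 / 2) ^ h := by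
  obtain ⟨K, hK⟩ := exists_pow_lt_of_lt_one (show (0 : ℝ) < 1 / 4 by norm_num) hq1
  have hK0 : K ≠ 0 := by
    rintro rfl
    norm_num at hK
  have hKpos : (0 : ℝ) < K := by exact_mod_cast Nat.pos_of_ne_zero hK0
  set η := γ / (2 * K) with hη
  have hη0 : 0 < η := by positivity
  have hr : (1 : ℝ) < 2 ^ η := Real.one_lt_rpow (by norm_num) hη0
  have hlim := (tendsto_pow_const_div_const_pow_of_one_lt 4 hr).eventually_lt_const
    (show (0 : ℝ) < 1 by norm_num)
  obtain ⟨n₁, hn₁⟩ := eventually_atTop.1 hlim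
  refine ⟨η, hη0, max n₁ ⌈(1 + K) / (γ / 2)⌉₊, fun n hn => ⟨⌊γ * n⌋₊ / K, ?_, ?_⟩⟩
  all_goals
    have hn2 : (1 + K) / (γ / 2) ≤ n := (Nat.le_ceil _).trans (by exact_mod_cast (le_max_right _ _).trans hn)
    have hn3 : 1 + K ≤ γ / 2 * n := by
      rw [div_le_iff₀ (by positivity)] at hn2
      linarith
    have hfl : γ * n < ⌊γ * n⌋₊ + 1 := Nat.lt_floor_add_one _
    have hdiv : (⌊γ * n⌋₊ : ℝ) < K * ((⌊γ * n⌋₊ / K : ℕ) + 1) := by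
      exact_mod_cast Nat.lt_mul_div_succ ⌊γ * n⌋₊ (Nat.pos_of_ne_zero hK0)
    have hηh : η * n ≤ ((⌊γ * n⌋₊ / K : ℕ) : ℝ) := by
      rw [hη, div_mul_eq_mul_div, div_le_iff₀ (by positivity)]
      nlinarith
  · exact hηh
  · set h := ⌊γ * n⌋₊ / K
    have h1 : q ^ ⌊γ * n⌋₊ ≤ (1 / 4) ^ h := by
      calc q ^ ⌊γ * n⌋₊ ≤ q ^ (K * h) := pow_le_pow_of_le_one hq0 hq1.le (Nat.mul_div_le _ _)
        _ = (q ^ K) ^ h := pow_mul _ _ _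
        _ ≤ _ := pow_le_pow_left₀ (by positivity) hK.le _
    have h2 : (n : ℝ) ^ 4 < 2 ^ h := by
      have := hn₁ n ((le_max_left _ _).trans hn)
      rw [div_lt_one (by positivity)] at this
      refine this.trans_le ?_
      rw [← Real.rpow_natCast, ← Real.rpow_mul (by norm_num), ← Real.rpow_natCast]
      exact Real.rpow_le_rpow_of_exponent_le (by norm_num) hηh
    calc (n : ℝ) ^ 4 * q ^ ⌊γ * n⌋₊ ≤ (n : ℝ) ^ 4 * (1 / 4) ^ h := by gcongr
      _ < 2 ^ h * (1 / 4) ^ h := by gcongr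
      _ = (1 / 2) ^ h := by rw [← mul_pow]; norm_num

end Selection

section Absorbing

open scoped Classical
open Finset

variable {V : Type*} {G : SimpleGraph V} {c : V → V → ℕ}

/-- The path `b₁ b₂ M a₁ a₂` can absorb any set of at most `s` further vertices. -/
def IsAbsorbing (G : SimpleGraph V) (c : V → V → ℕ) (b₁ b₂ a₁ a₂ : V) (M : List V) (s : ℕ) : Prop :=
  (b₁ :: b₂ :: (M ++ [a₁, a₂])).Nodup ∧ ∀ W : Finset V, #W ≤ s →
    ∃ M' : List V, M'.Perm (M ++ W.toList) ∧ IsPCWalk G c (b₁ :: b₂ :: (M' ++ [a₁, a₂]))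

/-- The set of entries of a quadruple. -/
noncomputable def quadFinset (q : V × V × V × V) : Finset V := {q.1, q.2.1, q.2.2.1, q.2.2.2}

/-- The list of entries of a quadruple. -/
def quadList (q : V × V × V × V) : List V := [q.1, q.2.1, q.2.2.1, q.2.2.2]

lemma mem_quadList {q : V × V × V × V} {x : V} : x ∈ quadList q ↔ x ∈ quadFinset q := by
  simp [quadList, quadFinset]

lemma exists_injective_absorber (F : Finset (V × V × V × V)) {h : ℕ}
    (hF : ∀ w, h < #(F.filter (AbsorbsVertex G c w))) (W : Finset V) (hW : #W ≤ h) :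
    ∃ g : V → V × V × V × V, Set.InjOn g W ∧ ∀ w ∈ W, g w ∈ F ∧ AbsorbsVertex G c w (g w) := by
  obtain ⟨g, hg, hgF⟩ := (all_card_le_biUnion_card_iff_exists_injective
    (fun w : W => F.filter (AbsorbsVertex G c w))).1 (by
      intro S
      rcases S.eq_empty_or_nonempty with rfl | ⟨w, hw⟩
      · simp
      · have h1 : #S ≤ #W := by simpa using card_le_univ S
        have h2 := card_le_card (subset_biUnion_of_mem
          (fun w : W => F.filter (AbsorbsVertex G c w)) hw)
        have h3 := hF w
        omega)
  refine ⟨fun w => if hw : w ∈ W then g ⟨w, hw⟩ else (w, w, w, w), ?_, ?_⟩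
  · intro w hw w' hw' hww
    rw [mem_coe] at hw hw'
    simp only [hw, hw', dif_pos] at hww
    simpa using hg hww
  · intro w hw
    simp only [hw, dif_pos]
    simpa using hgF ⟨w, hw⟩

lemma nodup_flatten_map_quadList {F : Finset (V × V × V × V)}
    (hFd : ∀ q ∈ F, ∀ q' ∈ F, q ≠ q' → Disjoint (quadFinset q) (quadFinset q'))
    (hF : ∀ q ∈ F, ∃ w, AbsorbsVertex G c w q) : (F.toList.map quadList).flatten.Nodup := by
  rw [← List.flatMap_def, List.nodup_flatMap]
  constructor
  · intro q hq
    obtain ⟨w, hw⟩ := hF q (by simpa using hq)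
    exact hw.nodup
  · refine F.nodup_toList.imp_of_mem ?_
    intro q q' hq hq' hne x hx hx'
    rw [mem_quadList] at hx hx'
    exact disjoint_left.1 (hFd q (by simpa using hq) q' (by simpa using hq') hne) hx hx'

lemma exists_blocks {F : Finset (V × V × V × V)} (hF : ∀ q ∈ F, ∃ w, AbsorbsVertex G c w q) {h : ℕ}
    (hFh : ∀ w, h < #(F.filter (AbsorbsVertex G c w))) (W : Finset V) (hW : #W ≤ h) :
    ∃ Ps' : List (List V), List.Forall₂ (SameEnds G c) (F.toList.map quadList) Ps' ∧
      Ps'.flatten.Perm ((F.toList.map quadList).flatten ++ W.toList) := by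
  obtain ⟨g, hg, hgW⟩ := exists_injective_absorber F hFh W hW
  let extra : V × V × V × V → List V := fun q => (W.filter fun w => g w = q).toList
  let block : V × V × V × V → List V := fun q =>
    [q.1, q.2.1] ++ extra q ++ [q.2.2.1, q.2.2.2]
  refine ⟨F.toList.map block, ?_, ?_⟩
  · rw [List.forall₂_map_left_iff, List.forall₂_map_right_iff, List.forall₂_same]
    intro q hq
    rcases (W.filter fun w => g w = q).eq_empty_or_nonempty with he | ⟨w, hw⟩
    · obtain ⟨w, hw⟩ := hF q (by simpa using hq)
      simp only [block, extra, he, toList_empty]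
      exact ⟨hw.walk, rfl, rfl⟩
    · have he : (W.filter fun w => g w = q) = {w} := by
        rw [mem_filter] at hw
        ext w'
        simp only [mem_filter, mem_singleton]
        refine ⟨fun h => hg h.1 hw.1 (h.2.trans hw.2.symm), ?_⟩
        rintro rfl
        exact hw
      rw [mem_filter] at hw
      obtain ⟨hw, rfl⟩ := hw
      simp only [block, extra, he, toList_singleton]
      exact ⟨(hgW w hw).2.walk_insert, rfl, rfl⟩
  · rw [← List.flatMap_def, ← List.flatMap_def]
    have h1 : (F.toList.flatMap block).Perm (F.toList.flatMap fun q => quadList q ++ extra q) := by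
      refine List.Perm.flatMap_left _ fun q _ => ?_
      simp only [block, quadList]
      rw [List.append_assoc]
      exact (List.perm_append_comm.append_left [q.1, q.2.1]).trans (by simp)
    refine h1.trans ((List.flatMap_append_perm _ _ _).symm.trans (List.Perm.append_left _ ?_))
    rw [List.perm_ext_iff_of_nodup _ W.nodup_toList]
    · intro w
      simp only [extra, List.mem_flatMap, mem_toList, mem_filter]
      refine ⟨fun ⟨q, _, hw, _⟩ => hw, fun hw => ⟨g w, (hgW w hw).1, hw, rfl⟩⟩
    · rw [List.nodup_flatMap]
      refine ⟨fun q _ => nodup_toList _, F.nodup_toList.imp ?_⟩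
      intro q q' hne w hw hw'
      simp only [extra, mem_toList, mem_filter] at hw hw'
      exact hne (hw.2.symm.trans hw'.2)

lemma exists_isAbsorbing_of_family [Fintype V] (hc : ∀ u v, c u v = c v u) {κ : ℕ}
    (hR : Supply G c univ κ) {b₁ b₂ a₁ a₂ : V} (hb : G.Adj b₁ b₂) (ha : G.Adj a₁ a₂)
    (hnd : [b₁, b₂, a₁, a₂].Nodup) {F : Finset (V × V × V × V)}
    (hFZ : ∀ q ∈ F, Disjoint (quadFinset q) {b₁, b₂, a₁, a₂})
    (hFd : ∀ q ∈ F, ∀ q' ∈ F, q ≠ q' → Disjoint (quadFinset q) (quadFinset q'))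
    (hF : ∀ q ∈ F, ∃ w, AbsorbsVertex G c w q) {h : ℕ}
    (hFh : ∀ w, h < #(F.filter (AbsorbsVertex G c w))) (hκ : 4 + 6 * #F ≤ κ) :
    ∃ M : List V, IsAbsorbing G c b₁ b₂ a₁ a₂ M h ∧ M.length = 6 * #F + 2 := by
  set Ps := F.toList.map quadList with hPs
  have hlen : Ps.length = #F := by simp [hPs]
  have hZ : #(F.biUnion quadFinset ∪ {b₁, b₂, a₁, a₂}) ≤ 4 * #F + 4 := by
    refine (card_union_le _ _).trans (add_le_add ?_ card_le_four)
    rw [mul_comm]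
    exact card_biUnion_le_card_mul _ _ _ fun q _ => card_le_four
  obtain ⟨Q, hQ, hQZ, hQl, hch⟩ := exists_chain hc hR ha Ps b₁ b₂
    (F.biUnion quadFinset ∪ {b₁, b₂, a₁, a₂}) hb (by
      intro P hP
      simp only [hPs, List.mem_map, mem_toList] at hP
      obtain ⟨q, hq, rfl⟩ := hP
      obtain ⟨w, hw⟩ := hF q hq
      exact ⟨by simp [quadList], hw.walk⟩) (by rw [hlen]; omega)
  have hall : ∀ W : Finset V, #W ≤ h →
      ∃ M' : List V, M'.Perm (Q ++ (Ps.flatten ++ W.toList)) ∧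
        IsPCWalk G c (b₁ :: b₂ :: (M' ++ [a₁, a₂])) := by
    intro W hW
    obtain ⟨Ps', h1, h2⟩ := exists_blocks hF hFh W hW
    obtain ⟨r, hr, hrw⟩ := hch Ps' h1
    exact ⟨r, hr.trans (h2.append_left Q), hrw⟩
  obtain ⟨M, hM, -⟩ := hall ∅ (by simp)
  simp only [toList_empty, List.append_nil] at hM
  refine ⟨M, ⟨?_, ?_⟩, ?_⟩
  · have h1 : (b₁ :: b₂ :: (M ++ [a₁, a₂])).Perm ((Q ++ Ps.flatten) ++ [b₁, b₂, a₁, a₂]) := by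
      have : (b₁ :: b₂ :: (M ++ [a₁, a₂])).Perm (M ++ [b₁, b₂, a₁, a₂]) := by
        have := List.perm_append_comm_assoc [b₁, b₂] M [a₁, a₂]
        simpa using this
      exact this.trans (hM.append_right _)
    rw [h1.nodup_iff]
    have hmemPs : ∀ x, x ∈ Ps.flatten ↔ ∃ q ∈ F, x ∈ quadFinset q := by
      intro x
      simp [hPs, mem_quadList]
    refine List.Nodup.append (List.Nodup.append hQ (nodup_flatten_map_quadList hFd hF) ?_) hnd ?_
    · intro x hx hx'
      rw [hmemPs] at hx'
      exact (hQZ x hx).2 (mem_union_left _ (mem_biUnion.2 hx'))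
    · intro x hx hx'
      have hx'' : x ∈ ({b₁, b₂, a₁, a₂} : Finset V) := by simpa using hx'
      rcases List.mem_append.1 hx with hx | hx
      · exact (hQZ x hx).2 (mem_union_right _ hx'')
      · rw [hmemPs] at hx
        obtain ⟨q, hq, hx⟩ := hx
        exact disjoint_left.1 (hFZ q hq) hx hx''
  · intro W hW
    obtain ⟨M', hM', hw⟩ := hall W hW
    refine ⟨M', hM'.trans ?_, hw⟩
    rw [← List.append_assoc]
    exact hM.symm.append_right _
  · have h1 : (Ps.flatten).length = 4 * #F := by
      rw [List.length_flatten, hPs, List.map_map]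
      have : (List.length ∘ quadList : V × V × V × V → ℕ) = fun _ => 4 := rfl
      rw [this]
      simp [mul_comm]
    rw [hM.length_eq, List.length_append, hQl, hlen, h1]
    ring

/-- An absorbing path of small linear length that absorbs linearly many vertices. -/
lemma exists_isAbsorbing {ε α : ℝ} (hε : 0 < ε) (hα : 0 < α) :
    ∃ σ : ℝ, 0 < σ ∧ ∃ n₀ : ℕ, ∀ (V : Type) [Fintype V] (G : SimpleGraph V) (c : V → V → ℕ) (b : ℕ),
      (∀ u v, c u v = c v u) → n₀ ≤ Fintype.card V → (∀ v a, #(badSet G c v a) ≤ b) →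
      (b : ℝ) ≤ (1 / 3 - ε) * Fintype.card V →
      ∃ (b₁ b₂ a₁ a₂ : V) (M : List V) (s : ℕ), IsAbsorbing G c b₁ b₂ a₁ a₂ M s ∧
        σ * Fintype.card V ≤ s ∧ (M.length + 4 : ℝ) ≤ α * Fintype.card V := by
  set γ := min (α / 8) (min (1 / 36) (ε / 6)) with hγ
  have hγ0 : 0 < γ := by positivity
  have hγ1 : γ ≤ α / 8 := min_le_left _ _
  have hγ2 : γ ≤ 1 / 36 := (min_le_right _ _).trans (min_le_left _ _)
  have hγ3 : γ ≤ ε / 6 := (min_le_right _ _).trans (min_le_right _ _)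
  obtain ⟨σ, hσ, n₁, hn₁⟩ := exists_pow_four_mul_pow_floor_lt (q := 1 - (1 / 9 ^ 4 : ℝ) / 2)
    (by norm_num) (by norm_num) hγ0
  refine ⟨σ, hσ, max n₁ (max 100 (max ⌈24 / α⌉₊ ⌈10 / ε⌉₊)), ?_⟩
  intro V _ G c b hc hn hb hbε
  set n := Fintype.card V with hnV
  simp only [max_le_iff, Nat.ceil_le] at hn
  obtain ⟨hn1, hn2, hn3, hn4⟩ := hn
  rw [div_le_iff₀ hα] at hn3
  rw [div_le_iff₀ hε] at hn4
  have hn2' : (100 : ℝ) ≤ n := by exact_mod_cast hn2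
  obtain ⟨h, hh, hlt⟩ := hn₁ n hn1
  set m := ⌊γ * n⌋₊ with hm
  have hmle : (m : ℝ) ≤ γ * n := Nat.floor_le (by positivity)
  have hm1 : (m : ℝ) ≤ α / 8 * n := hmle.trans (by gcongr)
  have hm2 : (m : ℝ) ≤ 1 / 36 * n := hmle.trans (by gcongr)
  have hm3 : (m : ℝ) ≤ ε / 6 * n := hmle.trans (by gcongr)
  have hpick : ∀ (v x y : V), ∃ w, G.Adj v w ∧ w ≠ x ∧ w ≠ y := by
    intro v x y
    have h1 := card_compl_union_ge (badSet G c v 0) {x, y}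
    have h2 := hb v 0
    have h3 : #({x, y} : Finset V) ≤ 2 := card_le_two
    have h4 : 3 * b < n := by
      have : (3 * b : ℝ) < n := by nlinarith
      exact_mod_cast this
    obtain ⟨w, hw⟩ := card_pos.1 (show 0 < #(badSet G c v 0 ∪ {x, y})ᶜ by omega)
    simp only [mem_compl, mem_union, not_or, notMem_badSet, mem_insert, mem_singleton] at hw
    exact ⟨w, hw.1.1, hw.2⟩
  obtain ⟨b₁⟩ : Nonempty V := Fintype.card_pos_iff.1 (by omega)
  obtain ⟨b₂, hb₂, -, -⟩ := hpick b₁ b₁ b₁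
  obtain ⟨a₁, -, ha₁, ha₁'⟩ := hpick b₁ b₁ b₂
  obtain ⟨a₂, ha₂, ha₂', ha₂''⟩ := hpick a₁ b₁ b₂
  have : Nonempty (V × V × V × V) := ⟨(b₁, b₁, b₁, b₁)⟩
  have : Nonempty V := ⟨b₁⟩
  obtain ⟨F, hF, hFZ, hFd, hFh, hsum⟩ := exists_disjoint_selection (ω := V) quadFinset
    (fun q => ⟨q.1, by simp [quadFinset]⟩) (k := 4) (fun q => card_le_four)
    (AbsorbsVertex G c) (p := 1 / 9 ^ 4) (by norm_num) {b₁, b₂, a₁, a₂} (z := 4 + 4 * m) (by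
      intro w Z hZ
      have h1 : n / 9 + 1 + 2 * b + (4 + 4 * m) + 3 ≤ n := by
        have h2 : ((n / 9 : ℕ) : ℝ) ≤ n / 9 := Nat.cast_div_le
        have : (((n / 9 : ℕ) + 1 + 2 * b + (4 + 4 * m) + 3 : ℝ)) ≤ n := by nlinarith
        exact_mod_cast this
      have h2 := card_absorbs_ge hc hb w Z hZ h1
      have h3 : (n : ℝ) ≤ 9 * ((n / 9 + 1 : ℕ) : ℝ) := by
        have : n ≤ 9 * (n / 9 + 1) := by omega
        exact_mod_cast this
      have h4 : Fintype.card (V × V × V × V) = n * (n * (n * n)) := by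
        simp only [Fintype.card_prod, ← hnV]
      rw [h4]
      calc (1 / 9 ^ 4 : ℝ) * ((n * (n * (n * n)) : ℕ) : ℝ) = 1 / 9 ^ 4 * (n : ℝ) ^ 4 := by
            push_cast; ring
        _ ≤ 1 / 9 ^ 4 * (9 * ((n / 9 + 1 : ℕ) : ℝ)) ^ 4 := by gcongr
        _ = (((n / 9 + 1) * ((n / 9 + 1) * ((n / 9 + 1) * (n / 9 + 1))) : ℕ) : ℝ) := by
            push_cast; ring
        _ ≤ _ := by exact_mod_cast h2) m (by
      have : #({b₁, b₂, a₁, a₂} : Finset V) ≤ 4 := card_le_four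
      omega)
  have hFlt : ∀ w, h < #(F.filter (AbsorbsVertex G c w)) := by
    refine lt_card_filter_of_sum_lt _ F (hsum.trans_lt (lt_of_le_of_lt ?_ hlt))
    refine mul_le_mul_of_nonneg_right ?_ (pow_nonneg (by norm_num) _)
    exact le_self_pow₀ (by linarith) (by norm_num)
  obtain ⟨M, hM, hMl⟩ := exists_isAbsorbing_of_family hc (κ := 4 + 6 * m) (supply_univ hb (by
      have : (3 * b + (4 + 6 * m) : ℝ) < n := by nlinarith
      exact_mod_cast this)) hb₂ ha₂ (by
      have := hb₂.ne
      have := ha₂.ne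
      simp only [List.nodup_cons, List.mem_cons, List.not_mem_nil, or_false, not_or]
      tauto) hFZ hFd hFh hFlt (by rw [hF])
  refine ⟨b₁, b₂, a₁, a₂, M, h, hM, hh, ?_⟩
  rw [hMl, hF]
  push_cast
  nlinarith

end Absorbing

section Reservoir

open scoped Classical
open Finset

variable {V : Type*} {G : SimpleGraph V} {c : V → V → ℕ}

lemma exists_colour_witness (c : V → V → ℕ) (u : V) (a : ℕ) :
    ∃ u', ∀ x, c u x ≠ c u u' → c u x ≠ a := by
  by_cases h : ∃ u', c u u' = a
  · obtain ⟨u', rfl⟩ := h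
    exact ⟨u', fun x hx => hx⟩
  · push Not at h
    exact ⟨u, fun x _ => h x⟩

lemma exists_disjoint_of_card_lt {τ : Type*} {supp : τ → Finset V} {F : Finset τ}
    (hF : ∀ q ∈ F, ∀ q' ∈ F, q ≠ q' → Disjoint (supp q) (supp q')) {Z : Finset V} (hZ : #Z < #F) :
    ∃ q ∈ F, Disjoint (supp q) Z := by
  by_contra! hno
  have : ∀ q ∈ F, ∃ x, x ∈ supp q ∧ x ∈ Z := fun q hq => not_disjoint_iff.1 (hno q hq)
  obtain ⟨q₀, hq₀⟩ := card_pos.1 (Nat.zero_lt_of_lt hZ)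
  have : Nonempty V := ⟨(this q₀ hq₀).choose⟩
  choose! f hf hfZ using ‹∀ q ∈ F, ∃ x, x ∈ supp q ∧ x ∈ Z›
  refine hZ.not_ge (card_le_card_of_injOn f hfZ ?_)
  intro q hq q' hq' h
  by_contra hne
  refine disjoint_left.1 (hF q hq q' hq' hne) (hf q hq) ?_
  rw [h]
  exact hf q' hq'

lemma supply_of_family {F : Finset (V × V)}
    (hFd : ∀ q ∈ F, ∀ q' ∈ F, q ≠ q' → Disjoint ({q.1, q.2} : Finset V) {q'.1, q'.2}) {h : ℕ}
    (hF : ∀ u u' v v', h < #(F.filter fun q => Connects G c u (c u u') v (c v v') q.1 q.2)) :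
    Supply G c (F.biUnion fun q => {q.1, q.2}) h := by
  intro u a v a' Z hZ
  obtain ⟨u', hu⟩ := exists_colour_witness c u a
  obtain ⟨v', hv⟩ := exists_colour_witness c v a'
  obtain ⟨q, hq, hqZ⟩ := exists_disjoint_of_card_lt (supp := fun q : V × V => {q.1, q.2})
    (fun q hq q' hq' => hFd q (mem_filter.1 hq).1 q' (mem_filter.1 hq').1)
    (hZ.trans_lt (hF u u' v v'))
  obtain ⟨hqF, h1, h2, h3⟩ := mem_filter.1 hq
  simp only [disjoint_insert_left, disjoint_singleton_left] at hqZ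
  exact ⟨q.1, mem_biUnion.2 ⟨q, hqF, by simp⟩, q.2, mem_biUnion.2 ⟨q, hqF, by simp⟩, hqZ.1, hqZ.2,
    ⟨h1.1, hu _ h1.2⟩, ⟨h2.1, hv _ h2.2⟩, h3⟩

/-- A small reservoir, outside a given set, which connects any two ends in linearly many ways. -/
lemma exists_reservoir {ε γ : ℝ} (hε : 0 < ε) (hγ : 0 < γ) :
    ∃ κ : ℝ, 0 < κ ∧ ∃ n₀ : ℕ, ∀ (V : Type) [Fintype V] (G : SimpleGraph V) (c : V → V → ℕ) (b : ℕ),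
      n₀ ≤ Fintype.card V → (∀ v a, #(badSet G c v a) ≤ b) →
      (b : ℝ) ≤ (1 / 3 - ε) * Fintype.card V → ∀ U : Finset V, (#U : ℝ) ≤ ε * Fintype.card V →
      ∃ (R : Finset V) (s : ℕ), Disjoint R U ∧ (#R : ℝ) ≤ γ * Fintype.card V ∧
        κ * Fintype.card V ≤ s ∧ Supply G c R s := by
  set γ' := min (γ / 2) (ε / 4) with hγ'
  have hγ0 : 0 < γ' := by positivity
  have hγ1 : γ' ≤ γ / 2 := min_le_left _ _
  have hγ2 : γ' ≤ ε / 4 := min_le_right _ _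
  set p := min (ε ^ 2) 1 with hp
  have hp0 : 0 < p := by positivity
  have hp1 : p ≤ 1 := min_le_right _ _
  have hp2 : p ≤ ε ^ 2 := min_le_left _ _
  obtain ⟨κ, hκ, n₁, hn₁⟩ := exists_pow_four_mul_pow_floor_lt (q := 1 - p / 2)
    (by linarith) (by linarith) hγ0
  refine ⟨κ, hκ, max n₁ 1, ?_⟩
  intro V _ G c b hn hb hbε U hU
  set n := Fintype.card V with hnV
  simp only [max_le_iff] at hn
  obtain ⟨hn1, hn2⟩ := hn
  have hn2' : (1 : ℝ) ≤ n := by exact_mod_cast hn2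
  obtain ⟨h, hh, hlt⟩ := hn₁ n hn1
  set m := ⌊γ' * n⌋₊ with hm
  have hmle : (m : ℝ) ≤ γ' * n := Nat.floor_le (by positivity)
  have hm1 : (m : ℝ) ≤ γ / 2 * n := hmle.trans (by gcongr)
  have hm2 : (m : ℝ) ≤ ε / 4 * n := hmle.trans (by gcongr)
  have : Nonempty V := Fintype.card_pos_iff.1 (by omega)
  have hεn : 0 < ε * n := by positivity
  obtain ⟨F, hF, hFZ, hFd, -, hsum⟩ := exists_disjoint_selection (τ := V × V)
    (ω := V × V × V × V) (fun q => {q.1, q.2})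
    (fun q => ⟨q.1, by simp⟩) (k := 2) (fun q => card_le_two)
    (fun w q => Connects G c w.1 (c w.1 w.2.1) w.2.2.1 (c w.2.2.1 w.2.2.2) q.1 q.2)
    hp0 U (z := #U + 2 * m) (by
      intro w Z hZ
      have h0 : (3 * b + (#U + 2 * m) : ℝ) + ε * n ≤ n := by nlinarith
      have h1 : 3 * b + (#U + 2 * m) ≤ n := by
        have : (3 * b + (#U + 2 * m) : ℝ) ≤ n := by linarith
        exact_mod_cast this
      have h2 := card_connects_ge hb w.1 w.2.2.1 (c w.1 w.2.1) (c w.2.2.1 w.2.2.2) Z hZ h1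
      have h3 : ε * n ≤ ((n - 3 * b - (#U + 2 * m) : ℕ) : ℝ) := by
        rw [Nat.sub_sub, Nat.cast_sub h1]
        push_cast
        linarith
      have h4 : ε * n ≤ ((n - b - (#U + 2 * m) : ℕ) : ℝ) :=
        h3.trans (by exact_mod_cast (by omega))
      have h5 : Fintype.card (V × V) = n * n := by
        simp only [Fintype.card_prod, ← hnV]
      rw [h5]
      calc p * ((n * n : ℕ) : ℝ) ≤ ε ^ 2 * (n * n) := by push_cast; gcongr
        _ = (ε * n) * (ε * n) := by ring
        _ ≤ ((n - 3 * b - (#U + 2 * m) : ℕ) : ℝ) * ((n - b - (#U + 2 * m) : ℕ) : ℝ) :=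
          mul_le_mul h3 h4 hεn.le (by positivity)
        _ ≤ _ := by
          rw [← Nat.cast_mul, Nat.cast_le]
          refine h2.trans (card_le_card fun q hq => ?_)
          simp only [mem_filter, mem_univ, true_and, disjoint_insert_left,
            disjoint_singleton_left] at hq ⊢
          exact hq) m le_rfl
  have hω : Fintype.card (V × V × V × V) = n * (n * (n * n)) := by
    simp only [Fintype.card_prod, ← hnV]
  have hFlt := lt_card_filter_of_sum_lt _ F (h := h) (hsum.trans_lt (by
    have : ((n * (n * (n * n)) : ℕ) : ℝ) = (n : ℝ) ^ 4 := by push_cast; ring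
    rw [hω, this]
    exact hlt))
  refine ⟨F.biUnion fun q => {q.1, q.2}, h, ?_, ?_, hh,
    supply_of_family hFd fun u u' v v' => hFlt (u, u', v, v')⟩
  · rw [disjoint_biUnion_left]
    exact hFZ
  · have h1 := card_biUnion_le_card_mul F (fun q => ({q.1, q.2} : Finset V)) 2 fun q _ => card_le_two
    rw [hF] at h1
    have h2 : (#(F.biUnion fun q => {q.1, q.2}) : ℝ) ≤ m * 2 := by exact_mod_cast h1
    linarith

end Reservoir

section TwoMatchings

open scoped Classical
open Finset

variable {V : Type*} {G H H' : SimpleGraph V} {c : V → V → ℕ}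

/-- The vertices `x` and `y` are joined by a walk of length at most `r`. -/
def Near (H : SimpleGraph V) (r : ℕ) (x y : V) : Prop :=
  ∃ w : H.Walk x y, w.length ≤ r

lemma Near.refl (r : ℕ) (x : V) : Near H r x x := ⟨.nil, by simp⟩

lemma Near.symm {r : ℕ} {x y : V} (h : Near H r x y) : Near H r y x := by
  obtain ⟨w, hw⟩ := h
  exact ⟨w.reverse, by simpa using hw⟩

lemma Near.trans {r s : ℕ} {x y z : V} (h : Near H r x y) (h' : Near H s y z) :
    Near H (r + s) x z := by
  obtain ⟨w, hw⟩ := h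
  obtain ⟨w', hw'⟩ := h'
  exact ⟨w.append w', by rw [Walk.length_append]; omega⟩

lemma Near.mono {r s : ℕ} {x y : V} (h : Near H r x y) (hle : H ≤ H') (hrs : r ≤ s) :
    Near H' s x y := by
  obtain ⟨w, hw⟩ := h
  exact ⟨w.mapLe hle, by rw [Walk.length_map]; omega⟩

lemma near_of_adj {x y : V} (h : H.Adj x y) : Near H 1 x y := ⟨h.toWalk, by simp⟩

lemma near_sup_edge {p q x y : V} {r : ℕ} (h : Near (H ⊔ edge p q) r x y) :
    Near H r x y ∨ ∃ r₁ r₂, r₁ + r₂ + 1 ≤ r ∧ ((Near H r₁ x p ∧ Near H r₂ q y) ∨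
      (Near H r₁ x q ∧ Near H r₂ p y)) := by
  obtain ⟨w, hw⟩ := h
  induction w generalizing r with
  | nil => exact .inl (Near.refl _ _)
  | @cons x z y hadj w ih =>
    rw [Walk.length_cons] at hw
    have ih := ih (r := r - 1) (by omega)
    rw [sup_adj, edge_adj] at hadj
    rcases hadj with hadj | ⟨⟨rfl, rfl⟩ | ⟨rfl, rfl⟩, -⟩
    · rcases ih with h | ⟨r₁, r₂, hr, ⟨h1, h2⟩ | ⟨h1, h2⟩⟩
      · exact .inl (((near_of_adj hadj).trans h).mono le_rfl (by omega))
      · exact .inr ⟨1 + r₁, r₂, by omega, .inl ⟨(near_of_adj hadj).trans h1, h2⟩⟩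
      · exact .inr ⟨1 + r₁, r₂, by omega, .inr ⟨(near_of_adj hadj).trans h1, h2⟩⟩
    · rcases ih with h | ⟨r₁, r₂, hr, ⟨h1, h2⟩ | ⟨h1, h2⟩⟩
      · exact .inr ⟨0, r - 1, by omega, .inl ⟨Near.refl _ _, h⟩⟩
      · exact .inr ⟨0, r₂, by omega, .inl ⟨Near.refl _ _, h2⟩⟩
      · exact .inl (h2.mono le_rfl (by omega))
    · rcases ih with h | ⟨r₁, r₂, hr, ⟨h1, h2⟩ | ⟨h1, h2⟩⟩
      · exact .inr ⟨0, r - 1, by omega, .inr ⟨Near.refl _ _, h⟩⟩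
      · exact .inl (h2.mono le_rfl (by omega))
      · exact .inr ⟨0, r₂, by omega, .inr ⟨Near.refl _ _, h2⟩⟩

lemma near_or_near_of_near_sup_edge {p q x y : V} {r : ℕ} (h : Near (H ⊔ edge p q) r x y) :
    Near H r x y ∨ ((Near H r x p ∨ Near H r x q) ∧ (Near H r y p ∨ Near H r y q)) := by
  rcases near_sup_edge h with h | ⟨r₁, r₂, hr, ⟨h1, h2⟩ | ⟨h1, h2⟩⟩
  · exact .inl h
  · exact .inr ⟨.inl (h1.mono le_rfl (by omega)), .inr (h2.symm.mono le_rfl (by omega))⟩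
  · exact .inr ⟨.inr (h1.mono le_rfl (by omega)), .inl (h2.symm.mono le_rfl (by omega))⟩

/-- A properly coloured subgraph of `G[S]` of maximum degree two, without cycles of length at most
`L + 1`. -/
structure IsPCTwoMatching (G : SimpleGraph V) (c : V → V → ℕ) (S : Finset V) (L : ℕ)
    (H : SimpleGraph V) : Prop where
  le : H ≤ G
  mem : ∀ {x y}, H.Adj x y → x ∈ S
  degree : ∀ {x y z w}, H.Adj x y → H.Adj x z → H.Adj x w → y = z ∨ y = w ∨ z = w
  colour : ∀ {x y z}, H.Adj x y → H.Adj x z → y ≠ z → c x y ≠ c x z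
  girth : ∀ {x y}, H.Adj x y → ¬ Near (H.deleteEdges {s(x, y)}) L x y

variable {S : Finset V} {L : ℕ}

lemma IsPCTwoMatching.mono (hH : IsPCTwoMatching G c S L H) (hle : H' ≤ H) :
    IsPCTwoMatching G c S L H' where
  le := hle.trans hH.le
  mem h := hH.mem (hle h)
  degree h₁ h₂ h₃ := hH.degree (hle h₁) (hle h₂) (hle h₃)
  colour h₁ h₂ := hH.colour (hle h₁) (hle h₂)
  girth h h' := hH.girth (hle h) (h'.mono (deleteEdges_mono hle) le_rfl)

lemma IsPCTwoMatching.sup_edge (hH : IsPCTwoMatching G c S L H) {p q : V} (hpq : G.Adj p q)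
    (hpS : p ∈ S) (hqS : q ∈ S) (hp : ∀ z, H.Adj p z → c p z ≠ c p q)
    (hq : ∀ z, H.Adj q z → c q z ≠ c q p) (hp' : ∀ z w, H.Adj p z → H.Adj p w → z = w)
    (hq' : ∀ z w, H.Adj q z → H.Adj q w → z = w) (hfar : ¬ Near H L p q) :
    IsPCTwoMatching G c S L (H ⊔ edge p q) where
  le := sup_le hH.le (by
    intro x y h
    rw [edge_adj] at h
    rcases h with ⟨⟨rfl, rfl⟩ | ⟨rfl, rfl⟩, -⟩
    exacts [hpq, hpq.symm])
  mem {x y} h := by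
    rw [sup_adj, edge_adj] at h
    rcases h with h | ⟨⟨rfl, rfl⟩ | ⟨rfl, rfl⟩, -⟩
    exacts [hH.mem h, hpS, hqS]
  degree {x y z w} h₁ h₂ h₃ := by
    have key : ∀ p q, p ≠ q → (∀ z w, H.Adj p z → H.Adj p w → z = w) →
        ∀ z w, (H.Adj p z ∨ p = p ∧ z = q ∨ p = q ∧ z = p) →
          (H.Adj p w ∨ p = p ∧ w = q ∨ p = q ∧ w = p) → q = z ∨ q = w ∨ z = w := by
      intro p q hne hp z w hz hw
      rcases hz with hz | ⟨-, rfl⟩ | ⟨rfl, -⟩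
      · rcases hw with hw | ⟨-, rfl⟩ | ⟨rfl, -⟩
        · exact .inr (.inr (hp _ _ hz hw))
        · exact .inr (.inl rfl)
        · exact (hne rfl).elim
      · exact .inl rfl
      · exact (hne rfl).elim
    have key' : ∀ {y z w}, (x = p ∧ y = q ∨ x = q ∧ y = p) → (H ⊔ edge p q).Adj x z →
        (H ⊔ edge p q).Adj x w → y = z ∨ y = w ∨ z = w := by
      rintro y z w (⟨rfl, rfl⟩ | ⟨rfl, rfl⟩) hz hw <;> rw [sup_adj, edge_adj] at hz hw
      · exact key _ _ hpq.ne hp' _ _ (hz.imp_right And.left) (hw.imp_right And.left)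
      · exact key _ _ hpq.ne.symm hq' _ _ (hz.imp_right fun h => h.1.symm)
          (hw.imp_right fun h => h.1.symm)
    by_cases h₁' : H.Adj x y
    · by_cases h₂' : H.Adj x z
      · by_cases h₃' : H.Adj x w
        · exact hH.degree h₁' h₂' h₃'
        · rcases key' (((edge_adj ..).1 (h₃.resolve_left h₃')).1) h₁ h₂ with h | h | h <;>
            simp [h]
      · rcases key' (((edge_adj ..).1 (h₂.resolve_left h₂')).1) h₁ h₃ with h | h | h <;>
          simp [h]
    · exact key' (((edge_adj ..).1 (h₁.resolve_left h₁')).1) h₂ h₃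
  colour {x y z} h₁ h₂ hyz := by
    simp only [sup_adj, edge_adj] at h₁ h₂
    rcases h₁ with h₁ | ⟨⟨rfl, rfl⟩ | ⟨rfl, rfl⟩, h₁⟩ <;>
      rcases h₂ with h₂ | ⟨⟨h₃, h₄⟩ | ⟨h₃, h₄⟩, h₂⟩
    · exact hH.colour h₁ h₂ hyz
    · subst h₃ h₄; exact hp _ h₁
    · subst h₃ h₄; exact hq _ h₁
    · exact (hp _ h₂).symm
    · exact (hyz h₄.symm).elim
    · exact (h₁ h₃).elim
    · exact (hq _ h₂).symm
    · exact (h₁ h₃).elim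
    · exact (hyz h₄.symm).elim
  girth {x y} h h' := by
    by_cases hxy : H.Adj x y
    · have hne : s(x, y) ≠ s(p, q) := by
        intro he
        have : H.Adj p q := by
          rw [← mem_edgeSet, ← he]
          exact hxy
        exact hp q this rfl
      have hle : (H ⊔ edge p q).deleteEdges {s(x, y)} ≤ H.deleteEdges {s(x, y)} ⊔ edge p q := by
        intro a b hab
        simp only [deleteEdges_adj, sup_adj] at hab ⊢
        tauto
      rcases near_sup_edge (h'.mono hle le_rfl) with h | ⟨r₁, r₂, hr, ⟨h1, h2⟩ | ⟨h1, h2⟩⟩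
      · exact hH.girth hxy h
      · exact hfar (((h1.symm.mono (deleteEdges_le _) le_rfl).trans ((near_of_adj hxy).trans
          (h2.symm.mono (deleteEdges_le _) le_rfl))).mono le_rfl (by omega))
      · exact hfar (((h1.symm.mono (deleteEdges_le _) le_rfl).trans ((near_of_adj hxy).trans
          (h2.symm.mono (deleteEdges_le _) le_rfl))).symm.mono le_rfl (by omega))
    · have he : s(x, y) = s(p, q) := by
        rw [sup_adj, edge_adj] at h
        rcases h with h | ⟨⟨rfl, rfl⟩ | ⟨rfl, rfl⟩, -⟩
        exacts [(hxy h).elim, rfl, Sym2.eq_swap]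
      have hle : (H ⊔ edge p q).deleteEdges {s(x, y)} ≤ H := by
        intro a b hab
        simp only [deleteEdges_adj, sup_adj, edge_adj, he, Set.mem_singleton_iff, Sym2.eq_iff] at hab
        tauto
      have := h'.mono hle le_rfl
      rw [Sym2.eq_iff] at he
      rcases he with ⟨rfl, rfl⟩ | ⟨rfl, rfl⟩
      exacts [hfar this, hfar this.symm]

variable [Fintype V]

lemma ncard_edgeSet_sup_edge {p q : V} (hne : p ≠ q) (h : ¬ H.Adj p q) :
    (H ⊔ edge p q).edgeSet.ncard = H.edgeSet.ncard + 1 := by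
  have : (H ⊔ edge p q).edgeSet = insert s(p, q) H.edgeSet := by
    rw [edgeSet_sup, edgeSet_edge_of_ne hne, Set.union_singleton]
  rw [this, Set.ncard_insert_of_notMem (by simpa using h) (Set.toFinite _)]

lemma ncard_edgeSet_deleteEdges {p q : V} (h : H.Adj p q) :
    (H.deleteEdges {s(p, q)}).edgeSet.ncard + 1 = H.edgeSet.ncard := by
  rw [edgeSet_deleteEdges]
  exact Set.ncard_sdiff_singleton_add_one (by simpa using h) (Set.toFinite _)

lemma IsPCTwoMatching.card_near_le (hH : IsPCTwoMatching G c S L H) (r : ℕ) (x : V) :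
    #(univ.filter fun y => Near H r x y) ≤ 3 ^ r := by
  induction r generalizing x with
  | zero =>
    refine card_le_one.2 ?_
    have : ∀ y, y ∈ (univ.filter fun y => Near H 0 x y) → x = y := by
      intro y hy
      simp only [mem_filter, mem_univ, true_and] at hy
      obtain ⟨w, hw⟩ := hy
      exact Walk.eq_of_length_eq_zero (Nat.le_zero.1 hw)
    intro y hy z hz
    rw [← this y hy, ← this z hz]
  | succ r ih =>
    have hdeg : #(univ.filter fun y => H.Adj x y) ≤ 2 := by
      by_contra! h
      obtain ⟨y, z, w, hy, hz, hw, h1, h2, h3⟩ := two_lt_card_iff.1 h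
      simp only [mem_filter, mem_univ, true_and] at hy hz hw
      rcases hH.degree hy hz hw with h | h | h
      exacts [h1 h, h2 h, h3 h]
    have hsub : (univ.filter fun y => Near H (r + 1) x y) ⊆
        insert x ((univ.filter fun y => H.Adj x y).biUnion
          fun z => univ.filter fun y => Near H r z y) := by
      intro y hy
      simp only [mem_filter, mem_univ, true_and, mem_insert, mem_biUnion] at hy ⊢
      obtain ⟨w, hw⟩ := hy
      cases w with
      | nil => exact .inl rfl
      | cons h w => exact .inr ⟨_, h, w, by simpa using hw⟩
    have h1 := card_le_card hsub
    have h2 := card_insert_le x ((univ.filter fun y => H.Adj x y).biUnion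
          fun z => univ.filter fun y => Near H r z y)
    have h3 := card_biUnion_le_card_mul (univ.filter fun y => H.Adj x y)
      (fun z => univ.filter fun y => Near H r z y) (3 ^ r) fun z _ => ih z
    have h4 := Nat.mul_le_mul_right (3 ^ r) hdeg
    have h5 : 0 < 3 ^ r := by positivity
    rw [pow_succ]
    omega

end TwoMatchings

section FibreCounting

open scoped Classical
open Finset

variable {V : Type*}

lemma card_eq_card_add_two_mul_card {T : Finset V} {f : V → V}
    (hf : ∀ x, #(T.filter (f · = x)) ≤ 2) :
    #T = #((T.image f).filter fun x => #(T.filter (f · = x)) ≠ 2) +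
      2 * #((T.image f).filter fun x => #(T.filter (f · = x)) = 2) := by
  rw [card_eq_sum_card_image f T, ← sum_filter_add_sum_filter_not (T.image f)
    (fun x => #(T.filter (f · = x)) = 2), add_comm]
  congr 1
  · rw [card_eq_sum_ones]
    refine sum_congr rfl fun x hx => ?_
    rw [mem_filter, mem_image] at hx
    obtain ⟨⟨t, ht, rfl⟩, h2⟩ := hx
    have h1 : 0 < #(T.filter (f · = f t)) := card_pos.2 ⟨t, by simp [ht]⟩
    have h3 := hf (f t)
    omega
  · rw [mul_comm, ← smul_eq_mul]
    exact sum_const_nat fun x hx => (mem_filter.1 hx).2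

/-- Two large sets, partitioned into fibres of size at most two, such that any two fibres conflict
in a restricted way, do not exist. -/
lemma false_of_fibre_conflicts {T T' : Finset V} {f g : V → V} {B B' : V → Finset V} {β : ℕ}
    (hf : ∀ x, #(T.filter (f · = x)) ≤ 2) (hg : ∀ y, #(T'.filter (g · = y)) ≤ 2)
    (hB : ∀ x ∈ T.image f, #(B x) ≤ β) (hB' : ∀ y ∈ T'.image g, #(B' y) ≤ β)
    (hpair : ∀ x ∈ T.image f, ∀ y ∈ T'.image g, y ∈ B x ∨ x ∈ B' y)
    (h2 : ∀ x ∈ T.image f, #(T.filter (f · = x)) = 2 → ∀ y ∈ T'.image g, y ∈ B x → x ∈ B' y)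
    (h2' : ∀ y ∈ T'.image g, #(T'.filter (g · = y)) = 2 → ∀ x ∈ T.image f, x ∈ B' y → y ∈ B x)
    (hT : 2 * β < #T) (hT' : 2 * β < #T') : False := by
  set X := T.image f with hX
  set Y := T'.image g with hY
  set X₁ := X.filter fun x => #(T.filter (f · = x)) ≠ 2 with hX₁
  set X₂ := X.filter fun x => #(T.filter (f · = x)) = 2 with hX₂
  set Y₁ := Y.filter fun y => #(T'.filter (g · = y)) ≠ 2 with hY₁
  set Y₂ := Y.filter fun y => #(T'.filter (g · = y)) = 2 with hY₂
  have hTc : #T = #X₁ + 2 * #X₂ := card_eq_card_add_two_mul_card hf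
  have hTc' : #T' = #Y₁ + 2 * #Y₂ := card_eq_card_add_two_mul_card hg
  have hb : ∀ x ∈ X₁, #(Y₁.filter (· ∈ B x)) + #Y₂ ≤ β := by
    intro x hx
    have hxX := (mem_filter.1 hx).1
    have hdis : Disjoint (Y₁.filter (· ∈ B x)) Y₂ := by
      rw [Finset.disjoint_left]
      intro y hy hy'
      exact (mem_filter.1 (mem_filter.1 hy).1).2 (mem_filter.1 hy').2
    rw [← card_union_of_disjoint hdis]
    refine (card_le_card ?_).trans (hB x hxX)
    intro y hy
    rcases mem_union.1 hy with hy | hy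
    · exact (mem_filter.1 hy).2
    · obtain ⟨hyY, hy2⟩ := mem_filter.1 hy
      exact (hpair x hxX y hyY).elim id (h2' y hyY hy2 x hxX)
  have hb' : ∀ y ∈ Y₁, #(X₁.filter (· ∈ B' y)) + #X₂ ≤ β := by
    intro y hy
    have hyY := (mem_filter.1 hy).1
    have hdis : Disjoint (X₁.filter (· ∈ B' y)) X₂ := by
      rw [Finset.disjoint_left]
      intro x hx hx'
      exact (mem_filter.1 (mem_filter.1 hx).1).2 (mem_filter.1 hx').2
    rw [← card_union_of_disjoint hdis]
    refine (card_le_card ?_).trans (hB' y hyY)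
    intro x hx
    rcases mem_union.1 hx with hx | hx
    · exact (mem_filter.1 hx).2
    · obtain ⟨hxX, hx2⟩ := mem_filter.1 hx
      exact (hpair x hxX y hyY).elim (h2 x hxX hx2 y hyY) id
  have hsum : #X₁ * #Y₁ ≤ ∑ x ∈ X₁, #(Y₁.filter (· ∈ B x)) + ∑ y ∈ Y₁, #(X₁.filter (· ∈ B' y)) := by
    have e1 : ∑ x ∈ X₁, #(Y₁.filter (· ∈ B x)) = #((X₁ ×ˢ Y₁).filter fun p => p.2 ∈ B p.1) := by
      simp only [card_filter, sum_product]
    have e2 : ∑ y ∈ Y₁, #(X₁.filter (· ∈ B' y)) = #((X₁ ×ˢ Y₁).filter fun p => p.1 ∈ B' p.2) := by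
      simp only [card_filter, sum_product_right]
    rw [e1, e2, ← card_product]
    refine (card_le_card ?_).trans (card_union_le _ _)
    rintro ⟨x, y⟩ hp
    rw [← filter_or, mem_filter]
    rw [mem_product] at hp
    exact ⟨mem_product.2 hp, hpair x (mem_filter.1 hp.1).1 y (mem_filter.1 hp.2).1⟩
  have hs := sum_le_card_nsmul _ _ _ hb
  have hs' := sum_le_card_nsmul _ _ _ hb'
  rw [sum_add_distrib, sum_const, smul_eq_mul, smul_eq_mul] at hs hs'
  have hzero : #X₁ + #Y₁ = 0 := by
    by_contra hne
    have : 0 < #X₁ + #Y₁ := Nat.pos_of_ne_zero hne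
    have h1 : #X₁ * (2 * β + 1) ≤ #X₁ * (#Y₁ + 2 * #Y₂) := Nat.mul_le_mul_left _ (by omega)
    have h3 : #Y₁ * (2 * β + 1) ≤ #Y₁ * (#X₁ + 2 * #X₂) := Nat.mul_le_mul_left _ (by omega)
    nlinarith
  have hXne : 0 < #X₂ := by omega
  obtain ⟨x, hx⟩ := card_pos.1 hXne
  obtain ⟨hxX, -⟩ := mem_filter.1 hx
  have : #Y₂ ≤ β := by
    refine (card_le_card ?_).trans (hB x hxX)
    intro y hy
    obtain ⟨hyY, hy2⟩ := mem_filter.1 hy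
    exact (hpair x hxX y hyY).elim id (h2' y hyY hy2 x hxX)
  omega

end FibreCounting

section Leaves

open scoped Classical
open Finset

variable {V : Type*} [Fintype V] {G H : SimpleGraph V} {c : V → V → ℕ} {S : Finset V} {L : ℕ}

/-- In `H`, the edge `tx` can be replaced by the edge `ut`; afterwards every edge at `x` has
colour `o`. The vertex `t` is far from both `u` and `v`. -/
structure IsSwitch (G : SimpleGraph V) (c : V → V → ℕ) (S : Finset V) (L : ℕ) (H : SimpleGraph V)
    (u v t x : V) (o : ℕ) : Prop where
  mem : t ∈ S
  adj : G.Adj u t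
  colour_left : ∀ z, H.Adj u z → c u z ≠ c u t
  far_left : ¬ Near H (L + 2) u t
  far_right : ¬ Near H (L + 2) v t
  old : H.Adj t x
  colour_right : ∀ z, H.Adj t z → z ≠ x → c t z ≠ c t u
  colour_end : ∀ z, H.Adj x z → z ≠ t → c x z = o

lemma false_of_isSwitch (hH : IsPCTwoMatching G c S L H) (hc : ∀ u v, c u v = c v u)
    (hmax : ∀ H', IsPCTwoMatching G c S L H' → H'.edgeSet.ncard ≤ H.edgeSet.ncard)
    {u v t x t' x' : V} {o o' : ℕ} (huS : u ∈ S) (hvS : v ∈ S)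
    (hu : ∀ y z, H.Adj u y → H.Adj u z → y = z) (hv : ∀ y z, H.Adj v y → H.Adj v z → y = z)
    (huv : ¬ Near H (L + 2) u v) (hs : IsSwitch G c S L H u v t x o)
    (hs' : IsSwitch G c S L H v u t' x' o') (hfar : ¬ Near H (L + 2) x x') (hadj : G.Adj x x')
    (ho : c x x' ≠ o) (ho' : c x x' ≠ o') : False := by
  have far : ∀ {a b r}, ¬ Near H r a b → L ≤ r → ¬ Near H L a b :=
    fun h hr h' => h (h'.mono le_rfl hr)
  have nuv : ¬ Near H L u v := far huv (by omega)
  have nut : ¬ Near H L u t := far hs.far_left (by omega)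
  have nvt : ¬ Near H L v t := far hs.far_right (by omega)
  have nut' : ¬ Near H L u t' := far hs'.far_right (by omega)
  have nvt' : ¬ Near H L v t' := far hs'.far_left (by omega)
  have nux : ¬ Near H L u x := fun h =>
    hs.far_left ((h.trans (near_of_adj hs.old.symm)).mono le_rfl (by omega))
  have nvx : ¬ Near H L v x := fun h =>
    hs.far_right ((h.trans (near_of_adj hs.old.symm)).mono le_rfl (by omega))
  have nux' : ¬ Near H L u x' := fun h =>
    hs'.far_right ((h.trans (near_of_adj hs'.old.symm)).mono le_rfl (by omega))
  have nvx' : ¬ Near H L v x' := fun h =>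
    hs'.far_left ((h.trans (near_of_adj hs'.old.symm)).mono le_rfl (by omega))
  have nxx' : ¬ Near H L x x' := far hfar (by omega)
  have nxt' : ¬ Near H L x t' := fun h =>
    hfar ((h.trans (near_of_adj hs'.old)).mono le_rfl (by omega))
  have ntx' : ¬ Near H L t x' := fun h =>
    hfar (((near_of_adj hs.old.symm).trans h).mono le_rfl (by omega))
  have ntt' : ¬ Near H L t t' := fun h =>
    hfar ((((near_of_adj hs.old.symm).trans h).trans (near_of_adj hs'.old)).mono le_rfl (by omega))
  have ne : ∀ {a b}, ¬ Near H L a b → a ≠ b := by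
    rintro a b h rfl
    exact h (Near.refl _ _)
  have ht'x' : (H.deleteEdges {s(t, x)}).Adj t' x' := by
    rw [deleteEdges_adj]
    refine ⟨hs'.old, ?_⟩
    simp only [Set.mem_singleton_iff, Sym2.eq_iff, not_or, not_and]
    exact ⟨fun h => (ne ntt' h.symm).elim, fun h => (ne nxt' h.symm).elim⟩
  have hc1 := ncard_edgeSet_deleteEdges hs.old
  have hc1' := ncard_edgeSet_deleteEdges ht'x'
  set H₁ := (H.deleteEdges {s(t, x)}).deleteEdges {s(t', x')} with hH₁
  have hle : H₁ ≤ H := (deleteEdges_le _).trans (deleteEdges_le _)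
  have h1 : ∀ {a b}, H₁.Adj a b → H.Adj a b ∧ s(a, b) ≠ s(t, x) ∧ s(a, b) ≠ s(t', x') := by
    intro a b h
    simp only [hH₁, deleteEdges_adj, Set.mem_singleton_iff] at h
    tauto
  have n1 : ∀ {a b}, ¬ Near H L a b → ¬ Near H₁ L a b := fun h h' => h (h'.mono hle le_rfl)
  have hV₁ : IsPCTwoMatching G c S L H₁ := hH.mono hle
  have hu1 : ∀ z, H₁.Adj u z → c u z ≠ c u t := fun z hz => hs.colour_left z (hle hz)
  have hV₂ : IsPCTwoMatching G c S L (H₁ ⊔ edge u t) := by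
    refine hV₁.sup_edge hs.adj huS hs.mem hu1 ?_ (fun z w hz hw => hu _ _ (hle hz) (hle hw)) ?_
      (n1 nut)
    · intro z hz
      obtain ⟨hz, hz', -⟩ := h1 hz
      exact hs.colour_right z hz fun h => hz' (by rw [h])
    · intro z w hz hw
      obtain ⟨hz, hz', -⟩ := h1 hz
      obtain ⟨hw, hw', -⟩ := h1 hw
      rcases hH.degree hs.old hz hw with h | h | h
      exacts [(hz' (by rw [h])).elim, (hw' (by rw [h])).elim, h]
  have hc2 := ncard_edgeSet_sup_edge hs.adj.ne fun h => hu1 t h rfl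
  set H₂ := H₁ ⊔ edge u t with hH₂
  have h2 : ∀ {a b}, H₂.Adj a b → a ≠ u → a ≠ t → H₁.Adj a b := by
    intro a b h
    rw [hH₂, sup_adj, edge_adj] at h
    tauto
  have n2 : ∀ {a b}, ¬ Near H L a b → ¬ Near H L a u → ¬ Near H L a t → ¬ Near H₂ L a b := by
    intro a b h h' h'' hn
    rcases near_or_near_of_near_sup_edge hn with hn | ⟨hn | hn, -⟩
    exacts [n1 h hn, n1 h' hn, n1 h'' hn]
  have hv2 : ∀ z, H₂.Adj v z → c v z ≠ c v t' := fun z hz =>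
    hs'.colour_left z (hle (h2 hz (ne nuv).symm (ne nvt)))
  have sy : ∀ {a b}, ¬ Near H L a b → ¬ Near H L b a := fun h h' => h h'.symm
  have hV₃ : IsPCTwoMatching G c S L (H₂ ⊔ edge v t') := by
    refine hV₂.sup_edge hs'.adj hvS hs'.mem hv2 ?_ (fun z w hz hw =>
      hv _ _ (hle (h2 hz (ne nuv).symm (ne nvt))) (hle (h2 hw (ne nuv).symm (ne nvt)))) ?_
      (n2 nvt' (sy nuv) nvt)
    · intro z hz
      obtain ⟨hz, -, hz'⟩ := h1 (h2 hz (ne nut').symm (ne ntt').symm)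
      exact hs'.colour_right z hz fun h => hz' (by rw [h])
    · intro z w hz hw
      obtain ⟨hz, -, hz'⟩ := h1 (h2 hz (ne nut').symm (ne ntt').symm)
      obtain ⟨hw, -, hw'⟩ := h1 (h2 hw (ne nut').symm (ne ntt').symm)
      rcases hH.degree hs'.old hz hw with h | h | h
      exacts [(hz' (by rw [h])).elim, (hw' (by rw [h])).elim, h]
  have hc3 := ncard_edgeSet_sup_edge hs'.adj.ne fun h => hv2 t' h rfl
  set H₃ := H₂ ⊔ edge v t' with hH₃
  have h3 : ∀ {a b}, H₃.Adj a b → a ≠ u → a ≠ t → a ≠ v → a ≠ t' → H₁.Adj a b := by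
    intro a b h hu ht
    rw [hH₃, sup_adj, edge_adj] at h
    have := @h2 a b
    tauto
  have h3x : ∀ {z}, H₃.Adj x z → H.Adj x z ∧ z ≠ t := by
    intro z hz
    obtain ⟨hz, hz', -⟩ := h1 (h3 hz (ne nux).symm hs.old.ne.symm (ne nvx).symm (ne nxt'))
    exact ⟨hz, fun h => hz' (by rw [h, Sym2.eq_swap])⟩
  have h3x' : ∀ {z}, H₃.Adj x' z → H.Adj x' z ∧ z ≠ t' := by
    intro z hz
    obtain ⟨hz, -, hz'⟩ := h1 (h3 hz (ne nux').symm (ne ntx').symm (ne nvx').symm hs'.old.ne.symm)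
    exact ⟨hz, fun h => hz' (by rw [h, Sym2.eq_swap])⟩
  have hx3 : ∀ z, H₃.Adj x z → c x z ≠ c x x' := fun z hz => by
    obtain ⟨hz, hz'⟩ := h3x hz
    rw [hs.colour_end z hz hz']
    exact ho.symm
  have hV₄ : IsPCTwoMatching G c S L (H₃ ⊔ edge x x') := by
    refine hV₃.sup_edge hadj (hH.mem hs.old.symm) (hH.mem hs'.old.symm) hx3 ?_ ?_ ?_ ?_
    · intro z hz
      obtain ⟨hz, hz'⟩ := h3x' hz
      rw [hs'.colour_end z hz hz', hc x' x]
      exact ho'.symm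
    · intro z w hz hw
      obtain ⟨hz, hz'⟩ := h3x hz
      obtain ⟨hw, hw'⟩ := h3x hw
      rcases hH.degree hs.old.symm hz hw with h | h | h
      exacts [(hz' h.symm).elim, (hw' h.symm).elim, h]
    · intro z w hz hw
      obtain ⟨hz, hz'⟩ := h3x' hz
      obtain ⟨hw, hw'⟩ := h3x' hw
      rcases hH.degree hs'.old.symm hz hw with h | h | h
      exacts [(hz' h.symm).elim, (hw' h.symm).elim, h]
    · intro hn
      rcases near_or_near_of_near_sup_edge hn with hn | ⟨hn | hn, -⟩
      · exact n2 (sy nxx') (sy nux') (sy ntx') hn.symm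
      · exact n2 nvx (sy nuv) nvt hn.symm
      · exact n2 (sy nxt') (sy nut') (sy ntt') hn.symm
  have hc4 := ncard_edgeSet_sup_edge hadj.ne fun h => hx3 x' h rfl
  have := hmax _ hV₄
  omega

lemma exists_isSwitch (hH : IsPCTwoMatching G c S L H)
    (hmax : ∀ H', IsPCTwoMatching G c S L H' → H'.edgeSet.ncard ≤ H.edgeSet.ncard)
    {u v t : V} (huS : u ∈ S) (htS : t ∈ S) (hu : ∀ y z, H.Adj u y → H.Adj u z → y = z)
    (hadj : G.Adj u t) (hcol : ∀ z, H.Adj u z → c u z ≠ c u t) (hut : ¬ Near H (L + 2) u t)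
    (hvt : ¬ Near H (L + 2) v t) : ∃ x o, IsSwitch G c S L H u v t x o := by
  obtain ⟨x, hx, hx'⟩ : ∃ x, H.Adj t x ∧ ∀ z, H.Adj t z → z ≠ x → c t z ≠ c t u := by
    by_contra! hno
    have hcol' : ∀ z, H.Adj t z → c t z ≠ c t u := by
      intro z hz hz'
      obtain ⟨z', h1, h2, h3⟩ := hno z hz
      exact hH.colour h1 hz h2 (h3.trans hz'.symm)
    have hnone : ∀ z, ¬ H.Adj t z := by
      intro z hz
      obtain ⟨z', h1, h2, h3⟩ := hno z hz
      exact hcol' z' h1 h3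
    have := hmax _ (hH.sup_edge hadj huS htS hcol hcol' hu (fun z _ hz _ => (hnone z hz).elim)
      fun h => hut (h.mono le_rfl (by omega)))
    rw [ncard_edgeSet_sup_edge hadj.ne fun h => hcol t h rfl] at this
    omega
  obtain ⟨o, ho⟩ : ∃ o, ∀ z, H.Adj x z → z ≠ t → c x z = o := by
    by_cases h : ∃ z, H.Adj x z ∧ z ≠ t
    · obtain ⟨z, hz, hzt⟩ := h
      refine ⟨c x z, fun z' hz' hzt' => ?_⟩
      rcases hH.degree hx.symm hz hz' with h | h | h
      exacts [(hzt h.symm).elim, (hzt' h.symm).elim, by rw [h]]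
    · push Not at h
      exact ⟨0, fun z hz hzt => (hzt (h z hz)).elim⟩
  exact ⟨x, o, htS, hadj, hcol, hut, hvt, hx, hx', ho⟩

lemma exists_switches (hH : IsPCTwoMatching G c S L H)
    (hmax : ∀ H', IsPCTwoMatching G c S L H' → H'.edgeSet.ncard ≤ H.edgeSet.ncard)
    {b : ℕ} (hb : ∀ v a, #(badSet G c v a) ≤ b)
    (hn : 3 * b + #Sᶜ + 4 * 3 ^ (L + 2) < Fintype.card V)
    {u : V} (v : V) (huS : u ∈ S) (hu : ∀ y z, H.Adj u y → H.Adj u z → y = z) :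
    ∃ (T : Finset V) (f : V → V) (o : V → ℕ), 2 * (b + 3 ^ (L + 2)) < #T ∧
      ∀ t ∈ T, IsSwitch G c S L H u v t (f t) (o t) := by
  obtain ⟨a, ha⟩ : ∃ a, ∀ z, H.Adj u z → c u z = a := by
    by_cases h : ∃ z, H.Adj u z
    · obtain ⟨z, hz⟩ := h
      exact ⟨c u z, fun z' hz' => by rw [hu _ _ hz hz']⟩
    · push Not at h
      exact ⟨0, fun z hz => (h z hz).elim⟩
  set N : V → Finset V := fun w => univ.filter fun y => Near H (L + 2) w y with hN
  set T := ((badSet G c u a ∪ Sᶜ) ∪ (N u ∪ N v))ᶜ with hT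
  have hTs : ∀ t ∈ T, ∃ x o, IsSwitch G c S L H u v t x o := by
    intro t ht
    simp only [hT, hN, mem_compl, mem_union, not_or, not_not, notMem_badSet, mem_filter, mem_univ,
      true_and] at ht
    obtain ⟨⟨⟨h1, h2⟩, h3⟩, h4, h5⟩ := ht
    exact exists_isSwitch hH hmax huS h3 hu h1 (fun z hz => by rw [ha z hz]; exact h2.symm) h4 h5
  have : Nonempty V := ⟨u⟩
  choose! f o hfo using hTs
  refine ⟨T, f, o, ?_, hfo⟩
  have h1 := card_compl_union_ge (badSet G c u a ∪ Sᶜ) (N u ∪ N v)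
  rw [← hT] at h1
  have h2 := card_union_le (badSet G c u a) Sᶜ
  have h3 := card_union_le (N u) (N v)
  have h4 := hb u a
  have h5 : #(N u) ≤ 3 ^ (L + 2) := hH.card_near_le _ _
  have h6 : #(N v) ≤ 3 ^ (L + 2) := hH.card_near_le _ _
  omega

/-- The ends of the paths of a maximum two-matching are all close to each other. -/
lemma IsPCTwoMatching.near_of_isMax (hH : IsPCTwoMatching G c S L H) (hc : ∀ u v, c u v = c v u)
    (hmax : ∀ H', IsPCTwoMatching G c S L H' → H'.edgeSet.ncard ≤ H.edgeSet.ncard)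
    {b : ℕ} (hb : ∀ v a, #(badSet G c v a) ≤ b)
    (hn : 3 * b + #Sᶜ + 4 * 3 ^ (L + 2) < Fintype.card V) {u v : V} (huS : u ∈ S) (hvS : v ∈ S)
    (hu : ∀ y z, H.Adj u y → H.Adj u z → y = z) (hv : ∀ y z, H.Adj v y → H.Adj v z → y = z) :
    Near H (L + 2) u v := by
  by_contra huv
  obtain ⟨T, f, o, hT, hfo⟩ := exists_switches hH hmax hb hn v huS hu
  obtain ⟨T', g, o', hT', hgo⟩ := exists_switches hH hmax hb hn u hvS hv
  have hfib : ∀ {T : Finset V} {f : V → V}, (∀ t ∈ T, H.Adj t (f t)) →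
      ∀ x, #(T.filter (f · = x)) ≤ 2 := by
    intro T f h x
    by_contra! hlt
    obtain ⟨y, z, w, hy, hz, hw, h1, h2, h3⟩ := two_lt_card_iff.1 hlt
    have key : ∀ {y}, y ∈ T.filter (f · = x) → H.Adj x y := by
      intro y hy
      obtain ⟨hyT, rfl⟩ := mem_filter.1 hy
      exact (h y hyT).symm
    rcases hH.degree (key hy) (key hz) (key hw) with h | h | h
    exacts [h1 h, h2 h, h3 h]
  let B : Finset V → (V → V) → (V → ℕ) → V → Finset V := fun T f o x => univ.filter fun y =>
    Near H (L + 2) x y ∨ ¬ G.Adj x y ∨ ∀ t ∈ T, f t = x → c x y = o t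
  have hB : ∀ (T : Finset V) (f : V → V) (o : V → ℕ), ∀ x ∈ T.image f,
      #(B T f o x) ≤ b + 3 ^ (L + 2) := by
    intro T f o x hx
    obtain ⟨t, ht, rfl⟩ := mem_image.1 hx
    have hsub : B T f o (f t) ⊆ badSet G c (f t) (o t) ∪
        univ.filter fun y => Near H (L + 2) (f t) y := by
      intro y hy
      simp only [B, mem_filter, mem_univ, true_and, mem_union, mem_badSet] at hy ⊢
      rcases hy with hy | hy | hy
      · exact .inr hy
      · exact .inl fun h => hy h.1
      · exact .inl fun h => h.2 (hy t ht rfl)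
    exact (card_le_card hsub).trans ((card_union_le _ _).trans
      (add_le_add (hb _ _) (hH.card_near_le _ _)))
  have h2 : ∀ {T T' : Finset V} {f g : V → V} {o o' : V → ℕ} {u v : V},
      (∀ t ∈ T, IsSwitch G c S L H u v t (f t) (o t)) → ∀ x ∈ T.image f,
      #(T.filter (f · = x)) = 2 → ∀ y ∈ T'.image g, y ∈ B T f o x → x ∈ B T' g o' y := by
    intro T T' f g o o' u v hfo x hx hx2 y hy hyB
    simp only [B, mem_filter, mem_univ, true_and] at hyB ⊢
    rcases hyB with h | h | h
    · exact .inl h.symm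
    · exact .inr (.inl fun h' => h h'.symm)
    · obtain ⟨t₁, t₂, hne, ht⟩ := card_eq_two.1 hx2
      have ht₁ : t₁ ∈ T.filter (f · = x) := by rw [ht]; simp
      have ht₂ : t₂ ∈ T.filter (f · = x) := by rw [ht]; simp
      rw [mem_filter] at ht₁ ht₂
      have s₁ := hfo t₁ ht₁.1
      have s₂ := hfo t₂ ht₂.1
      rw [ht₁.2] at s₁
      rw [ht₂.2] at s₂
      have e₁ := s₁.colour_end t₂ s₂.old.symm hne.symm
      have e₂ := s₂.colour_end t₁ s₁.old.symm hne
      have := h t₁ ht₁.1 ht₁.2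
      have := h t₂ ht₂.1 ht₂.2
      exact (hH.colour s₁.old.symm s₂.old.symm hne (by omega)).elim
  refine false_of_fibre_conflicts (B := B T f o) (B' := B T' g o')
    (hfib fun t ht => (hfo t ht).old) (hfib fun t ht => (hgo t ht).old) (hB T f o) (hB T' g o') ?_
    (h2 hfo) (h2 hgo) hT hT'
  intro x hx y hy
  by_contra! hno
  simp only [B, mem_filter, mem_univ, true_and, not_or, not_not, not_forall] at hno
  obtain ⟨⟨h1, h3, t, ht, rfl, h4⟩, -, -, t', ht', rfl, h5⟩ := hno
  exact false_of_isSwitch hH hc hmax huS hvS hu hv huv (hfo t ht) (hgo t' ht') h1 h3 h4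
    (by rw [hc]; exact h5)

end Leaves

section PathCovers

open scoped Classical
open Finset

variable {V : Type*} {G H : SimpleGraph V} {c : V → V → ℕ} {S : Finset V} {L : ℕ}

lemma near_of_isChain {z u : V} {l : List V} (h : List.IsChain H.Adj (z :: (l ++ [u]))) :
    Near H (l.length + 1) z u := by
  induction l generalizing z with
  | nil => exact near_of_adj (by simpa using h)
  | cons y l ih =>
    rw [List.cons_append, List.isChain_cons_cons] at h
    exact ((near_of_adj h.1).trans (ih h.2)).mono le_rfl (by simp; omega)

lemma IsPCTwoMatching.lt_length_of_isChain (hH : IsPCTwoMatching G c S L H) {z y u : V}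
    {l : List V} (hnd : (z :: y :: (l ++ [u])).Nodup)
    (h : List.IsChain H.Adj (z :: y :: (l ++ [u]))) (hzu : H.Adj z u) : L < l.length + 2 := by
  by_contra! hlt
  rw [List.isChain_cons_cons] at h
  rw [List.nodup_cons] at hnd
  refine hH.girth hzu ?_
  have hzy : (H.deleteEdges {s(z, u)}).Adj z y := by
    rw [deleteEdges_adj]
    refine ⟨h.1, ?_⟩
    have : y ≠ u := by
      rintro rfl
      simp at hnd
    simp [this, hzu.ne]
  have hch : List.IsChain (H.deleteEdges {s(z, u)}).Adj (y :: (l ++ [u])) := by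
    refine h.2.imp_of_mem_imp ?_
    intro a b ha hb hab
    rw [deleteEdges_adj]
    refine ⟨hab, ?_⟩
    have h1 : a ≠ z := fun h => hnd.1 (h ▸ ha)
    have h2 : b ≠ z := fun h => hnd.1 (h ▸ hb)
    simp [h1, h2]
  exact ((near_of_adj hzy).trans (near_of_isChain hch)).mono le_rfl (by omega)

lemma IsPCTwoMatching.isPCWalk (hH : IsPCTwoMatching G c S L H) (hc : ∀ u v, c u v = c v u)
    {l : List V} (hnd : l.Nodup) (h : List.IsChain H.Adj l) : IsPCWalk G c l := by
  match l, hnd, h with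
  | [], _, _ => trivial
  | [_], _, _ => trivial
  | [a, b], _, h => exact hH.le (by simpa using h)
  | a :: b :: d :: l, hnd, h =>
    rw [List.isChain_cons_cons] at h
    have h2 := (List.isChain_cons_cons.1 h.2).1
    refine ⟨hH.le h.1, ?_, hH.isPCWalk hc (List.nodup_cons.1 hnd).2 h.2⟩
    rw [hc a b]
    refine hH.colour h.1.symm h2 ?_
    rintro rfl
    simp at hnd

/-- A vertex of a chain with an extra neighbour outside the chain is an end of the chain. -/
lemma IsPCTwoMatching.eq_nil_or_eq_nil (hH : IsPCTwoMatching G c S L H) {l₁ l₂ : List V} {z u : V}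
    (hnd : (l₁ ++ z :: l₂).Nodup) (h : List.IsChain H.Adj (l₁ ++ z :: l₂)) (hzu : H.Adj z u)
    (hu₁ : u ∉ l₁.getLast?) (hu₂ : u ∉ l₂.head?) : l₁ = [] ∨ l₂ = [] := by
  rcases l₁.eq_nil_or_concat with rfl | ⟨l₁, a, rfl⟩
  · exact .inl rfl
  rcases l₂ with _ | ⟨b, l₂⟩
  · exact .inr rfl
  exfalso
  simp only [List.concat_eq_append] at *
  have h1 : H.Adj a z := by
    have : l₁ ++ [a] ++ z :: b :: l₂ = l₁ ++ (a :: z :: (b :: l₂)) := by simp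
    rw [this] at h
    exact (List.isChain_cons_cons.1 (List.isChain_append.1 h).2.1).1
  have h2 : H.Adj z b := (List.isChain_cons_cons.1 (List.isChain_append.1 h).2.1).1
  rcases hH.degree h1.symm h2 hzu with h | h | h
  · subst h
    simp [List.nodup_append] at hnd
  · simp [h] at hu₁
  · simp [h] at hu₂

/-- A family of disjoint chains of `H` covering `S`. -/
structure IsChainCover (H : SimpleGraph V) (S : Finset V) (Ps : List (List V)) : Prop where
  ne_nil : ∀ P ∈ Ps, P ≠ []
  isChain : ∀ P ∈ Ps, List.IsChain H.Adj P
  nodup : Ps.flatten.Nodup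
  mem_iff : ∀ x, x ∈ Ps.flatten ↔ x ∈ S

lemma IsChainCover.perm {Ps Ps' : List (List V)} (h : IsChainCover H S Ps) (hp : Ps.Perm Ps') :
    IsChainCover H S Ps' where
  ne_nil P hP := h.ne_nil P (hp.mem_iff.2 hP)
  isChain P hP := h.isChain P (hp.mem_iff.2 hP)
  nodup := hp.flatten.nodup_iff.1 h.nodup
  mem_iff x := by rw [← hp.flatten.mem_iff]; exact h.mem_iff x

lemma IsChainCover.merge {P P' Q : List V} {Ps : List (List V)}
    (h : IsChainCover H S (P :: P' :: Ps)) (hQ : Q.Perm (P ++ P')) (hch : List.IsChain H.Adj Q) :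
    IsChainCover H S (Q :: Ps) := by
  have hp : (Q :: Ps).flatten.Perm (P :: P' :: Ps).flatten := by
    simp only [List.flatten_cons, ← List.append_assoc]
    exact hQ.append_right _
  refine ⟨?_, ?_, hp.nodup_iff.2 h.nodup, fun x => by rw [hp.mem_iff]; exact h.mem_iff x⟩
  · intro R hR
    rcases List.mem_cons.1 hR with rfl | hR
    · rintro rfl
      exact h.ne_nil P (by simp) (List.append_eq_nil_iff.1 hQ.nil_eq.symm).1
    · exact h.ne_nil R (by simp [hR])
  · intro R hR
    rcases List.mem_cons.1 hR with rfl | hR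
    exacts [hch, h.isChain R (by simp [hR])]

/-- In a minimal chain cover, each chain is long or ends in a leaf. -/
lemma IsPCTwoMatching.lt_length_or_leaf (hH : IsPCTwoMatching G c S L H) {Ps : List (List V)}
    (hPs : IsChainCover H S Ps) (hmin : ∀ Ps', IsChainCover H S Ps' → Ps.length ≤ Ps'.length)
    {l : List V} {u : V} (hP : l ++ [u] ∈ Ps) :
    L < (l ++ [u]).length ∨ ∀ y z, H.Adj u y → H.Adj u z → y = z := by
  by_contra! hno
  obtain ⟨hlen, y, y', hy, hy', hne⟩ := hno
  obtain ⟨z, hz, hzl⟩ : ∃ z, H.Adj u z ∧ z ∉ l.getLast? := by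
    by_cases h : y ∈ l.getLast?
    · refine ⟨y', hy', fun h' => hne ?_⟩
      rw [Option.mem_def] at h h'
      exact Option.some.inj (h.symm.trans h')
    · exact ⟨y, hy, h⟩
  have hnd : (l ++ [u]).Nodup := (List.nodup_flatten.1 hPs.nodup).1 _ hP
  have hch := hPs.isChain _ hP
  obtain ⟨P', hP', hzP'⟩ := List.mem_flatten.1 ((hPs.mem_iff z).2 (hH.mem hz.symm))
  obtain ⟨l₁, l₂, rfl⟩ := List.append_of_mem hzP'
  by_cases heq : l₁ ++ z :: l₂ = l ++ [u]
  · obtain rfl | ⟨l₂, w, rfl⟩ := l₂.eq_nil_or_concat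
    · exact hz.ne (by simpa using (List.append_inj' heq rfl).2.symm)
    rw [List.concat_eq_append] at *
    have heq' : l₁ ++ z :: l₂ = l ∧ [w] = [u] :=
      List.append_inj' (t₁ := [w]) (t₂ := [u]) (by simpa using heq) rfl
    obtain ⟨rfl, h⟩ := heq'
    obtain rfl : w = u := by simpa using h
    obtain _ | ⟨y, l₂⟩ := l₂
    · simp at hzl
    rcases hH.eq_nil_or_eq_nil (l₁ := l₁) (z := z) (l₂ := y :: l₂ ++ [w]) (u := w)
      (by simpa using hnd) (by simpa using hch) hz.symm (by
        intro h
        have := List.mem_of_getLast? h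
        rw [List.append_assoc, List.nodup_append] at hnd
        exact hnd.2.2 w this w (by simp) rfl) (by
        intro h
        simp only [List.cons_append, List.head?_cons, Option.mem_def, Option.some.injEq] at h
        subst h
        simp [List.nodup_append] at hnd) with rfl | h
    · have := hH.lt_length_of_isChain (by simpa using hnd) (by simpa using hch) hz.symm
      simp at hlen
      omega
    · simp at h
  · have hmem : l₁ ++ z :: l₂ ∈ Ps.erase (l ++ [u]) := (List.mem_erase_of_ne heq).2 hP'
    have hperm : Ps.Perm ((l ++ [u]) :: (l₁ ++ z :: l₂) ::
        (Ps.erase (l ++ [u])).erase (l₁ ++ z :: l₂)) :=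
      (List.perm_cons_erase hP).trans ((List.perm_cons_erase hmem).cons _)
    have hcov := hPs.perm hperm
    set Qs := (Ps.erase (l ++ [u])).erase (l₁ ++ z :: l₂)
    have hlt : ∀ Q : List V, Q.Perm ((l ++ [u]) ++ (l₁ ++ z :: l₂)) →
        ¬ List.IsChain H.Adj Q := by
      intro Q hQ hQc
      have h1 := hmin _ (hcov.merge hQ hQc)
      rw [hperm.length_eq] at h1
      simp at h1
    have hnd' := hcov.nodup
    simp only [List.flatten_cons, ← List.append_assoc] at hnd'
    have hdis : u ∉ l₁ ++ z :: l₂ := by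
      intro hmem
      rw [List.append_assoc, List.append_assoc, List.append_assoc] at hnd'
      have := (List.nodup_append.1 (List.nodup_append.1 hnd').2.1).2.2 u (by simp) u
        (by simp at hmem ⊢; tauto)
      exact this rfl
    have hch' := hPs.isChain _ hP'
    rcases hH.eq_nil_or_eq_nil ((List.nodup_flatten.1 hPs.nodup).1 _ hP') hch' hz.symm
      (fun h => hdis (List.mem_append_left _ (List.mem_of_getLast? h)))
      (fun h => hdis (List.mem_append_right _ (List.mem_cons_of_mem _ (List.mem_of_head? h))))
      with rfl | rfl
    · refine hlt _ (List.Perm.refl _) (List.isChain_append.2 ⟨hch, hch', ?_⟩)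
      simpa using hz
    · refine hlt ((l ++ [u]) ++ (l₁ ++ [z]).reverse) ((List.reverse_perm _).append_left _)
        (List.isChain_append.2 ⟨hch, ?_, ?_⟩)
      · rw [List.isChain_reverse]
        exact hch'.imp fun a b h => h.symm
      · simpa using hz

end PathCovers

section Covers

open scoped Classical
open Finset

variable {V : Type*} {G : SimpleGraph V} {c : V → V → ℕ}

lemma isPCTwoMatching_bot (G : SimpleGraph V) (c : V → V → ℕ) (S : Finset V) (L : ℕ) :
    IsPCTwoMatching G c S L ⊥ where
  le := bot_le
  mem h := h.elim
  degree h := h.elim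
  colour h := h.elim
  girth h := h.elim

lemma mul_length_le_of_forall {D : Finset V} {L : ℕ} {Ps : List (List V)}
    (h : ∀ P ∈ Ps, L < P.length ∨ ∃ x ∈ P, x ∈ D) :
    (L + 1) * Ps.length ≤ Ps.flatten.length + (L + 1) * Ps.flatten.countP (· ∈ D) := by
  induction Ps with
  | nil => simp
  | cons P Ps ih =>
    have ih := ih fun Q hQ => h Q (by simp [hQ])
    simp only [List.length_cons, List.flatten_cons, List.length_append, List.countP_append,
      mul_add, mul_one]
    rcases h P (by simp) with h | ⟨x, hx, hxD⟩
    · have := Nat.zero_le (L * P.countP (· ∈ D))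
      nlinarith
    · have h1 : 1 ≤ P.countP (· ∈ D) := List.countP_pos_iff.2 ⟨x, hx, by simpa using hxD⟩
      have h2 := Nat.mul_le_mul_left (L + 1) h1
      nlinarith

lemma countP_mem_le_card {l : List V} (hl : l.Nodup) (D : Finset V) :
    l.countP (· ∈ D) ≤ #D := by
  rw [List.countP_eq_length_filter, ← List.toFinset_card_of_nodup (hl.filter _)]
  exact card_le_card fun x hx => by simpa using (by simpa using hx : x ∈ l ∧ x ∈ D).2

lemma exists_walk_cover [Fintype V] (hc : ∀ u v, c u v = c v u) {b : ℕ}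
    (hb : ∀ v a, #(badSet G c v a) ≤ b) {S : Finset V} {L : ℕ}
    (hn : 3 * b + #Sᶜ + 4 * 3 ^ (L + 2) < Fintype.card V) :
    ∃ Ps : List (List V), (∀ P ∈ Ps, P ≠ [] ∧ IsPCWalk G c P) ∧ Ps.flatten.Nodup ∧
      (∀ x, x ∈ Ps.flatten ↔ x ∈ S) ∧ (L + 1) * Ps.length ≤ #S + (L + 1) * 3 ^ (L + 2) := by
  obtain ⟨H, hH, hmax⟩ := Set.exists_max_image {H | IsPCTwoMatching G c S L H}
    (fun H => H.edgeSet.ncard) (Set.toFinite _) ⟨⊥, isPCTwoMatching_bot G c S L⟩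
  have hH : IsPCTwoMatching G c S L H := hH
  have hex : ∃ k, ∃ Ps, IsChainCover H S Ps ∧ Ps.length = k := by
    have h : (S.toList.map fun x => [x]).flatten = S.toList := by
      rw [← List.flatMap_def]
      exact List.flatMap_singleton' _
    exact ⟨_, _, ⟨by simp, by simp, h ▸ S.nodup_toList, by simp [h]⟩, rfl⟩
  obtain ⟨Ps, hPs, hlen⟩ := Nat.find_spec hex
  have hmin : ∀ Ps', IsChainCover H S Ps' → Ps.length ≤ Ps'.length := fun Ps' h => by
    rw [hlen]
    exact Nat.find_min' hex ⟨Ps', h, rfl⟩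
  have hnodup := List.nodup_flatten.1 hPs.nodup
  refine ⟨Ps, fun P hP => ⟨hPs.ne_nil P hP,
    hH.isPCWalk hc (hnodup.1 P hP) (hPs.isChain P hP)⟩, hPs.nodup, hPs.mem_iff, ?_⟩
  set D : Finset V := S.filter fun u => ∀ y z, H.Adj u y → H.Adj u z → y = z with hD
  have hDcard : #D ≤ 3 ^ (L + 2) := by
    rcases D.eq_empty_or_nonempty with h | ⟨u, hu⟩
    · simp [h]
    · refine (card_le_card fun v hv => ?_).trans (hH.card_near_le (L + 2) u)
      rw [hD, mem_filter] at hu hv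
      simp only [mem_filter, mem_univ, true_and]
      exact hH.near_of_isMax hc hmax hb hn hu.1 hv.1 hu.2 hv.2
  have hkey := mul_length_le_of_forall (D := D) (L := L) (Ps := Ps) (by
    intro P hP
    obtain ⟨l, u, rfl⟩ := (List.eq_nil_or_concat P).resolve_left (hPs.ne_nil P hP)
    rw [List.concat_eq_append] at *
    refine (hH.lt_length_or_leaf hPs hmin hP).imp_right fun h => ⟨u, by simp, ?_⟩
    rw [hD, mem_filter]
    exact ⟨(hPs.mem_iff u).1 (List.mem_flatten.2 ⟨_, hP, by simp⟩), h⟩)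
  have hS : Ps.flatten.length ≤ #S := by
    rw [← List.toFinset_card_of_nodup hPs.nodup]
    exact card_le_card fun x hx => (hPs.mem_iff x).1 (by simpa using hx)
  have h2 := Nat.mul_le_mul_left (L + 1) ((countP_mem_le_card hPs.nodup D).trans hDcard)
  omega

lemma exists_cover {ε β : ℝ} (hε : 0 < ε) (hβ : 0 < β) :
    ∃ n₀ : ℕ, ∀ (V : Type) [Fintype V] (G : SimpleGraph V) (c : V → V → ℕ) (b : ℕ),
      (∀ u v, c u v = c v u) → n₀ ≤ Fintype.card V → (∀ v a, #(badSet G c v a) ≤ b) →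
      (b : ℝ) ≤ (1 / 3 - ε) * Fintype.card V →
      ∀ S : Finset V, (#Sᶜ : ℝ) ≤ ε * Fintype.card V →
      ∃ Ps : List (List V), (∀ P ∈ Ps, P ≠ [] ∧ IsPCWalk G c P) ∧ Ps.flatten.Nodup ∧
        (∀ x, x ∈ Ps.flatten ↔ x ∈ S) ∧ (Ps.length : ℝ) ≤ β * Fintype.card V := by
  obtain ⟨L, hL⟩ := exists_nat_gt (2 / β)
  obtain ⟨n₁, hn₁⟩ := exists_nat_gt (4 * 3 ^ (L + 2) / ε)
  obtain ⟨n₂, hn₂⟩ := exists_nat_gt (2 * 3 ^ (L + 2) / β)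
  refine ⟨max n₁ n₂, fun V _ G c b hc hn hb hbn S hS => ?_⟩
  have h1 : (n₁ : ℝ) ≤ Fintype.card V := by exact_mod_cast (le_max_left _ _).trans hn
  have h2 : (n₂ : ℝ) ≤ Fintype.card V := by exact_mod_cast (le_max_right _ _).trans hn
  set n := Fintype.card V
  rw [div_lt_iff₀ hε] at hn₁
  rw [div_lt_iff₀ hβ] at hn₂ hL
  obtain ⟨Ps, h, hnd, hmem, hlen⟩ := exists_walk_cover (L := L) (S := S) hc hb (by
    have : (3 * b + #Sᶜ + 4 * 3 ^ (L + 2) : ℝ) < n := by nlinarith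
    exact_mod_cast this)
  refine ⟨Ps, h, hnd, hmem, ?_⟩
  have hSn : (#S : ℝ) ≤ n := by exact_mod_cast card_le_univ S
  have hlen' : ((L + 1) * Ps.length : ℝ) ≤ #S + (L + 1) * 3 ^ (L + 2) := by exact_mod_cast hlen
  have hLpos : (0 : ℝ) < L + 1 := by positivity
  have h3 : (3 : ℝ) ^ (L + 2) ≤ β / 2 * n := by nlinarith
  have h4 : (n : ℝ) ≤ (L + 1) * (β / 2 * n) := by
    have : (0 : ℝ) ≤ n := by positivity
    nlinarith
  have h5 := mul_le_mul_of_nonneg_left h3 hLpos.le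
  refine le_of_mul_le_mul_left ?_ hLpos
  linarith

lemma exists_subcover {Ps : List (List V)} (h : ∀ P ∈ Ps, P ≠ [] ∧ IsPCWalk G c P) {T : ℕ}
    (hT : T ≤ Ps.flatten.length) :
    ∃ Ps' : List (List V), Ps'.length ≤ Ps.length ∧ Ps'.flatten.Sublist Ps.flatten ∧
      Ps'.flatten.length = T ∧ ∀ P ∈ Ps', P ≠ [] ∧ IsPCWalk G c P := by
  induction Ps with
  | nil => exact ⟨[], by simpa [eq_comm] using hT⟩
  | cons P Ps ih =>
    have h' : ∀ P ∈ Ps, P ≠ [] ∧ IsPCWalk G c P := fun Q hQ => h Q (by simp [hQ])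
    by_cases hle : T ≤ Ps.flatten.length
    · obtain ⟨Ps', h1, h2, h3, h4⟩ := ih h' hle
      refine ⟨Ps', by simp; omega, ?_, h3, h4⟩
      rw [List.flatten_cons]
      exact h2.trans (List.sublist_append_right _ _)
    · rw [List.flatten_cons, List.length_append] at hT
      have hdrop : ∀ k (l : List V), IsPCWalk G c l → IsPCWalk G c (l.drop k) := by
        intro k
        induction k with
        | zero => simp
        | succ k ihk =>
          rintro (_ | ⟨a, l⟩) hl
          · simpa using hl
          · exact ihk l hl.of_cons
      have hlen : (P.drop (P.length + Ps.flatten.length - T)).length = T - Ps.flatten.length := by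
        rw [List.length_drop]
        omega
      refine ⟨P.drop (P.length + Ps.flatten.length - T) :: Ps, by simp, ?_, ?_, ?_⟩
      · rw [List.flatten_cons, List.flatten_cons]
        exact (List.drop_sublist _ _).append_right _
      · rw [List.flatten_cons, List.length_append, hlen]
        omega
      · intro Q hQ
        rcases List.mem_cons.1 hQ with rfl | hQ
        · refine ⟨fun h0 => ?_, hdrop _ _ (h P (by simp)).2⟩
          rw [h0, List.length_nil] at hlen
          omega
        · exact h' Q hQ

end Covers

section Cycles

open scoped Classical
open Finset

variable {V : Type*} {G : SimpleGraph V} {c : V → V → ℕ}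

/-- Two properly coloured walks which overlap in their end edges form a properly coloured cycle. -/
lemma isPCCycle_append {b₁ b₂ a₁ a₂ : V} {l l₁ l₂ r : List V} (h₁ : l = b₁ :: b₂ :: l₁)
    (h₂ : l = l₂ ++ [a₁, a₂]) (hl : IsPCWalk G c l) (hr : IsPCWalk G c (a₁ :: a₂ :: (r ++ [b₁, b₂])))
    (hnd : (l ++ r).Nodup) (hlen : 3 ≤ (l ++ r).length) : IsPCCycle G c (l ++ r) := by
  refine ⟨hlen, hnd, ?_⟩
  have h : l ++ r ++ (l ++ r).take 2 = l₂ ++ a₁ :: a₂ :: (r ++ [b₁, b₂]) := by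
    have : (l ++ r).take 2 = [b₁, b₂] := by simp [h₁]
    rw [this, h₂]
    simp
  rw [h, isPCWalk_append_cons_cons]
  exact ⟨h₂ ▸ hl, hr⟩

variable [Fintype V] {b : ℕ}

lemma exists_isPCWalk (hc : ∀ u v, c u v = c v u) (hb : ∀ v a, #(badSet G c v a) ≤ b) (k : ℕ)
    (hk : b + k + 1 < Fintype.card V) :
    ∃ (x y : V) (l : List V), l.length = k ∧ (x :: y :: l).Nodup ∧ IsPCWalk G c (x :: y :: l) := by
  induction k with
  | zero =>
    obtain ⟨v⟩ : Nonempty V := Fintype.card_pos_iff.1 (by omega)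
    obtain ⟨w, hw⟩ := exists_mem_notMem_of_card_lt_card
      (s := badSet G c v 0) (t := univ) (by rw [card_univ]; have := hb v 0; omega)
    have hadj := (notMem_badSet.1 hw.2).1
    exact ⟨v, w, [], rfl, by simpa using hadj.ne, hadj⟩
  | succ k ih =>
    obtain ⟨x, y, l, hl, hnd, hw⟩ := ih (by omega)
    obtain ⟨w, hw'⟩ := exists_mem_notMem_of_card_lt_card
      (s := badSet G c x (c x y) ∪ (y :: l).toFinset) (t := univ) (by
        have h1 := card_union_le (badSet G c x (c x y)) (y :: l).toFinset
        have h2 := List.toFinset_card_le (y :: l)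
        have := hb x (c x y)
        rw [List.length_cons] at h2
        rw [card_univ]
        omega)
    have hw' := hw'.2
    rw [mem_union, not_or, notMem_badSet, List.mem_toFinset] at hw'
    obtain ⟨⟨hadj, hcol⟩, hmem⟩ := hw'
    refine ⟨w, x, y :: l, by simp [hl], ?_, hadj.symm, by rwa [hc], hw⟩
    rw [List.nodup_cons]
    refine ⟨fun h => ?_, hnd⟩
    rcases List.mem_cons.1 h with h | h
    exacts [hadj.ne h.symm, hmem h]

lemma exists_isPCCycle_of_small (hc : ∀ u v, c u v = c v u)
    (hb : ∀ v a, #(badSet G c v a) ≤ b) {ℓ : ℕ} (hℓ : 4 ≤ ℓ) (hn : 3 * b + ℓ < Fintype.card V) :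
    ∃ l : List V, IsPCCycle G c l ∧ l.length = ℓ := by
  obtain ⟨x, y, l, hl, hnd, hw⟩ := exists_isPCWalk hc hb (ℓ - 4) (by omega)
  obtain ⟨l₂, a₁, a₂, h₂⟩ : ∃ l₂ a₁ a₂, x :: y :: l = l₂ ++ [a₁, a₂] := exists_eq_append_pair x y l
  have ha : G.Adj a₁ a₂ := isPCWalk_pair_adj (h₂ ▸ hw)
  have hxy : G.Adj x y := by
    cases l with
    | nil => exact hw
    | cons => exact hw.1
  obtain ⟨p, -, q, -, hp, hq, hcon⟩ := supply_univ hb hn a₂ (c a₁ a₂) x (c x y)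
    (x :: y :: l).toFinset ((List.toFinset_card_le _).trans (by simp; omega))
  rw [List.mem_toFinset] at hp hq
  refine ⟨(x :: y :: l) ++ [p, q], isPCCycle_append rfl h₂ hw
    (isPCWalk_connect hc ha hcon hxy (by simp)) ?_ (by simp), by simp; omega⟩
  rw [List.nodup_append]
  refine ⟨hnd, by simpa using hcon.2.2.1.1.ne, ?_⟩
  rintro u hu v hv rfl
  simp only [List.mem_cons, List.not_mem_nil, or_false] at hv
  rcases hv with rfl | rfl
  exacts [hp hu, hq hu]

lemma exists_isPCCycle_of_isAbsorbing (hc : ∀ u v, c u v = c v u) {b₁ b₂ a₁ a₂ : V} {M : List V}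
    {s κ ℓ : ℕ} {R : Finset V} {Ps : List (List V)} (hM : IsAbsorbing G c b₁ b₂ a₁ a₂ M s)
    (hR : Supply G c R κ) (hdis : Disjoint R (b₁ :: b₂ :: (M ++ [a₁, a₂])).toFinset)
    (hPs : ∀ P ∈ Ps, P ≠ [] ∧ IsPCWalk G c P) (hnd : Ps.flatten.Nodup)
    (hmem : ∀ x, x ∈ Ps.flatten ↔ x ∈ ((b₁ :: b₂ :: (M ++ [a₁, a₂])).toFinset ∪ R)ᶜ)
    (hκ : 2 * Ps.length ≤ κ) (hRs : #R ≤ s) (hs : 2 * Ps.length ≤ s)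
    (hℓ : M.length + 4 + 2 * (Ps.length + 1) ≤ ℓ) (hn : ℓ ≤ Fintype.card V) :
    ∃ l : List V, IsPCCycle G c l ∧ l.length = ℓ := by
  obtain ⟨hMnd, hMabs⟩ := hM
  set A := b₁ :: b₂ :: (M ++ [a₁, a₂]) with hA
  have hAlen : A.length = M.length + 4 := by simp [hA]
  have hadj : G.Adj b₁ b₂ ∧ G.Adj a₁ a₂ := by
    obtain ⟨M', -, hM'⟩ := hMabs ∅ (by simp)
    refine ⟨?_, isPCWalk_pair_adj (l := b₁ :: b₂ :: M') (by simpa using hM')⟩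
    exact ((isPCWalk_append_cons_cons [] _ b₁ b₂).1 hM').1
  set T := min Ps.flatten.length (ℓ - (M.length + 4 + 2 * (Ps.length + 1))) with hT
  obtain ⟨Ps', hlen', hsub, hTlen, hPs'⟩ := exists_subcover hPs (T := T) (min_le_left _ _)
  obtain ⟨Q, hQnd, hQ, hQlen, hchain⟩ := exists_chain hc hR hadj.1 Ps' a₁ a₂ ∅ hadj.2 hPs'
    (by rw [card_empty]; omega)
  obtain ⟨r, hr, hrw⟩ := hchain Ps' (List.forall₂_same.2 fun P hP => ⟨(hPs' P hP).2, rfl, rfl⟩)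
  have hrlen : r.length = 2 * (Ps'.length + 1) + T := by
    rw [hr.length_eq, List.length_append, hQlen, hTlen]
  have hcov : ∀ x ∈ Ps'.flatten, x ∉ A ∧ x ∉ R := fun x hx => by
    have := (hmem x).1 (hsub.subset hx)
    simpa [not_or] using this
  have hrnd : r.Nodup := by
    rw [hr.nodup_iff, List.nodup_append]
    refine ⟨hQnd, hnd.sublist hsub, ?_⟩
    rintro x hx y hy rfl
    exact (hcov x hy).2 (hQ x hx).1
  have hbase : (A ++ r).Nodup := by
    rw [List.nodup_append]
    refine ⟨hMnd, hrnd, ?_⟩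
    rintro x hx y hy rfl
    rcases List.mem_append.1 (hr.mem_iff.1 hy) with h | h
    · exact Finset.disjoint_left.1 hdis (hQ x h).1 (List.mem_toFinset.2 hx)
    · exact (hcov x h).1 hx
  have hbaselen : (A ++ r).length = M.length + 4 + 2 * (Ps'.length + 1) + T := by
    rw [List.length_append, hAlen, hrlen]
    omega
  obtain ⟨W, hW, hWcard⟩ := exists_subset_card_eq (s := (A ++ r).toFinsetᶜ)
    (n := ℓ - (A ++ r).length) (by
      rw [card_compl, List.toFinset_card_of_nodup hbase]
      omega)
  have hWs : #W ≤ s := by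
    rcases min_choice Ps.flatten.length (ℓ - (M.length + 4 + 2 * (Ps.length + 1))) with h | h
    · refine (card_le_card fun x hx => ?_).trans hRs
      have hx := hW hx
      rw [mem_compl, List.mem_toFinset, List.mem_append, not_or, hr.mem_iff, List.mem_append,
        not_or, hsub.eq_of_length (by rw [hTlen, hT, h]), hmem, mem_compl, not_not, mem_union,
        List.mem_toFinset] at hx
      exact hx.2.2.resolve_left hx.1
    · omega
  obtain ⟨M', hM', hM'w⟩ := hMabs W hWs
  have hperm : (b₁ :: b₂ :: (M' ++ [a₁, a₂]) ++ r).Perm ((A ++ r) ++ W.toList) := by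
    have h1 : (M' ++ ([a₁, a₂] ++ r)).Perm (M ++ (W.toList ++ ([a₁, a₂] ++ r))) := by
      rw [← List.append_assoc M]
      exact hM'.append_right _
    have h2 : (W.toList ++ ([a₁, a₂] ++ r)).Perm (([a₁, a₂] ++ r) ++ W.toList) :=
      List.perm_append_comm
    have h3 := h1.trans (h2.append_left M)
    simpa [hA] using h3
  have hlen : (b₁ :: b₂ :: (M' ++ [a₁, a₂]) ++ r).length = ℓ := by
    rw [hperm.length_eq, List.length_append, length_toList, hWcard]
    omega
  refine ⟨_, isPCCycle_append (l₂ := b₁ :: b₂ :: M') rfl (by simp) hM'w hrw ?_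
    (by rw [hlen]; omega), hlen⟩
  rw [hperm.nodup_iff, List.nodup_append]
  refine ⟨hbase, W.nodup_toList, ?_⟩
  rintro x hx y hy rfl
  have := hW (mem_toList.1 hy)
  rw [mem_compl, List.mem_toFinset] at this
  exact this hx

lemma card_badSet_add_colourDeg1 (v : V) (a : ℕ) :
    #(badSet G c v a) + colourDeg1 G c v a = Fintype.card V := by
  have : colourDeg1 G c v a = #(badSet G c v a)ᶜ := by
    rw [colourDeg1, ← Set.ncard_coe_finset]
    congr 1
    ext w
    simp [mem_badSet]
  rw [this, card_add_card_compl]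

end Cycles

/-- For every `ε > 0` there is `n₀` such that every edge-coloured graph on
`n ≥ n₀` vertices with `δ₁^c(G) ≥ (2/3 + ε) n` contains a properly coloured cycle of
length `ℓ` for every `3 ≤ ℓ ≤ n`. -/
theorem stmt2 (ε : ℝ) (hε : 0 < ε) :
    ∃ n₀ : ℕ, ∀ (V : Type) [Fintype V] (G : SimpleGraph V) (c : V → V → ℕ),
      (∀ u v, c u v = c v u) →
      n₀ ≤ Fintype.card V →
      (∀ (v : V) (a : ℕ), (2 / 3 + ε) * (Fintype.card V : ℝ) ≤ colourDeg1 G c v a) →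
      ∀ ℓ : ℕ, 3 ≤ ℓ → ℓ ≤ Fintype.card V →
        ∃ l : List V, IsPCCycle G c l ∧ l.length = ℓ := by
  classical
  obtain ⟨σ, hσ, n₁, h₁⟩ := exists_isAbsorbing hε (half_pos hε)
  obtain ⟨κ, hκ, n₂, h₂⟩ := exists_reservoir hε (lt_min hσ (half_pos hε))
  obtain ⟨n₃, h₃⟩ := exists_cover hε (half_pos (lt_min (lt_min hσ hκ) hε))
  obtain ⟨n₄, hn₄⟩ := exists_nat_gt (2 / ε)
  refine ⟨max (max n₁ n₂) (max n₃ n₄), fun V _ G c hc hn hdeg ℓ hℓ hℓn => ?_⟩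
  simp only [max_le_iff] at hn
  obtain ⟨⟨hn₁, hn₂⟩, hn₃, hn₄'⟩ := hn
  have hn₄' : (n₄ : ℝ) ≤ Fintype.card V := by exact_mod_cast hn₄'
  rw [div_lt_iff₀ hε] at hn₄
  have hbad : ∀ v a, ((badSet G c v a).card : ℝ) ≤ (1 / 3 - ε) * Fintype.card V := fun v a => by
    have h : ((badSet G c v a).card + colourDeg1 G c v a : ℝ) = Fintype.card V := by
      exact_mod_cast card_badSet_add_colourDeg1 v a
    linarith [hdeg v a]
  obtain ⟨v⟩ : Nonempty V := Fintype.card_pos_iff.1 (by omega)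
  have hb : ∀ v a, (badSet G c v a).card ≤ ⌊(1 / 3 - ε) * (Fintype.card V : ℝ)⌋₊ :=
    fun v a => Nat.le_floor (hbad v a)
  have hbn : (⌊(1 / 3 - ε) * (Fintype.card V : ℝ)⌋₊ : ℝ) ≤ (1 / 3 - ε) * Fintype.card V :=
    Nat.floor_le ((Nat.cast_nonneg _).trans (hbad v 0))
  generalize ⌊(1 / 3 - ε) * (Fintype.card V : ℝ)⌋₊ = b at hb hbn
  obtain ⟨b₁, b₂, a₁, a₂, M, s, hM, hs, hMlen⟩ := h₁ V G c b hc hn₁ hb hbn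
  have hA : ((b₁ :: b₂ :: (M ++ [a₁, a₂])).toFinset.card : ℝ) ≤ ε / 2 * Fintype.card V := by
    refine le_trans ?_ hMlen
    exact_mod_cast (List.toFinset_card_le _).trans (by simp)
  have hn0 : (0 : ℝ) ≤ Fintype.card V := Nat.cast_nonneg _
  obtain ⟨R, k, hdis, hR, hk, hsup⟩ := h₂ V G c b hn₂ hb hbn
    (b₁ :: b₂ :: (M ++ [a₁, a₂])).toFinset (by nlinarith)
  have hRσ := hR.trans (mul_le_mul_of_nonneg_right (min_le_left σ (ε / 2)) hn0)
  have hRε := hR.trans (mul_le_mul_of_nonneg_right (min_le_right σ (ε / 2)) hn0)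
  obtain ⟨Ps, hPs, hnd, hmem, hPlen⟩ := h₃ V G c b hc hn₃ hb hbn
    ((b₁ :: b₂ :: (M ++ [a₁, a₂])).toFinset ∪ R)ᶜ (by
      rw [compl_compl]
      have : (((b₁ :: b₂ :: (M ++ [a₁, a₂])).toFinset ∪ R).card : ℝ) ≤
          (b₁ :: b₂ :: (M ++ [a₁, a₂])).toFinset.card + R.card := by exact_mod_cast Finset.card_union_le _ _
      linarith)
  have hPle : ∀ {x : ℝ}, min (min σ κ) ε ≤ x → (2 * Ps.length : ℝ) ≤ x * Fintype.card V :=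
    fun h => by linarith [mul_le_mul_of_nonneg_right h hn0]
  have hPσ := hPle ((min_le_left _ _).trans (min_le_left _ _))
  have hPκ := hPle ((min_le_left _ _).trans (min_le_right _ _))
  have hPε := hPle (min_le_right _ _)
  by_cases hlarge : M.length + 4 + 2 * (Ps.length + 1) ≤ ℓ
  · exact exists_isPCCycle_of_isAbsorbing hc hM hsup hdis hPs hnd hmem
      (by exact_mod_cast hPκ.trans hk) (by exact_mod_cast hRσ.trans hs)
      (by exact_mod_cast hPσ.trans hs) hlarge hℓn
  · have hℓ' : (ℓ : ℝ) < M.length + 4 + 2 * (Ps.length + 1) := by exact_mod_cast not_le.1 hlarge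
    have hsmall : 3 * b + ℓ < Fintype.card V := by
      have : (3 * b + ℓ : ℝ) < Fintype.card V := by nlinarith
      exact_mod_cast this
    rcases hℓ.eq_or_lt with rfl | hℓ4
    · exact exists_isPCCycle_three hc hb (by omega)
    · exact exists_isPCCycle_of_small hc hb hℓ4 hsmall
end

section
/- For every integer k ≥ 1, every edge-coloured graph G on n vertices with δ₁^c(G) ≥ 2n/3 + k contains a properly coloured 2-factor in which every cycle has length at least k/2. -/
open SimpleGraph

section

variable {V : Type*}

/-- Every walk of `H` from `a` to `b` has length at least `d`. -/
def Far (H : SimpleGraph V) (d : ℕ) (a b : V) : Prop :=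
  ∀ p : H.Walk a b, d ≤ p.length

lemma Far.symm {H : SimpleGraph V} {d : ℕ} {a b : V} (h : Far H d a b) : Far H d b a :=
  fun p => by simpa using h p.reverse

lemma Far.weaken {H K : SimpleGraph V} {d d' : ℕ} {a b : V} (h : Far H d a b) (hK : K ≤ H)
    (hd : d' ≤ d) : Far K d' a b :=
  fun p => hd.trans (by simpa using h (p.mapLe hK))

lemma Far.step {H : SimpleGraph V} {d : ℕ} {a b b' : V} (h : Far H d a b) (hb : H.Adj b b') :
    Far H (d - 1) a b' := fun p => by
  have := h (p.append (SimpleGraph.Walk.cons hb.symm SimpleGraph.Walk.nil))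
  simp at this
  omega

/-- A walk in `J` with an added edge either shortens to a walk of `J`, or splits at the edge. -/
lemma exists_walk_of_sup_edge {J : SimpleGraph V} {a b s t : V}
    (p : (J ⊔ edge a b).Walk s t) :
    (∃ q : J.Walk s t, q.length ≤ p.length) ∨
    (∃ (q : J.Walk s a) (r : J.Walk b t), q.length + r.length + 1 ≤ p.length) ∨
    (∃ (q : J.Walk s b) (r : J.Walk a t), q.length + r.length + 1 ≤ p.length) := by
  induction p with
  | nil => exact Or.inl ⟨SimpleGraph.Walk.nil, le_rfl⟩
  | @cons s s' t h p ih =>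
    rw [sup_adj, edge_adj] at h
    rcases h with h | ⟨⟨rfl, rfl⟩ | ⟨rfl, rfl⟩, -⟩
    · rcases ih with ⟨q, hq⟩ | ⟨q, r, hq⟩ | ⟨q, r, hq⟩
      · exact Or.inl ⟨q.cons h, by simpa using hq⟩
      · exact Or.inr (Or.inl ⟨q.cons h, r, by simp; omega⟩)
      · exact Or.inr (Or.inr ⟨q.cons h, r, by simp; omega⟩)
    · rcases ih with ⟨q, hq⟩ | ⟨q, r, hq⟩ | ⟨q, r, hq⟩
      · exact Or.inr (Or.inl ⟨SimpleGraph.Walk.nil, q, by simpa using hq⟩)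
      · exact Or.inr (Or.inl ⟨SimpleGraph.Walk.nil, r, by simp; omega⟩)
      · exact Or.inl ⟨r, by simp; omega⟩
    · rcases ih with ⟨q, hq⟩ | ⟨q, r, hq⟩ | ⟨q, r, hq⟩
      · exact Or.inr (Or.inr ⟨SimpleGraph.Walk.nil, q, by simpa using hq⟩)
      · exact Or.inl ⟨r, by simp; omega⟩
      · exact Or.inr (Or.inr ⟨SimpleGraph.Walk.nil, r, by simp; omega⟩)

lemma Far.sup_edge {J : SimpleGraph V} {a b s t : V} {d : ℕ} (h : Far J d s t)
    (ha : Far J (d - 1) a t) (hb : Far J (d - 1) b t) : Far (J ⊔ edge a b) d s t := by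
  intro p
  rcases exists_walk_of_sup_edge p with ⟨q, hq⟩ | ⟨q, r, hq⟩ | ⟨q, r, hq⟩
  · exact (h q).trans hq
  · have := hb r; omega
  · have := ha r; omega

/-- A properly coloured subgraph of maximum degree at most two, all of whose cycles have more
than `ℓ` vertices. -/
structure Admissible (G : SimpleGraph V) (c : V → V → ℕ) (ℓ : ℕ) (H : SimpleGraph V) : Prop where
  le : H ≤ G
  deg : ∀ v a b d, H.Adj v a → H.Adj v b → H.Adj v d → a = b ∨ a = d ∨ b = d
  proper : ∀ v a b, H.Adj v a → H.Adj v b → a ≠ b → c v a ≠ c v b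
  girth : ∀ a b, H.Adj a b → Far (H.deleteEdges {s(a, b)}) ℓ a b

/-- The vertex `a` has degree at most one in `H` and the edge `ab` avoids the colour at `a`. -/
def Accepts (c : V → V → ℕ) (H : SimpleGraph V) (a b : V) : Prop :=
  (∀ u v, H.Adj a u → H.Adj a v → u = v) ∧ ∀ v, H.Adj a v → c a v ≠ c a b

lemma Admissible.mono {G : SimpleGraph V} {c : V → V → ℕ} {ℓ : ℕ} {H K : SimpleGraph V}
    (hH : Admissible G c ℓ H) (hK : K ≤ H) : Admissible G c ℓ K where
  le := hK.trans hH.le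
  deg v a b d ha hb hd := hH.deg v a b d (hK ha) (hK hb) (hK hd)
  proper v a b ha hb := hH.proper v a b (hK ha) (hK hb)
  girth a b hab := (hH.girth a b (hK hab)).weaken (deleteEdges_mono hK) le_rfl

lemma Admissible.sup_edge {G : SimpleGraph V} {c : V → V → ℕ} {ℓ : ℕ} {K : SimpleGraph V}
    {a b : V} (hK : Admissible G c ℓ K) (hab : G.Adj a b) (ha : Accepts c K a b)
    (hb : Accepts c K b a) (hfar : Far K ℓ a b) : Admissible G c ℓ (K ⊔ edge a b) where
  le := by
    refine sup_le hK.le ?_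
    intro u v h
    rw [edge_adj] at h
    rcases h with ⟨⟨rfl, rfl⟩ | ⟨rfl, rfl⟩, -⟩
    exacts [hab, hab.symm]
  deg v p q r hp hq hr := by
    simp only [sup_adj, edge_adj] at hp hq hr
    have h1 := hK.deg v p q r
    have h2 := ha.1
    have h3 := hb.1
    grind
  proper v p q hp hq hpq := by
    simp only [sup_adj, edge_adj] at hp hq
    have h1 := hK.proper v p q
    have h2 := ha.2
    have h3 := hb.2
    grind
  girth p q hpq := by
    by_cases h : s(p, q) = s(a, b)
    · have hle : (K ⊔ edge a b).deleteEdges {s(p, q)} ≤ K := by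
        intro u v huv
        simp only [deleteEdges_adj, sup_adj, edge_adj, Set.mem_singleton_iff, h] at huv
        rcases huv with ⟨h | ⟨⟨rfl, rfl⟩ | ⟨rfl, rfl⟩, -⟩, h'⟩
        · exact h
        · exact absurd rfl h'
        · exact absurd Sym2.eq_swap h'
      rcases Sym2.eq_iff.1 h with ⟨rfl, rfl⟩ | ⟨rfl, rfl⟩
      · exact hfar.weaken hle le_rfl
      · exact hfar.symm.weaken hle le_rfl
    · have hpK : K.Adj p q := by
        simp only [sup_adj, edge_adj] at hpq
        rcases hpq with hpq | ⟨⟨rfl, rfl⟩ | ⟨rfl, rfl⟩, -⟩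
        · exact hpq
        · exact absurd rfl h
        · exact absurd Sym2.eq_swap h
      have hle : (K ⊔ edge a b).deleteEdges {s(p, q)} ≤ K.deleteEdges {s(p, q)} ⊔ edge a b := by
        intro u v huv
        simp only [deleteEdges_adj, sup_adj] at huv ⊢
        tauto
      have hd : K.deleteEdges {s(p, q)} ≤ K := deleteEdges_le _
      intro w
      rcases exists_walk_of_sup_edge (w.mapLe hle) with ⟨x, hx⟩ | ⟨x, y, hx⟩ | ⟨x, y, hx⟩
      · have := hK.girth p q hpK x
        simp at hx
        omega
      · have := hfar ((x.mapLe hd).reverse.append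
          (SimpleGraph.Walk.cons hpK (y.mapLe hd).reverse))
        simp at this hx
        omega
      · have := hfar (((y.mapLe hd).append (SimpleGraph.Walk.cons hpK.symm (x.mapLe hd))))
        simp at this hx
        omega

lemma ncard_edgeSet_sup_edge_s5 [Finite V] {c : V → V → ℕ} {K : SimpleGraph V} {a b : V}
    (hne : a ≠ b) (ha : Accepts c K a b) :
    (K ⊔ edge a b).edgeSet.ncard = K.edgeSet.ncard + 1 := by
  rw [edgeSet_sup, edgeSet_edge_of_ne hne, Set.union_singleton, Set.ncard_insert_of_notMem]
  exact fun h => ha.2 b h rfl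

/-- An admissible subgraph with the maximum number of edges. -/
def IsMaxAdmissible (G : SimpleGraph V) (c : V → V → ℕ) (ℓ : ℕ) (H : SimpleGraph V) : Prop :=
  Admissible G c ℓ H ∧ ∀ K, Admissible G c ℓ K → K.edgeSet.ncard ≤ H.edgeSet.ncard

/-- The edge `xw` respects the colour at `x`, and `w` is at distance at least `m` from `x`
and `y`. -/
def Candidate (G : SimpleGraph V) (c : V → V → ℕ) (H : SimpleGraph V) (m : ℕ) (x y w : V) : Prop :=
  G.Adj x w ∧ (∀ v, H.Adj x v → c x v ≠ c x w) ∧ Far H m x w ∧ Far H m y w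

/-- Deleting the edge `wz` frees `w` for a new edge of colour `α`. -/
def Exposes (c : V → V → ℕ) (H : SimpleGraph V) (w : V) (α : ℕ) (z : V) : Prop :=
  H.Adj w z ∧ ∀ v, H.Adj w v → v ≠ z → c w v ≠ α

/-- After the edge `zw` has been deleted, the edge `zv` of `G` respects the colour at `z`. -/
def Joinable (G : SimpleGraph V) (c : V → V → ℕ) (H : SimpleGraph V) (z w v : V) : Prop :=
  G.Adj z v ∧ ∀ t, H.Adj z t → t ≠ w → c z t ≠ c z v

lemma far_two_ne {H : SimpleGraph V} {a b : V} (h : Far H 2 a b) : a ≠ b := by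
  rintro rfl
  simpa using h SimpleGraph.Walk.nil

lemma far_two_not_adj {H : SimpleGraph V} {a b : V} (h : Far H 2 a b) : ¬ H.Adj a b := fun h' => by
  simpa using h (SimpleGraph.Walk.cons h' SimpleGraph.Walk.nil)

lemma Admissible.exists_exposes {G : SimpleGraph V} {c : V → V → ℕ} {ℓ : ℕ} {H : SimpleGraph V}
    (hH : Admissible G c ℓ H) {w z : V} (hz : H.Adj w z) (α : ℕ) : ∃ z, Exposes c H w α z := by
  by_cases h : ∃ v, H.Adj w v ∧ c w v = α
  · obtain ⟨v, hv, hα⟩ := h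
    exact ⟨v, hv, fun u hu huv h' => hH.proper w u v hu hv huv (h'.trans hα.symm)⟩
  · push Not at h
    exact ⟨z, hz, fun v hv _ => h v hv⟩

lemma IsMaxAdmissible.not_accepts [Finite V] {G : SimpleGraph V} {c : V → V → ℕ} {ℓ : ℕ}
    {H : SimpleGraph V} (hH : IsMaxAdmissible G c ℓ H) {a b : V} (hab : G.Adj a b)
    (ha : Accepts c H a b) (hfar : Far H ℓ a b) : ¬ Accepts c H b a := fun hb => by
  have := hH.2 _ (hH.1.sup_edge hab ha hb hfar)
  rw [ncard_edgeSet_sup_edge_s5 hab.ne ha] at this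
  omega

lemma ncard_edgeSet_deleteEdges_singleton [Finite V] {H : SimpleGraph V} {w z : V}
    (h : H.Adj w z) :
    (H.deleteEdges {s(w, z)}).edgeSet.ncard + 1 = H.edgeSet.ncard := by
  rw [edgeSet_deleteEdges]
  exact Set.ncard_sdiff_singleton_add_one (by exact h) (Set.toFinite _)

section Augment

variable [Finite V] {G : SimpleGraph V} {c : V → V → ℕ} {ℓ m : ℕ} {H : SimpleGraph V}
  {x y w z u z' : V}

/-- Replacing `wz` by `xw` preserves admissibility and the number of edges. -/
lemma IsMaxAdmissible.exchange (hc : ∀ u v, c u v = c v u) (hH : IsMaxAdmissible G c ℓ H)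
    (hx : ∀ u v, H.Adj x u → H.Adj x v → u = v) (hxw : G.Adj x w)
    (hcol : ∀ v, H.Adj x v → c x v ≠ c x w) (hfar : Far H ℓ x w)
    (hz : Exposes c H w (c x w) z) :
    IsMaxAdmissible G c ℓ (H.deleteEdges {s(w, z)} ⊔ edge x w) := by
  have hle : H.deleteEdges {s(w, z)} ≤ H := deleteEdges_le _
  have hacc : Accepts c (H.deleteEdges {s(w, z)}) x w :=
    ⟨fun u v hu hv => hx u v (hle hu) (hle hv), fun v hv => hcol v (hle hv)⟩
  refine ⟨(hH.1.mono hle).sup_edge hxw hacc ?_ (hfar.weaken hle le_rfl), ?_⟩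
  · obtain ⟨h1, h2⟩ := hz
    constructor
    · intro p q hp hq
      have := hH.1.deg w p q z
      simp only [deleteEdges_adj, Set.mem_singleton_iff] at hp hq
      grind
    · intro v hv
      simp only [deleteEdges_adj, Set.mem_singleton_iff] at hv
      rw [hc w x]
      exact h2 v hv.1 (fun h => hv.2 (by rw [h]))
  · intro K hK
    rw [ncard_edgeSet_sup_edge_s5 hxw.ne hacc, ncard_edgeSet_deleteEdges_singleton hz.1]
    exact hH.2 K hK

lemma IsMaxAdmissible.not_exposes_swap (hc : ∀ u v, c u v = c v u) (hH : IsMaxAdmissible G c ℓ H)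
    (hm : ℓ ≤ m) (hm2 : 2 ≤ m) (hxy : x ≠ y)
    (hx : ∀ u v, H.Adj x u → H.Adj x v → u = v) (hy : ∀ u v, H.Adj y u → H.Adj y v → u = v)
    (hw : Candidate G c H m x y w) (hz : Candidate G c H m y x z)
    (hwz : Exposes c H w (c x w) z) (hzw : Exposes c H z (c y z) w) : False := by
  obtain ⟨w1, w2, w3, w4⟩ := hw
  obtain ⟨z1, z2, z3, z4⟩ := hz
  have hM := hH.exchange hc hx w1 w2 (w3.weaken le_rfl hm) hwz
  have hle : H.deleteEdges {s(w, z)} ≤ H := deleteEdges_le _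
  have ne1 := far_two_ne (w4.weaken le_rfl hm2)
  have ne2 := far_two_ne (z4.weaken le_rfl hm2)
  have ne3 := hwz.1.ne
  have hdeg := hH.1.deg z
  refine hM.not_accepts z1 ⟨?_, ?_⟩ ?_ ⟨?_, ?_⟩
  · intro p q hp hq
    have := hy p q
    simp only [sup_adj, edge_adj, deleteEdges_adj] at hp hq
    grind
  · intro p hp
    have := z2 p
    simp only [sup_adj, edge_adj, deleteEdges_adj] at hp
    grind
  · refine Far.sup_edge (z3.weaken hle hm) (z4.weaken hle (by omega)) ?_
    exact (hH.1.girth w z hwz.1).weaken le_rfl (by omega)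
  · intro p q hp hq
    have := hdeg p q w
    have := hzw.1
    simp only [sup_adj, edge_adj, deleteEdges_adj, Set.mem_singleton_iff, Sym2.eq_iff] at hp hq
    grind
  · intro p hp
    have := hzw.2 p
    have := hc y z
    simp only [sup_adj, edge_adj, deleteEdges_adj, Set.mem_singleton_iff, Sym2.eq_iff] at hp
    grind

lemma IsMaxAdmissible.not_joinable (hc : ∀ u v, c u v = c v u) (hH : IsMaxAdmissible G c ℓ H)
    (hm : ℓ ≤ m) (hm2 : 2 ≤ m) (hxy : x ≠ y)
    (hx : ∀ u v, H.Adj x u → H.Adj x v → u = v) (hy : ∀ u v, H.Adj y u → H.Adj y v → u = v)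
    (hw : Candidate G c H m x y w) (hu : Candidate G c H m y x u)
    (hwz : Exposes c H w (c x w) z) (huz : Exposes c H u (c y u) z')
    (huw : u = w → c x w = c y u → z = z')
    (hfar : Far H (ℓ + 1) z z') (hzz' : Joinable G c H z w z') :
    ¬ Joinable G c H z' u z := fun hz'z => by
  have hswap : ¬ (z = u ∧ z' = w) := by
    rintro ⟨rfl, rfl⟩
    exact hH.not_exposes_swap hc hm hm2 hxy hx hy hw hu hwz huz
  obtain ⟨w1, w2, w3, w4⟩ := hw
  obtain ⟨u1, u2, u3, u4⟩ := hu
  have hadj := hzz'.1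
  have hwne := hwz.1.ne
  have hune := huz.1.ne
  have hzx : z ≠ x := fun h => far_two_not_adj (w3.weaken le_rfl hm2) (h ▸ hwz.1.symm)
  have hzy : z ≠ y := fun h => far_two_not_adj (w4.weaken le_rfl hm2) (h ▸ hwz.1.symm)
  have hz'x : z' ≠ x := fun h => far_two_not_adj (u4.weaken le_rfl hm2) (h ▸ huz.1.symm)
  have hz'y : z' ≠ y := fun h => far_two_not_adj (u3.weaken le_rfl hm2) (h ▸ huz.1.symm)
  have hwx := far_two_ne (w3.weaken le_rfl hm2)
  have hwy := far_two_ne (w4.weaken le_rfl hm2)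
  have hux := far_two_ne (u4.weaken le_rfl hm2)
  have huy := far_two_ne (u3.weaken le_rfl hm2)
  have hzu : z ≠ u := by
    rintro rfl
    exact hzz'.2 z' huz.1 (fun h => hswap ⟨rfl, h⟩) rfl
  have hz'w : z' ≠ w := by
    rintro rfl
    exact hz'z.2 z hwz.1 (fun h => hswap ⟨h, rfl⟩) rfl
  have hKH : (H.deleteEdges {s(w, z)}).deleteEdges {s(u, z')} ≤ H :=
    (deleteEdges_le _).trans (deleteEdges_le _)
  have hK1 : (H.deleteEdges {s(w, z)}).deleteEdges {s(u, z')} ≤ H.deleteEdges {s(u, z')} :=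
    deleteEdges_mono (deleteEdges_le _)
  have huz'K : (H.deleteEdges {s(w, z)}).Adj u z' := by
    simp only [deleteEdges_adj, Set.mem_singleton_iff, Sym2.eq_iff]
    exact ⟨huz.1, by rintro (⟨-, h⟩ | ⟨-, h⟩); exacts [hadj.ne h.symm, hz'w h]⟩
  have hcard := ncard_edgeSet_deleteEdges_singleton huz'K
  have hcard' := ncard_edgeSet_deleteEdges_singleton hwz.1
  set K := (H.deleteEdges {s(w, z)}).deleteEdges {s(u, z')} with hK
  have hKadj : ∀ p q, K.Adj p q ↔ (H.Adj p q ∧ ¬ (p = w ∧ q = z ∨ p = z ∧ q = w)) ∧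
      ¬ (p = u ∧ q = z' ∨ p = z' ∧ q = u) := fun p q => by
    simp only [hK, deleteEdges_adj, Set.mem_singleton_iff, Sym2.eq_iff]
  have hdw := hH.1.deg w
  have hdu := hH.1.deg u
  have hdz := hH.1.deg z
  have hdz' := hH.1.deg z'
  have hwzs := hwz.1.symm
  have huzs := huz.1.symm
  have hwz1 := hwz.1
  have huz1 := huz.1
  have ax : Accepts c K x w :=
    ⟨fun p q hp hq => hx p q (hKH hp) (hKH hq), fun v hv => w2 v (hKH hv)⟩
  have aw : Accepts c K w x := by
    constructor
    · intro p q hp hq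
      rw [hKadj] at hp hq
      grind
    · intro v hv
      rw [hKadj] at hv
      have := hwz.2 v
      have := hc w x
      grind
  have ay : Accepts c (K ⊔ edge x w) y u := by
    constructor
    · intro p q hp hq
      simp only [sup_adj, edge_adj, hKadj] at hp hq
      have := hy p q
      grind
    · intro v hv
      simp only [sup_adj, edge_adj, hKadj] at hv
      have := u2 v
      grind
  have au : Accepts c (K ⊔ edge x w) u y := by
    constructor
    · intro p q hp hq
      simp only [sup_adj, edge_adj, hKadj] at hp hq
      have := hadj.ne
      grind
    · intro v hv
      simp only [sup_adj, edge_adj, hKadj] at hv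
      have := huz.2 v
      have := hc u y
      have := hc u v
      have := hadj.ne
      grind
  have az : Accepts c (K ⊔ edge x w ⊔ edge y u) z z' := by
    constructor
    · intro p q hp hq
      simp only [sup_adj, edge_adj, hKadj] at hp hq
      grind
    · intro v hv
      simp only [sup_adj, edge_adj, hKadj] at hv
      have := hzz'.2 v
      grind
  have az' : Accepts c (K ⊔ edge x w ⊔ edge y u) z' z := by
    constructor
    · intro p q hp hq
      simp only [sup_adj, edge_adj, hKadj] at hp hq
      grind
    · intro v hv
      simp only [sup_adj, edge_adj, hKadj] at hv
      have := hz'z.2 v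
      grind
  have fwz' : Far H ℓ w z' := hfar.symm.step hwz.1.symm |>.symm
  have fwu : Far H (ℓ - 1) w u := fwz'.step huz.1.symm
  have fxz' : Far H (ℓ - 1) x z' := (u4.step huz.1).weaken le_rfl (by omega)
  have fyz' : Far H (ℓ - 1) y z' := (u3.step huz.1).weaken le_rfl (by omega)
  have fuz' : Far K ℓ u z' := (hH.1.girth u z' huz.1).weaken hK1 le_rfl
  have f1 : Far K ℓ x w := w3.weaken hKH hm
  have f2 : Far (K ⊔ edge x w) ℓ y u :=
    Far.sup_edge (u3.weaken hKH hm) (u4.weaken hKH (by omega)) (fwu.weaken hKH le_rfl)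
  have f3 : Far (K ⊔ edge x w ⊔ edge y u) ℓ z z' := by
    refine Far.sup_edge (Far.sup_edge ?_ ?_ ?_) (Far.sup_edge ?_ ?_ ?_) (Far.sup_edge ?_ ?_ ?_)
    · exact hfar.weaken hKH (by omega)
    · exact fxz'.weaken hKH (by omega)
    · exact fwz'.weaken hKH (by omega)
    · exact fyz'.weaken hKH (by omega)
    · exact fxz'.weaken hKH (by omega)
    · exact fwz'.weaken hKH (by omega)
    · exact fuz'.weaken le_rfl (by omega)
    · exact fxz'.weaken hKH (by omega)
    · exact fwz'.weaken hKH (by omega)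
  have hadm := (((hH.1.mono hKH).sup_edge w1 ax aw f1).sup_edge u1 ay au f2).sup_edge hadj az az' f3
  have := hH.2 _ hadm
  rw [ncard_edgeSet_sup_edge_s5 hadj.ne az, ncard_edgeSet_sup_edge_s5 u1.ne ay,
    ncard_edgeSet_sup_edge_s5 w1.ne ax] at this
  omega

end Augment

section Counting

open Finset

open scoped Classical in
/-- The elements of `B` on which `g` takes a value not taken elsewhere on `B`. -/
noncomputable def uniqueFibre (B : Finset V) (g : V → V) : Finset V :=
  B.filter fun u => ∀ v ∈ B, g v = g u → v = u

lemma mem_uniqueFibre {B : Finset V} {g : V → V} {u : V} :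
    u ∈ uniqueFibre B g ↔ u ∈ B ∧ ∀ v ∈ B, g v = g u → v = u := by
  simp [uniqueFibre]

lemma uniqueFibre_subset (B : Finset V) (g : V → V) : uniqueFibre B g ⊆ B :=
  fun _ hu => (mem_uniqueFibre.1 hu).1

open scoped Classical in
lemma card_uniqueFibre_lt [Fintype V] {B P : Finset V} {g : V → V} {q : ℕ}
    (hg : ∀ z, #{u ∈ B | g u = z} ≤ 2) (hP : q ≤ #P)
    (hdisj : ∀ u ∈ B, ∀ v ∈ B, u ≠ v → g u = g v → g u ∉ P)
    (hcard : 2 * Fintype.card V + 1 ≤ 2 * q + #B) :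
    #(uniqueFibre B g) + 1 ≤ 2 * #{u ∈ uniqueFibre B g | g u ∈ P} := by
  set U := uniqueFibre B g with hU
  have hUB : U ⊆ B := uniqueFibre_subset B g
  have hmem : ∀ u, u ∈ U ↔ u ∈ B ∧ ∀ v ∈ B, g v = g u → v = u := fun u =>
    mem_uniqueFibre
  have hinj : #(U.image g) = #U := card_image_of_injOn fun u hu v hv h =>
    ((hmem v).1 hv).2 u (hUB hu) h
  have htwo : #(B \ U) ≤ 2 * #((B \ U).image g) := by
    refine card_le_mul_card_image _ 2 fun z _ => (card_le_card ?_).trans (hg z)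
    exact filter_subset_filter _ sdiff_subset
  have hdis : Disjoint (U.image g) ((B \ U).image g) := by
    rw [Finset.disjoint_left]
    intro z hz hz'
    obtain ⟨u, hu, rfl⟩ := mem_image.1 hz
    obtain ⟨v, hv, h⟩ := mem_image.1 hz'
    rw [mem_sdiff] at hv
    exact hv.2 (((hmem u).1 hu).2 v hv.1 h ▸ hu)
  have hB := card_sdiff_add_card_eq_card hUB
  have hsub : P ⊆ (univ \ (U.image g ∪ (B \ U).image g)) ∪ ({u ∈ U | g u ∈ P}.image g) := by
    intro z hz
    simp only [mem_union, mem_sdiff, mem_univ, true_and, mem_image, mem_filter]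
    by_contra! h
    obtain ⟨⟨u, hu, rfl⟩ | ⟨u, ⟨huB, huU⟩, rfl⟩, h2⟩ := h
    · exact h2 u ⟨hu, hz⟩ rfl
    · have : ∃ v ∈ B, g v = g u ∧ v ≠ u := by
        by_contra! h
        exact huU ((hmem u).2 ⟨huB, h⟩)
      obtain ⟨v, hv, h, hne⟩ := this
      exact hdisj u huB v hv hne.symm h.symm hz
  have h1 := (card_le_card hsub).trans (card_union_le _ _)
  have h2 := card_sdiff_add_card_eq_card (subset_univ (U.image g ∪ (B \ U).image g))
  rw [card_union_of_disjoint hdis, card_univ] at h2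
  have h3 : #({u ∈ U | g u ∈ P}.image g) ≤ #{u ∈ U | g u ∈ P} := card_image_le
  omega

open scoped Classical in
/-- Two vertex sets whose allowed pairs are too numerous to avoid a reciprocal pair. -/
lemma exists_reciprocal_pair [Fintype V] {A B : Finset V} {f g : V → V} {P Q : V → Finset V}
    {q : ℕ} (hf : ∀ z, #{u ∈ A | f u = z} ≤ 2) (hg : ∀ z, #{u ∈ B | g u = z} ≤ 2)
    (hP : ∀ w ∈ A, q ≤ #(P w)) (hQ : ∀ u ∈ B, q ≤ #(Q u))
    (hPB : ∀ w ∈ A, ∀ u ∈ B, ∀ v ∈ B, u ≠ v → g u = g v → g u ∉ P w)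
    (hQA : ∀ w ∈ B, ∀ u ∈ A, ∀ v ∈ A, u ≠ v → f u = f v → f u ∉ Q w)
    (hA : A.Nonempty) (hcA : 2 * Fintype.card V + 1 ≤ 2 * q + #A)
    (hcB : 2 * Fintype.card V + 1 ≤ 2 * q + #B) :
    ∃ w ∈ A, ∃ u ∈ B, g u ∈ P w ∧ f w ∈ Q u := by
  by_contra! hno
  set S := uniqueFibre A f with hS
  set T := uniqueFibre B g with hT
  have hSA : S ⊆ A := uniqueFibre_subset A f
  have hTB : T ⊆ B := uniqueFibre_subset B g
  have h1 : ∀ w ∈ A, #T + 1 ≤ 2 * #{u ∈ T | g u ∈ P w} := fun w hw =>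
    card_uniqueFibre_lt hg (hP w hw) (hPB w hw) hcB
  have h2 : ∀ u ∈ B, #S + 1 ≤ 2 * #{w ∈ S | f w ∈ Q u} := fun u hu =>
    card_uniqueFibre_lt hf (hQ u hu) (hQA u hu) hcA
  obtain ⟨w, hw⟩ := hA
  have hTpos : 0 < #T := by
    have := h1 w hw
    have := card_filter_le T (fun u => g u ∈ P w)
    omega
  obtain ⟨u, hu⟩ := card_pos.1 hTpos
  have hSpos : 0 < #S := by
    have := h2 u (hTB hu)
    have := card_filter_le S (fun w => f w ∈ Q u)
    omega
  have e1 : #S * (#T + 1) ≤ 2 * ∑ w ∈ S, #{u ∈ T | g u ∈ P w} := by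
    rw [mul_sum, ← smul_eq_mul]
    exact card_nsmul_le_sum _ _ _ fun w hw => h1 w (hSA hw)
  have e2 : #T * (#S + 1) ≤ 2 * ∑ w ∈ S, #{u ∈ T | f w ∈ Q u} := by
    have := sum_card_bipartiteAbove_eq_sum_card_bipartiteBelow (s := S) (t := T)
      (fun w u => f w ∈ Q u)
    simp only [bipartiteAbove, bipartiteBelow] at this
    rw [this, mul_sum, ← smul_eq_mul]
    exact card_nsmul_le_sum _ _ _ fun u hu => h2 u (hTB hu)
  have e3 : ∑ w ∈ S, #{u ∈ T | g u ∈ P w} + ∑ w ∈ S, #{u ∈ T | f w ∈ Q u} ≤ #S * #T := by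
    rw [← sum_add_distrib, ← smul_eq_mul]
    refine sum_le_card_nsmul _ _ _ fun w hw => ?_
    rw [← card_union_of_disjoint]
    · exact card_le_card (union_subset (filter_subset _ _) (filter_subset _ _))
    · rw [disjoint_filter]
      exact fun u hu h => hno w (hSA hw) u (hTB hu) h
  nlinarith

end Counting

section Annulus

variable {H : SimpleGraph V} {z : V}

lemma exists_adj_sphere {d : ℕ} {v : V} (h1 : Far H (d + 1) z v) (h2 : ¬ Far H (d + 2) z v) :
    ∃ u, H.Adj u v ∧ Far H d z u ∧ ¬ Far H (d + 1) z u := by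
  simp only [Far, not_forall, not_le] at h2
  obtain ⟨p, hp⟩ := h2
  have hp' := h1 p
  obtain ⟨q, hq⟩ : ∃ q : H.Walk v z, q.length = p.length := ⟨p.reverse, by simp⟩
  cases q with
  | nil => simp at hq; omega
  | @cons _ u _ h q =>
    refine ⟨u, h.symm, h1.step h, fun h' => ?_⟩
    have := h'.symm q
    simp at hq
    omega

lemma ncard_sphere_le [Finite V]
    (hdeg : ∀ v a b d, H.Adj v a → H.Adj v b → H.Adj v d → a = b ∨ a = d ∨ b = d)
    (d : ℕ) : {v | Far H (d + 1) z v ∧ ¬ Far H (d + 2) z v}.ncard ≤ (H.neighborSet z).ncard := by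
  induction d with
  | zero =>
    refine Set.ncard_le_ncard ?_ (Set.toFinite _)
    rintro v ⟨h1, h2⟩
    obtain ⟨u, huv, -, hu⟩ := exists_adj_sphere h1 h2
    simp only [Far, not_forall, not_le] at hu
    obtain ⟨p, hp⟩ := hu
    have := SimpleGraph.Walk.eq_of_length_eq_zero (p := p) (by omega)
    exact this ▸ huv
  | succ d ih =>
    refine le_trans ?_ ih
    choose! f hf using fun v (hv : Far H (d + 2) z v ∧ ¬ Far H (d + 3) z v) =>
      exists_adj_sphere hv.1 hv.2
    refine Set.ncard_le_ncard_of_injOn f (fun v hv => (hf v hv).2) ?_ (Set.toFinite _)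
    intro v hv w hw h
    obtain ⟨t, ht, -, ht'⟩ := exists_adj_sphere (hf v hv).2.1 (hf v hv).2.2
    rcases hdeg _ v w t (hf v hv).1 (h ▸ (hf w hw).1) ht.symm with h | rfl | rfl
    · exact h
    · exact absurd (hv.1.weaken le_rfl (by omega)) ht'
    · exact absurd (hw.1.weaken le_rfl (by omega)) ht'

lemma ncard_annulus_le [Finite V]
    (hdeg : ∀ v a b d, H.Adj v a → H.Adj v b → H.Adj v d → a = b ∨ a = d ∨ b = d) (j d : ℕ) :
    {v | Far H (j + 1) z v ∧ ¬ Far H (j + 1 + d) z v}.ncard ≤ d * (H.neighborSet z).ncard := by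
  induction d with
  | zero => simp
  | succ d ih =>
    have hsub : {v | Far H (j + 1) z v ∧ ¬ Far H (j + 1 + (d + 1)) z v} ⊆
        {v | Far H (j + 1) z v ∧ ¬ Far H (j + 1 + d) z v} ∪
        {v | Far H (j + d + 1) z v ∧ ¬ Far H (j + d + 2) z v} := by
      rintro v ⟨h1, h2⟩
      by_cases h : Far H (j + 1 + d) z v
      · exact Or.inr ⟨h.weaken le_rfl (by omega), fun h' => h2 (h'.weaken le_rfl (by omega))⟩
      · exact Or.inl ⟨h1, h⟩
    have h1 := (Set.ncard_le_ncard hsub (Set.toFinite _)).trans (Set.ncard_union_le _ _)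
    have h2 := ncard_sphere_le (z := z) hdeg (j + d)
    rw [add_mul, one_mul]
    omega

lemma far_one_of_ne {a b : V} (h : a ≠ b) : Far H 1 a b := fun p => by
  by_contra! hp
  exact h (SimpleGraph.Walk.eq_of_length_eq_zero (p := p) (by omega))

lemma far_two_of_not_adj {a b : V} (h : a ≠ b) (h' : ¬ H.Adj a b) : Far H 2 a b := fun p => by
  cases p with
  | nil => exact absurd rfl h
  | cons h1 p =>
    cases p with
    | nil => exact absurd h1 h'
    | cons h2 p => simp

end Annulus

lemma Admissible.ncard_neighborSet_le [Finite V] {G : SimpleGraph V} {c : V → V → ℕ} {ℓ : ℕ}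
    {H : SimpleGraph V} (hH : Admissible G c ℓ H) (v : V) : (H.neighborSet v).ncard ≤ 2 := by
  by_contra! h
  obtain ⟨a, ha, b, hb, d, hd, h1, h2, h3⟩ := (Set.two_lt_ncard (Set.toFinite _)).1 h
  rcases hH.deg v a b d ha hb hd with h | h | h <;> contradiction

section TwoDeficient

variable [Fintype V] {G : SimpleGraph V} {c : V → V → ℕ} {ℓ m D : ℕ} {H : SimpleGraph V}

lemma le_ncard_avoiding_colour (hD : ∀ v a, D ≤ colourDeg1 G c v a) (z : V) {T : V → Prop}
    (hT : ∀ s t, T s → T t → s = t) :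
    D ≤ {v | G.Adj z v ∧ ∀ t, T t → c z t ≠ c z v}.ncard := by
  by_cases h : ∃ t, T t
  · obtain ⟨t, ht⟩ := h
    refine (hD z (c z t)).trans (Set.ncard_le_ncard ?_ (Set.toFinite _))
    rintro v ⟨h1, h2⟩
    exact ⟨h1, fun s hs => hT t s ht hs ▸ h2.symm⟩
  · refine (hD z 0).trans (Set.ncard_le_ncard ?_ (Set.toFinite _))
    rintro v ⟨h1, h2⟩
    exact ⟨h1, fun s hs => absurd ⟨s, hs⟩ h⟩

lemma Admissible.le_ncard_candidate (hH : Admissible G c ℓ H)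
    (hD : ∀ v a, D ≤ colourDeg1 G c v a) (hm2 : 2 ≤ m) {x y : V}
    (hx : ∀ u v, H.Adj x u → H.Adj x v → u = v) (hy : ∀ u v, H.Adj y u → H.Adj y v → u = v) :
    D ≤ {w | Candidate G c H m x y w}.ncard + (2 * m - 2) := by
  obtain ⟨m, rfl⟩ := Nat.exists_eq_add_of_le hm2
  have hsub : {w | G.Adj x w ∧ ∀ v, H.Adj x v → c x v ≠ c x w} ⊆
      {w | Candidate G c H (2 + m) x y w} ∪
      ({w | Far H (1 + 1) x w ∧ ¬ Far H (1 + 1 + m) x w} ∪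
      ({y} ∪ {w | Far H (0 + 1) y w ∧ ¬ Far H (0 + 1 + (m + 1)) y w})) := by
    rintro w ⟨h1, h2⟩
    by_cases hx' : Far H (2 + m) x w
    · by_cases hy' : Far H (2 + m) y w
      · exact Or.inl ⟨h1, h2, hx', hy'⟩
      · by_cases hyw : w = y
        · exact Or.inr (Or.inr (Or.inl hyw))
        · exact Or.inr (Or.inr (Or.inr ⟨far_one_of_ne (Ne.symm hyw),
            fun h => hy' (h.weaken le_rfl (by omega))⟩))
    · exact Or.inr (Or.inl ⟨far_two_of_not_adj h1.ne fun h => h2 w h rfl,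
        fun h => hx' (h.weaken le_rfl (by omega))⟩)
  have h1 := le_ncard_avoiding_colour hD x (T := H.Adj x) hx
  have h2 := (Set.ncard_le_ncard hsub (Set.toFinite _)).trans (Set.ncard_union_le _ _)
  have h3 := Set.ncard_union_le {w | Far H (1 + 1) x w ∧ ¬ Far H (1 + 1 + m) x w}
    ({y} ∪ {w | Far H (0 + 1) y w ∧ ¬ Far H (0 + 1 + (m + 1)) y w})
  have h4 := Set.ncard_union_le {y} {w | Far H (0 + 1) y w ∧ ¬ Far H (0 + 1 + (m + 1)) y w}
  have h5 := (ncard_annulus_le (z := x) hH.deg 1 m).trans (Nat.mul_le_mul_left m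
    ((Set.ncard_le_one_iff (Set.toFinite _)).2 fun ha hb => hx _ _ ha hb))
  have h6 := (ncard_annulus_le (z := y) hH.deg 0 (m + 1)).trans (Nat.mul_le_mul_left (m + 1)
    ((Set.ncard_le_one_iff (Set.toFinite _)).2 fun ha hb => hy _ _ ha hb))
  rw [Set.ncard_singleton] at h4
  omega

lemma Admissible.le_ncard_joinable (hH : Admissible G c ℓ H)
    (hD : ∀ v a, D ≤ colourDeg1 G c v a) {z w : V} (hzw : H.Adj z w) :
    D ≤ {v | Joinable G c H z w v ∧ Far H (ℓ + 1) z v}.ncard + 2 * ℓ := by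
  have hsub : {v | Joinable G c H z w v} ⊆ {v | Joinable G c H z w v ∧ Far H (ℓ + 1) z v} ∪
      {v | Far H (0 + 1) z v ∧ ¬ Far H (0 + 1 + ℓ) z v} := by
    intro v hv
    by_cases h : Far H (ℓ + 1) z v
    · exact Or.inl ⟨hv, h⟩
    · exact Or.inr ⟨far_one_of_ne hv.1.ne, fun h' => h (h'.weaken le_rfl (by omega))⟩
  have h1 := le_ncard_avoiding_colour hD z (T := fun t => H.Adj z t ∧ t ≠ w) (by
    rintro s t ⟨hs, hs'⟩ ⟨ht, ht'⟩
    rcases hH.deg z s t w hs ht hzw with h | h | h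
    exacts [h, absurd h hs', absurd h ht'])
  have h2 := (Set.ncard_le_ncard hsub (Set.toFinite _)).trans (Set.ncard_union_le _ _)
  have h3 := (ncard_annulus_le (z := z) hH.deg 0 ℓ).trans (Nat.mul_le_mul_left ℓ
    (hH.ncard_neighborSet_le z))
  simp only [and_imp] at h1
  change D ≤ {v | Joinable G c H z w v}.ncard at h1
  omega

lemma IsMaxAdmissible.not_joinable_of_two (hc : ∀ u v, c u v = c v u)
    (hH : IsMaxAdmissible G c ℓ H) (hm : ℓ ≤ m) (hm2 : 2 ≤ m) {x y w z u v z' : V} (hxy : x ≠ y)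
    (hx : ∀ u v, H.Adj x u → H.Adj x v → u = v) (hy : ∀ u v, H.Adj y u → H.Adj y v → u = v)
    (hw : Candidate G c H m x y w) (hwz : Exposes c H w (c x w) z)
    (hu : Candidate G c H m y x u) (huz : Exposes c H u (c y u) z')
    (hv : Candidate G c H m y x v) (hvz : Exposes c H v (c y v) z') (huv : u ≠ v)
    (huw : u = w → c x w = c y u → z = z') (hvw : v = w → c x w = c y v → z = z')
    (hfar : Far H (ℓ + 1) z z') : ¬ Joinable G c H z w z' := fun hj => by
  have h1 := hH.not_joinable hc hm hm2 hxy hx hy hw hu hwz huz huw hfar hj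
  have h2 := hH.not_joinable hc hm hm2 hxy hx hy hw hv hwz hvz hvw hfar hj
  have hadj := hj.1.symm
  have hu' := huz.1.symm
  have hv' := hvz.1.symm
  have hp := hH.1.proper z' u v hu' hv' huv
  refine h1 ⟨hadj, fun t ht htu htz => h2 ⟨hadj, fun s hs hsv hsz => hp ?_⟩⟩
  have ht' := hH.1.deg z' t u v ht hu' hv'
  have hs' := hH.1.deg z' s u v hs hu' hv'
  have : t = v := by tauto
  have : s = u := by tauto
  subst t s
  exact hsz.trans htz.symm

lemma Candidate.exists_adj {x y w : V}
    (hH : IsMaxAdmissible G c ℓ H) (hm : ℓ ≤ m)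
    (hx : ∀ u v, H.Adj x u → H.Adj x v → u = v) (hw : Candidate G c H m x y w) :
    ∃ z, H.Adj w z := by
  by_contra! h
  exact hH.not_accepts hw.1 ⟨hx, hw.2.1⟩ (hw.2.2.1.weaken le_rfl hm)
    ⟨fun u _ hu => absurd hu (h u), fun u hu => absurd hu (h u)⟩

lemma IsMaxAdmissible.false_of_two_deficient (hc : ∀ u v, c u v = c v u)
    (hH : IsMaxAdmissible G c ℓ H) (hm : ℓ ≤ m) (hm2 : 2 ≤ m)
    (hD : ∀ v a, D ≤ colourDeg1 G c v a)
    (hDn : 2 * Fintype.card V + 4 * ℓ + 2 * m ≤ 3 * D + 1) {x y : V} (hxy : x ≠ y)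
    (hx : ∀ u v, H.Adj x u → H.Adj x v → u = v) (hy : ∀ u v, H.Adj y u → H.Adj y v → u = v) :
    False := by
  classical
  have : Nonempty V := ⟨x⟩
  choose! e he using fun w (hw : ∃ z, H.Adj w z) => (hH.1.exists_exposes hw.choose_spec)
  have hA : ∀ {w}, Candidate G c H m x y w → Exposes c H w (c x w) (e w (c x w)) := fun {w} hw =>
    he w (hw.exists_adj hH hm hx) _
  have hB : ∀ {w}, Candidate G c H m y x w → Exposes c H w (c y w) (e w (c y w)) := fun {w} hw =>
    he w (hw.exists_adj hH hm hy) _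
  have hfib : ∀ (S : Finset V) (f : V → V), (∀ w ∈ S, H.Adj (f w) w) →
      ∀ z, (S.filter fun w => f w = z).card ≤ 2 := by
    intro S f hf z
    rw [← Set.ncard_coe_finset]
    refine le_trans (Set.ncard_le_ncard ?_ (Set.toFinite _)) (hH.1.ncard_neighborSet_le z)
    intro w hw
    rw [Finset.mem_coe, Finset.mem_filter] at hw
    exact hw.2 ▸ hf w hw.1
  have hDV : D ≤ Fintype.card V := by
    refine (hD x 0).trans ?_
    rw [← Nat.card_eq_fintype_card, ← Set.ncard_univ]
    exact Set.ncard_le_ncard (Set.subset_univ _) (Set.toFinite _)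
  have cA := hH.1.le_ncard_candidate hD hm2 hx hy
  have cB := hH.1.le_ncard_candidate hD hm2 hy hx
  rw [Set.ncard_eq_toFinset_card _ (Set.toFinite _)] at cA cB
  obtain ⟨w, hw, u, hu, h1, h2⟩ := exists_reciprocal_pair
    (A := (Set.toFinite {w | Candidate G c H m x y w}).toFinset)
    (B := (Set.toFinite {w | Candidate G c H m y x w}).toFinset)
    (f := fun w => e w (c x w)) (g := fun u => e u (c y u))
    (P := fun w => (Set.toFinite {v | Joinable G c H (e w (c x w)) w v ∧
      Far H (ℓ + 1) (e w (c x w)) v}).toFinset)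
    (Q := fun u => (Set.toFinite {v | Joinable G c H (e u (c y u)) u v ∧
      Far H (ℓ + 1) (e u (c y u)) v}).toFinset) (q := D - 2 * ℓ)
    (hfib _ _ fun w hw => (hA (by simpa using hw)).1.symm)
    (hfib _ _ fun w hw => (hB (by simpa using hw)).1.symm)
    (fun w hw => by
      rw [← Set.ncard_eq_toFinset_card]
      have := hH.1.le_ncard_joinable hD (hA (w := w) (by simpa using hw)).1.symm
      omega)
    (fun w hw => by
      rw [← Set.ncard_eq_toFinset_card]
      have := hH.1.le_ncard_joinable hD (hB (w := w) (by simpa using hw)).1.symm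
      omega)
    (by
      intro w hw u hu v hv huv huv' hmem
      simp only [Set.Finite.mem_toFinset, Set.mem_ofPred_eq] at hw hu hv hmem
      exact hH.not_joinable_of_two hc hm hm2 hxy hx hy hw (hA hw) hu (hB hu) hv
        (huv' ▸ hB hv) huv (fun h h' => by rw [h', h])
        (fun h h' => by rw [huv', h', h]) hmem.2 hmem.1)
    (by
      intro w hw u hu v hv huv huv' hmem
      simp only [Set.Finite.mem_toFinset, Set.mem_ofPred_eq] at hw hu hv hmem
      exact hH.not_joinable_of_two hc hm hm2 hxy.symm hy hx hw (hB hw) hu (hA hu) hv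
        (huv' ▸ hA hv) huv (fun h h' => by rw [h', h])
        (fun h h' => by rw [huv', h', h]) hmem.2 hmem.1)
    (Finset.card_pos.1 (by omega)) (by omega) (by omega)
  simp only [Set.Finite.mem_toFinset, Set.mem_ofPred_eq] at hw hu h1 h2
  exact hH.not_joinable hc hm hm2 hxy hx hy hw hu (hA hw) (hB hu)
    (fun h h' => by rw [h', h]) h1.2 h1.1 h2.1

end TwoDeficient

section TwoFactor

variable {G : SimpleGraph V} {c : V → V → ℕ} {ℓ D : ℕ} {H : SimpleGraph V}

lemma exists_isMaxAdmissible [Finite V] (G : SimpleGraph V) (c : V → V → ℕ) (ℓ : ℕ) :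
    ∃ H, IsMaxAdmissible G c ℓ H := by
  obtain ⟨H, hH, hmax⟩ := Set.exists_max_image {H | Admissible G c ℓ H}
    (fun H => H.edgeSet.ncard) (Set.toFinite _)
    ⟨⊥, { le := bot_le
          deg := by simp
          proper := by simp
          girth := by simp }⟩
  exact ⟨H, hH, hmax⟩

/-- A maximum admissible subgraph with a deficient vertex can be modified to have two. -/
lemma IsMaxAdmissible.exists_two_deficient [Fintype V] (hc : ∀ u v, c u v = c v u)
    (hH : IsMaxAdmissible G c ℓ H) (hG : ∀ v, ∃ w, G.Adj v w) {x : V}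
    (hx : ∀ u v, H.Adj x u → H.Adj x v → u = v) :
    ∃ K, IsMaxAdmissible G c ℓ K ∧ ∃ x y, x ≠ y ∧ (∀ u v, K.Adj x u → K.Adj x v → u = v) ∧
      ∀ u v, K.Adj y u → K.Adj y v → u = v := by
  classical
  by_contra! hno
  have hdef : ∀ y, y ≠ x → ∃ u v, H.Adj y u ∧ H.Adj y v ∧ u ≠ v := fun y hy =>
    hno H hH x y hy.symm hx
  by_cases hx0 : ∃ u, H.Adj x u
  · obtain ⟨u, hu⟩ := hx0
    have hodd : Odd (H.degree x) := by
      have : H.degree x = 1 := (H.degree_eq_one_iff_existsUnique_adj).2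
        ⟨u, hu, fun v hv => hx v u hv hu⟩
      simp [this]
    obtain ⟨y, hyx, hy⟩ := H.exists_ne_odd_degree_of_exists_odd_degree x hodd
    obtain ⟨a, b, ha, hb, hab⟩ := hdef y hyx
    have h2 : 1 < H.degree y := Finset.one_lt_card.2
      ⟨a, (H.mem_neighborFinset y a).2 ha, b, (H.mem_neighborFinset y b).2 hb, hab⟩
    have h3 := hH.1.ncard_neighborSet_le y
    rw [Set.ncard_eq_toFinset_card'] at h3
    change H.degree y ≤ 2 at h3
    have : H.degree y = 2 := by omega
    rw [this] at hy
    exact absurd hy (by decide)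
  · push Not at hx0
    obtain ⟨w, hw⟩ := hG x
    obtain ⟨a, -, ha, -⟩ := hdef w hw.ne'
    obtain ⟨z, hz⟩ := hH.1.exists_exposes ha (c x w)
    have hzx : z ≠ x := fun h => hx0 w (h ▸ hz.1.symm)
    have hfar : Far H ℓ x w := fun p => by
      cases p with
      | nil => exact absurd rfl hw.ne
      | cons h p => exact absurd h (hx0 _)
    have hK := hH.exchange hc hx hw (fun v hv => absurd hv (hx0 v)) hfar hz
    obtain ⟨u, v, hu, hv, huv⟩ := hno _ hK x z hzx.symm (by
      intro u v hu hv
      have := hx0 u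
      have := hx0 v
      simp only [sup_adj, edge_adj, deleteEdges_adj] at hu hv
      grind)
    have := hH.1.deg z u v w
    have := hz.1.symm
    have := hz.1.ne
    simp only [sup_adj, edge_adj, deleteEdges_adj, Set.mem_singleton_iff, Sym2.eq_iff] at hu hv
    grind

lemma exists_two_regular_admissible [Fintype V] {m : ℕ} (hc : ∀ u v, c u v = c v u)
    (hm : ℓ ≤ m) (hm2 : 2 ≤ m) (hD : ∀ v a, D ≤ colourDeg1 G c v a)
    (hDn : 2 * Fintype.card V + 4 * ℓ + 2 * m ≤ 3 * D + 1) :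
    ∃ H, Admissible G c ℓ H ∧ ∀ v, (H.neighborSet v).ncard = 2 := by
  obtain ⟨H, hH⟩ := exists_isMaxAdmissible G c ℓ
  refine ⟨H, hH.1, fun v => (hH.1.ncard_neighborSet_le v).antisymm ?_⟩
  by_contra! h
  obtain ⟨K, hK, x, y, hxy, hx, hy⟩ := hH.exists_two_deficient hc (x := v) (fun v => by
      have h0 : 0 < colourDeg1 G c v 0 := by have := hD v 0; omega
      obtain ⟨w, hw, -⟩ := (Set.ncard_pos (Set.toFinite _)).1 h0
      exact ⟨w, hw⟩)
    (fun a b ha hb => (Set.ncard_le_one_iff (Set.toFinite _)).1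
      (show (H.neighborSet v).ncard ≤ 1 by omega) ha hb)
  exact hK.false_of_two_deficient hc hm hm2 hD hDn hxy hx hy

lemma isPCWalk_of_getElem (l : List V)
    (hadj : ∀ i (h : i + 1 < l.length), G.Adj l[i] l[i + 1])
    (hcol : ∀ i (h : i + 2 < l.length), c l[i] l[i + 1] ≠ c l[i + 1] l[i + 2]) :
    IsPCWalk G c l := by
  induction l with
  | nil => simp [IsPCWalk]
  | cons a l ih =>
    match l, ih with
    | [], _ => simp [IsPCWalk]
    | [b], _ => simpa [IsPCWalk] using hadj 0 (by simp)
    | b :: d :: l, ih =>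
      refine ⟨hadj 0 (by simp), hcol 0 (by simp), ih (fun i h => ?_) fun i h => ?_⟩
      · exact hadj (i + 1) (by simpa using h)
      · exact hcol (i + 1) (by simpa using h)

/-- The vertices of a cycle of `H`, each listed once, form a properly coloured cycle. -/
lemma Admissible.isPCCycle (hc : ∀ u v, c u v = c v u) (hH : Admissible G c ℓ H) {v : V}
    {p : H.Walk v v} (hp : p.IsCycle) : IsPCCycle G c p.support.tail := by
  have hlen : p.support.tail.length = p.length := by simp
  have h3 := hp.three_le_length
  have hget : ∀ i (h : i < (p.support.tail ++ p.support.tail.take 2).length),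
      (p.support.tail ++ p.support.tail.take 2)[i] = p.getVert (i % p.length + 1) := by
    intro i h
    have hi : i < p.length + 2 := by
      simp at h; omega
    rw [List.getElem_append]
    split_ifs with h'
    · rw [hlen] at h'
      simp [Nat.mod_eq_of_lt h', SimpleGraph.Walk.support_getElem_eq_getVert]
    · rw [hlen] at h'
      have : i % p.length = i - p.length := by
        rw [Nat.mod_eq_sub_mod (by omega), Nat.mod_eq_of_lt (by omega)]
      simp [this, SimpleGraph.Walk.support_getElem_eq_getVert]
  have hadj : ∀ i, H.Adj (p.getVert (i % p.length + 1)) (p.getVert ((i + 1) % p.length + 1)) := by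
    intro i
    have hlt := Nat.mod_lt i (show 0 < p.length by omega)
    rw [Nat.add_mod, Nat.mod_eq_of_lt (show 1 < p.length by omega)]
    rcases Nat.lt_or_ge (i % p.length + 1) p.length with h | h
    · rw [Nat.mod_eq_of_lt h]
      exact p.adj_getVert_succ h
    · have : i % p.length + 1 = p.length := by omega
      rw [this, Nat.mod_self, p.getVert_length]
      simpa using p.adj_getVert_succ (i := 0) (by omega)
  have hinj : ∀ i j, i < p.length → j < p.length → p.getVert (i + 1) = p.getVert (j + 1) →
      i = j := by
    intro i j hi hj h
    have := hp.getVert_injOn (show i + 1 ∈ _ by constructor <;> omega)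
      (show j + 1 ∈ _ by constructor <;> omega) h
    omega
  refine ⟨hlen ▸ h3, hp.support_nodup, isPCWalk_of_getElem _ ?_ ?_⟩
  · intro i h
    rw [hget, hget]
    exact hH.le (hadj i)
  · intro i h
    rw [hget, hget, hget, hc]
    refine hH.proper _ _ _ (hadj i).symm (hadj (i + 1)) fun h' => ?_
    have hpos : 0 < p.length := by omega
    have := hinj _ _ (Nat.mod_lt _ hpos) (Nat.mod_lt _ hpos) h'
    have : 2 % p.length = 0 := by
      have : (i + 0) ≡ i + 2 [MOD p.length] := this
      exact (Nat.ModEq.add_left_cancel' i this).symm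
    rw [Nat.mod_eq_of_lt (by omega)] at this
    omega

lemma Admissible.lt_length (hH : Admissible G c ℓ H) {v : V} {p : H.Walk v v}
    (hp : p.IsCycle) : ℓ < p.length := by
  cases p with
  | nil => exact absurd hp SimpleGraph.Walk.not_isCycle_nil
  | @cons _ u _ h p =>
    rw [SimpleGraph.Walk.cons_isCycle_iff] at hp
    have := (hH.girth v u h).symm (p.toDeleteEdges {s(v, u)} (by
      rintro e he rfl
      exact hp.2 he))
    simpa [Nat.lt_succ_iff] using this

/-- The cycles of a two-regular admissible subgraph form a properly coloured two-factor. -/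
lemma Admissible.exists_two_factor [Finite V] (hc : ∀ u v, c u v = c v u)
    (hH : Admissible G c ℓ H) (hreg : ∀ v, (H.neighborSet v).ncard = 2) :
    ∃ S : Finset (List V),
      (∀ l ∈ S, IsPCCycle G c l ∧ ℓ < l.length) ∧
      (∀ l ∈ S, ∀ l' ∈ S, l ≠ l' → ∀ v, v ∈ l → v ∉ l') ∧
      (∀ v : V, ∃ l ∈ S, v ∈ l) := by
  classical
  have hex : ∀ C : H.ConnectedComponent, ∃ l : List V,
      IsPCCycle G c l ∧ ℓ < l.length ∧ ∀ v, v ∈ l ↔ v ∈ C.supp := by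
    intro C
    obtain ⟨v, hv⟩ := C.nonempty_supp
    have hne : (H.neighborSet v).Nonempty := (Set.ncard_pos (Set.toFinite _)).1 (by simp [hreg])
    obtain ⟨p, hp, hpC⟩ :=
      SimpleGraph.IsCycles.exists_cycle_toSubgraph_verts_eq_connectedComponentSupp
      (fun v _ => hreg v) hv hne
    refine ⟨p.support.tail, hH.isPCCycle hc hp, by simpa using hH.lt_length hp, fun u => ?_⟩
    rw [← hpC, SimpleGraph.Walk.mem_verts_toSubgraph]
    refine ⟨List.mem_of_mem_tail, fun h => ?_⟩
    rcases SimpleGraph.Walk.mem_support_iff p |>.1 h with rfl | h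
    · exact SimpleGraph.Walk.end_mem_tail_support hp.not_nil
    · exact h
  choose L hL1 hL2 hL3 using hex
  have := Fintype.ofFinite H.ConnectedComponent
  refine ⟨Finset.univ.image L, ?_, ?_, fun v => ⟨L (H.connectedComponentMk v), by simp, ?_⟩⟩
  · simp only [Finset.mem_image, Finset.mem_univ, true_and, forall_exists_index,
      forall_apply_eq_imp_iff]
    exact fun C => ⟨hL1 C, hL2 C⟩
  · simp only [Finset.mem_image, Finset.mem_univ, true_and, forall_exists_index,
      forall_apply_eq_imp_iff]
    intro C C' hne v hv hv'
    rw [hL3, SimpleGraph.ConnectedComponent.mem_supp_iff] at hv hv'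
    exact hne (by rw [← hv, ← hv'])
  · rw [hL3, SimpleGraph.ConnectedComponent.mem_supp_iff]

end TwoFactor

end

/-- For every integer `k ≥ 1`, every edge-coloured graph on `n` vertices with
`δ₁^c(G) ≥ 2n/3 + k` contains a properly coloured 2-factor in which every cycle has length at
least `k/2`. -/
theorem stmt5 {V : Type*} [Fintype V] (G : SimpleGraph V) (c : V → V → ℕ)
    (hc : ∀ u v, c u v = c v u) (k : ℕ) (hk : 1 ≤ k)
    (hδ : ∀ (v : V) (a : ℕ),
      (2 * (Fintype.card V : ℝ)) / 3 + k ≤ colourDeg1 G c v a) :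
    ∃ S : Finset (List V),
      (∀ l ∈ S, IsPCCycle G c l ∧ k ≤ 2 * l.length) ∧
      (∀ l ∈ S, ∀ l' ∈ S, l ≠ l' → ∀ v, v ∈ l → v ∉ l') ∧
      (∀ v : V, ∃ l ∈ S, v ∈ l) := by
  have hD : ∀ v a, (2 * Fintype.card V + 3 * k + 2) / 3 ≤ colourDeg1 G c v a := fun v a => by
    have h := hδ v a
    have : ((2 * Fintype.card V + 3 * k : ℕ) : ℝ) ≤ (3 * colourDeg1 G c v a : ℕ) := by
      push_cast
      linarith
    have := Nat.cast_le.1 this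
    omega
  obtain ⟨H, hH, hreg⟩ := exists_two_regular_admissible (ℓ := (k - 1) / 2)
    (m := max ((k - 1) / 2) 2) hc (le_max_left _ _) (le_max_right _ _) hD (by omega)
  obtain ⟨S, h1, h2, h3⟩ := hH.exists_two_factor hc hreg
  exact ⟨S, fun l hl => ⟨(h1 l hl).1, by have := (h1 l hl).2; omega⟩, h2, h3⟩
end
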